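/- Fix an integer n ≥ 2. There exists a constant c = c(n) such that for every polynomial f ∈ ℤ[x_1,…,x_n] of total degree d ≥ 1 which is irreducible in ℚ[x_1,…,x_n], and every real B ≥ 1, one has N_aff(f,B) ≤ c · d^{3(n−1)} · B^{n−2+1/d} · (log B + d). -/

import Mathlib

open MvPolynomial

/-- The number of integral points of height at most `B` on the zero set of `f`. -/
noncomputable def Naff {n : ℕ} (f : MvPolynomial (Fin n) ℤ) (B : ℝ) : ℕ :=
  Set.ncard {x : Fin n → ℤ | MvPolynomial.eval x f = 0 ∧ ∀ i, (|x i| : ℝ) ≤ B}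

/-- The linear form with coefficients `c`. -/
noncomputable def linForm {K : Type*} [CommSemiring K] {n : ℕ} (c : Fin n → K) :
    MvPolynomial (Fin n) K :=
  ∑ i, MvPolynomial.C (c i) * MvPolynomial.X i

/-- `f` is NCC (not cylindrical over a curve) over `K`: it cannot be written as
`g(ℓ₁(x), ℓ₂(x))` for linear forms `ℓ₁, ℓ₂` over `K` and `g ∈ K[y₁,y₂]`. -/
def IsNCC {K : Type*} [CommSemiring K] {n : ℕ} (f : MvPolynomial (Fin n) K) : Prop :=
  ¬ ∃ (c c' : Fin n → K) (g : MvPolynomial (Fin 2) K),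
      f = MvPolynomial.aeval ![linForm c, linForm c'] g

/-- `f` is `r`-irreducible: every divisor of `f` of total degree at most `r` is a unit. -/
def RIrreducible {K : Type*} [CommSemiring K] {n : ℕ} (r : ℕ) (f : MvPolynomial (Fin n) K) : Prop :=
  ∀ g : MvPolynomial (Fin n) K, g ∣ f → g.totalDegree ≤ r → IsUnit g

/-! ### Dimension counts for polynomials of bounded total degree -/

/-- The exponents in `n` variables of total degree at most `k`. -/
noncomputable def expLE (n k : ℕ) : Finset (Fin n →₀ ℕ) :=
  (Finset.range (k + 1)).biUnion fun j => (Finset.univ : Finset (Fin n)).finsuppAntidiag j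

theorem mem_expLE {n k : ℕ} {m : Fin n →₀ ℕ} : m ∈ expLE n k ↔ m.degree ≤ k := by
  simp [expLE, Finset.mem_finsuppAntidiag, Finsupp.degree_eq_sum]

theorem card_expLE (n k : ℕ) : (expLE n k).card = (k + n).choose n := by
  rw [expLE, Finset.card_biUnion]
  · simp only [Finset.card_finsuppAntidiag_nat_eq_multichoose, Finset.card_univ, Fintype.card_fin]
    rw [Nat.sum_range_multichoose]
  · intro i _ j _ hij
    rw [Function.onFun, Finset.disjoint_left]
    intro m hm hm'
    rw [Finset.mem_finsuppAntidiag] at hm hm'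
    exact hij (hm.1.symm.trans hm'.1)

section
variable {K : Type*} [Field K] {n : ℕ}

/-- Polynomials in `n` variables of total degree at most `k`. -/
noncomputable abbrev polyLE (K : Type*) [Field K] (n k : ℕ) : Submodule K (MvPolynomial (Fin n) K) :=
  restrictTotalDegree (Fin n) K k

theorem finrank_polyLE (k : ℕ) : Module.finrank K (polyLE K n k) = (k + n).choose n := by
  have hb := basisRestrictSupport K {m : Fin n →₀ ℕ | (m.sum fun _ e => e) ≤ k}
  have : {m : Fin n →₀ ℕ | (m.sum fun _ e => e) ≤ k} = (expLE n k : Set (Fin n →₀ ℕ)) := by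
    ext m
    simp [mem_expLE, Finsupp.degree_eq_sum, Finsupp.sum_fintype]
  change Module.finrank K (restrictSupport K {m : Fin n →₀ ℕ | (m.sum fun _ e => e) ≤ k}) = _
  rw [this] at hb ⊢
  rw [Module.finrank_eq_card_basis hb]
  simp [card_expLE]

/-- Multiplication by `f` on polynomials of degree at most `k`. -/
theorem finrank_mul_polyLE {f : MvPolynomial (Fin n) K} (hf : f ≠ 0) (k : ℕ) :
    Module.finrank K ((polyLE K n k).map (LinearMap.mulLeft K f)) = (k + n).choose n := by
  rw [← finrank_polyLE (K := K)]
  refine (LinearEquiv.finrank_eq (Submodule.equivMapOfInjective _ ?_ _)).symm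
  intro a b h
  exact mul_left_cancel₀ hf h

theorem finrank_map_polyLE_add_le {f g : MvPolynomial (Fin n) K} (hf : Irreducible f)
    (hfg : ¬ f ∣ g) {V : Type*} [AddCommGroup V] [Module K V] (T : MvPolynomial (Fin n) K →ₗ[K] V)
    (hTf : ∀ q, T (f * q) = 0) (hTg : ∀ q, T (g * q) = 0) (m : ℕ) {d e : ℕ}
    (hd : f.totalDegree = d) (he : g.totalDegree = e) :
    Module.finrank K ((polyLE K n (m + d + e)).map T) + (m + e + n).choose n + (m + d + n).choose n
      ≤ (m + d + e + n).choose n + (m + n).choose n := by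
  have hf0 := hf.ne_zero
  have hg0 : g ≠ 0 := by rintro rfl; exact hfg (dvd_zero _)
  set P := polyLE K n (m + d + e) with hP
  set A := (polyLE K n (m + e)).map (LinearMap.mulLeft K f)
  set B := (polyLE K n (m + d)).map (LinearMap.mulLeft K g)
  set C := (polyLE K n m).map (LinearMap.mulLeft K (f * g))
  have hA : Module.finrank K A = _ := finrank_mul_polyLE hf0 (m + e)
  have hB : Module.finrank K B = _ := finrank_mul_polyLE hg0 (m + d)
  have hC : Module.finrank K C = _ := finrank_mul_polyLE (mul_ne_zero hf0 hg0) m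
  have hAB : A ⊓ B ≤ C := by
    rintro _ ⟨⟨a, ha, rfl⟩, ⟨b, hb, hab⟩⟩
    simp only [LinearMap.mulLeft_apply] at hab
    have hfb : f ∣ b := by
      have : f ∣ g * b := ⟨a, hab⟩
      exact (hf.prime.dvd_or_dvd this).resolve_left hfg
    obtain ⟨c, rfl⟩ := hfb
    refine ⟨c, ?_, ?_⟩
    · rw [SetLike.mem_coe, mem_restrictTotalDegree] at hb ⊢
      rcases eq_or_ne c 0 with rfl | hc
      · simp
      rw [totalDegree_mul_of_isDomain hf0 hc] at hb
      lia
    · simp only [LinearMap.mulLeft_apply]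
      rw [← hab]; ring
  have h1 := Submodule.finrank_sup_add_finrank_inf_eq A B
  have h2 := Submodule.finrank_mono hAB
  have hAP : A ≤ P := by
    rintro _ ⟨a, ha, rfl⟩
    rw [SetLike.mem_coe, mem_restrictTotalDegree] at ha
    rw [hP, mem_restrictTotalDegree]
    exact (totalDegree_mul _ _).trans (by lia)
  have hBP : B ≤ P := by
    rintro _ ⟨a, ha, rfl⟩
    rw [SetLike.mem_coe, mem_restrictTotalDegree] at ha
    rw [hP, mem_restrictTotalDegree]
    exact (totalDegree_mul _ _).trans (by lia)
  have h3 := LinearMap.finrank_range_add_finrank_ker (T.domRestrict P)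
  have h4 : Module.finrank K (A ⊔ B : Submodule K (MvPolynomial (Fin n) K)) ≤
      Module.finrank K (T.domRestrict P).ker := by
    have hle : A ⊔ B ≤ P := sup_le hAP hBP
    rw [← LinearEquiv.finrank_eq (Submodule.comapSubtypeEquivOfLe hle)]
    apply Submodule.finrank_mono
    intro x hx
    rw [Submodule.mem_comap, Submodule.coe_subtype] at hx
    rw [LinearMap.mem_ker, LinearMap.domRestrict_apply]
    have : A ⊔ B ≤ T.ker := by
      apply sup_le
      · rintro _ ⟨a, _, rfl⟩; exact hTf a
      · rintro _ ⟨a, _, rfl⟩; exact hTg a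
    exact this hx
  have h5 : (T.domRestrict P).range = P.map T := by
    rw [LinearMap.range_domRestrict]
  rw [h5, finrank_polyLE] at h3
  lia

theorem choose_second_difference_le (n m d e : ℕ) :
    (m + d + e + (n + 2)).choose (n + 2) + (m + (n + 2)).choose (n + 2) ≤
      (m + e + (n + 2)).choose (n + 2) + (m + d + (n + 2)).choose (n + 2)
        + d * e * (m + d + e + n).choose n := by
  have step : ∀ a e : ℕ, (a + e + (n + 1)).choose (n + 1) ≤ (a + (n + 1)).choose (n + 1)
      + e * (a + e + n).choose n := by
    intro a e
    induction e with
    | zero => simp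
    | succ e ih =>
      have h1 : (a + (e + 1) + (n + 1)).choose (n + 1) = (a + e + (n + 1)).choose n
          + (a + e + (n + 1)).choose (n + 1) := by
        rw [show a + (e + 1) + (n + 1) = (a + e + (n + 1)) + 1 by ring, Nat.choose_succ_succ]
      have h2 : (a + e + n).choose n ≤ (a + (e + 1) + n).choose n :=
        Nat.choose_le_choose n (by lia)
      have h3 : (a + e + (n + 1)) = a + (e + 1) + n := by ring
      rw [h1, h3]
      rw [h3] at ih
      nlinarith [Nat.mul_le_mul_left e h2]
  induction d with
  | zero => simp
  | succ d ih =>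
    have h1 : (m + (d + 1) + e + (n + 2)).choose (n + 2) = (m + d + e + (n + 2)).choose (n + 1)
        + (m + d + e + (n + 2)).choose (n + 2) := by
      rw [show m + (d + 1) + e + (n + 2) = (m + d + e + (n + 2)) + 1 by ring, Nat.choose_succ_succ]
    have h2 : (m + (d + 1) + (n + 2)).choose (n + 2) = (m + d + (n + 2)).choose (n + 1)
        + (m + d + (n + 2)).choose (n + 2) := by
      rw [show m + (d + 1) + (n + 2) = (m + d + (n + 2)) + 1 by ring, Nat.choose_succ_succ]
    have h3 := step (m + d + 1) e
    rw [show m + d + 1 + e + (n + 1) = m + d + e + (n + 2) by ring,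
      show m + d + 1 + (n + 1) = m + d + (n + 2) by ring,
      show m + d + 1 + e + n = m + (d + 1) + e + n by ring] at h3
    have h4 : (m + d + e + n).choose n ≤ (m + (d + 1) + e + n).choose n :=
        Nat.choose_le_choose n (by lia)
    nlinarith [Nat.mul_le_mul_left (d * e) h4]

/-- If `T` kills the multiples of `f` and `g`, with `f` irreducible not dividing `g`, then the
image under `T` of the polynomials of bounded degree is small. -/
theorem finrank_map_polyLE_le {f g : MvPolynomial (Fin (n + 2)) K} (hf : Irreducible f)
    (hfg : ¬ f ∣ g) {V : Type*} [AddCommGroup V] [Module K V]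
    (T : MvPolynomial (Fin (n + 2)) K →ₗ[K] V)
    (hTf : ∀ q, T (f * q) = 0) (hTg : ∀ q, T (g * q) = 0) {k : ℕ} {d e : ℕ}
    (hd : f.totalDegree = d) (he : g.totalDegree = e) (hk : d + e ≤ k) :
    Module.finrank K ((polyLE K (n + 2) k).map T) ≤ d * e * (k + n).choose n := by
  obtain ⟨m, rfl⟩ := Nat.exists_eq_add_of_le' hk
  have h1 := finrank_map_polyLE_add_le hf hfg T hTf hTg m hd he
  have h2 := choose_second_difference_le n m d e
  rw [← add_assoc]
  lia

end

section
variable {K : Type*} [Field K]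

/-- If `T` is onto a finite-dimensional space and kills the multiples of two plane curves without
common component, the dimension is at most the product of the degrees. -/
theorem finrank_le_mul_of_surjective {f g : MvPolynomial (Fin 2) K} (hf : Irreducible f)
    (hfg : ¬ f ∣ g) {V : Type*} [AddCommGroup V] [Module K V] [FiniteDimensional K V]
    (T : MvPolynomial (Fin 2) K →ₗ[K] V) (hT : Function.Surjective T)
    (hTf : ∀ q, T (f * q) = 0) (hTg : ∀ q, T (g * q) = 0) :
    Module.finrank K V ≤ f.totalDegree * g.totalDegree := by
  set b := Module.finBasis K V
  choose q hq using fun i => hT (b i)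
  set k := f.totalDegree + g.totalDegree + ∑ i, (q i).totalDegree
  have h := finrank_map_polyLE_le (n := 0) hf hfg T hTf hTg (k := k) rfl rfl (by lia)
  have htop : (polyLE K 2 k).map T = ⊤ := by
    rw [eq_top_iff, ← b.span_eq, Submodule.span_le]
    rintro _ ⟨i, rfl⟩
    refine ⟨q i, ?_, hq i⟩
    rw [SetLike.mem_coe, mem_restrictTotalDegree]
    have := Finset.single_le_sum (f := fun i => (q i).totalDegree) (fun _ _ => Nat.zero_le _)
      (Finset.mem_univ i)
    lia
  rw [htop, finrank_top] at h
  simpa using h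

/-- Evaluation at a finite set of points. -/
noncomputable def evalOn {n : ℕ} (S : Finset (Fin n → K)) :
    MvPolynomial (Fin n) K →ₗ[K] (S → K) where
  toFun q := fun P => eval P.1 q
  map_add' := by intros; ext; simp
  map_smul' := by intros; ext; simp [smul_eval]

theorem exists_separating {n : ℕ} [DecidableEq (Fin n → K)] (S : Finset (Fin n → K)) (P : Fin n → K) :
    ∃ q : MvPolynomial (Fin n) K, eval P q = 1 ∧ ∀ Q ∈ S, Q ≠ P → eval Q q = 0 := by
  classical
  have h : ∀ Q : Fin n → K, ∃ l : MvPolynomial (Fin n) K, Q ≠ P → eval P l = 1 ∧ eval Q l = 0 := by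
    intro Q
    by_cases hQ : Q = P
    · exact ⟨0, fun h => absurd hQ h⟩
    obtain ⟨i, hi⟩ := Function.ne_iff.mp hQ
    refine ⟨C (P i - Q i)⁻¹ * (X i - C (Q i)), fun _ => ⟨?_, by simp⟩⟩
    have : P i - Q i ≠ 0 := sub_ne_zero.mpr (Ne.symm hi)
    simp [this]
  choose l hl using h
  refine ⟨∏ Q ∈ S.erase P, l Q, ?_, ?_⟩
  · rw [map_prod]
    exact Finset.prod_eq_one fun Q hQ => (hl Q (Finset.ne_of_mem_erase hQ)).1
  · intro Q hQ hQP
    rw [map_prod]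
    exact Finset.prod_eq_zero (Finset.mem_erase.mpr ⟨hQP, hQ⟩) (hl Q hQP).2

theorem evalOn_surjective {n : ℕ} (S : Finset (Fin n → K)) : Function.Surjective (evalOn S) := by
  classical
  intro v
  choose q hq1 hq0 using fun P => exists_separating S P
  refine ⟨∑ P ∈ S.attach, C (v P) * q P.1, ?_⟩
  ext Q
  simp only [evalOn, LinearMap.coe_mk, AddHom.coe_mk, map_sum, map_mul, eval_C, Finset.sum_apply]
  rw [Finset.sum_eq_single Q]
  · rw [hq1, mul_one]
  · intro P _ hPQ
    rw [hq0 P.1 Q.1 Q.2 (fun h => hPQ (Subtype.ext h.symm)), mul_zero]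
  · simp

/-- Bezout's inequality for plane curves. -/
theorem card_common_zeros_le {f g : MvPolynomial (Fin 2) K} (hf : Irreducible f)
    (hfg : ¬ f ∣ g) (S : Finset (Fin 2 → K)) (hSf : ∀ P ∈ S, eval P f = 0)
    (hSg : ∀ P ∈ S, eval P g = 0) : S.card ≤ f.totalDegree * g.totalDegree := by
  have h := finrank_le_mul_of_surjective hf hfg (evalOn S) (evalOn_surjective S)
    (fun q => by ext P; simp [evalOn, hSf P.1 P.2]) (fun q => by ext P; simp [evalOn, hSg P.1 P.2])
  simpa using h

end

/-- The number of common zeros in a grid `{-b,…,b}ⁿ` of an irreducible `f` and `g` with `f ∤ g`. -/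
theorem card_common_zeros_grid_le {n : ℕ} {f g : MvPolynomial (Fin (n + 2)) ℚ} (hf : Irreducible f)
    (hfg : ¬ f ∣ g) (b : ℕ) (S : Finset (Fin (n + 2) → ℤ)) (hSb : ∀ P ∈ S, ∀ i, |P i| ≤ b)
    (hSf : ∀ P ∈ S, eval (fun i => (P i : ℚ)) f = 0)
    (hSg : ∀ P ∈ S, eval (fun i => (P i : ℚ)) g = 0) :
    S.card ≤ f.totalDegree * g.totalDegree *
      (f.totalDegree + g.totalDegree + (n + 2) * (2 * b + 1) + n).choose n := by
  classical
  let T : MvPolynomial (Fin (n + 2)) ℚ →ₗ[ℚ] (S → ℚ) :=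
    { toFun := fun q P => eval (fun i => ((P.1 i : ℤ) : ℚ)) q
      map_add' := by intros; ext; simp
      map_smul' := by intros; ext; simp [smul_eval] }
  have h := finrank_map_polyLE_le (k := f.totalDegree + g.totalDegree + (n + 2) * (2 * b + 1)) hf hfg T
    (fun q => by ext P; simp [T, hSf P.1 P.2]) (fun q => by ext P; simp [T, hSg P.1 P.2])
    rfl rfl (by lia)
  have htop : (polyLE ℚ (n + 2) (f.totalDegree + g.totalDegree + (n + 2) * (2 * b + 1))).map T = ⊤ := by
    rw [eq_top_iff]
    intro v _
    let q : (Fin (n + 2) → ℤ) → MvPolynomial (Fin (n + 2)) ℚ := fun P =>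
      ∏ i, ∏ j ∈ (Finset.Icc (-b : ℤ) b).erase (P i),
        (C ((P i : ℚ) - j)⁻¹ * (X i - C (j : ℚ)))
    have hq1 : ∀ P : Fin (n + 2) → ℤ, eval (fun i => (P i : ℚ)) (q P) = 1 := by
      intro P
      simp only [q, map_prod]
      refine Finset.prod_eq_one fun i _ => Finset.prod_eq_one fun j hj => ?_
      have : (P i : ℚ) - j ≠ 0 := by
        rw [sub_ne_zero]; exact_mod_cast (Finset.ne_of_mem_erase hj).symm
      simp [this]
    have hq0 : ∀ P Q : Fin (n + 2) → ℤ, (∀ i, |Q i| ≤ b) → Q ≠ P →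
        eval (fun i => (Q i : ℚ)) (q P) = 0 := by
      intro P Q hQ hne
      obtain ⟨i, hi⟩ := Function.ne_iff.mp hne
      simp only [q, map_prod]
      refine Finset.prod_eq_zero (Finset.mem_univ i) (Finset.prod_eq_zero (i := Q i) ?_ (by simp))
      rw [Finset.mem_erase, Finset.mem_Icc]
      exact ⟨hi, abs_le.mp (hQ i)⟩
    have hqd : ∀ P : Fin (n + 2) → ℤ, (q P).totalDegree ≤ (n + 2) * (2 * b + 1) := by
      intro P
      refine (totalDegree_finsetProd _ _).trans ?_
      refine (Finset.sum_le_card_nsmul _ _ (2 * b + 1) fun i _ => ?_).trans (by simp)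
      refine (totalDegree_finsetProd _ _).trans ?_
      refine (Finset.sum_le_card_nsmul _ _ 1 fun j _ => ?_).trans ?_
      · refine (totalDegree_mul _ _).trans ?_
        have := totalDegree_sub (X i : MvPolynomial (Fin (n + 2)) ℚ) (C (j : ℚ))
        simp only [totalDegree_C, totalDegree_X] at this ⊢
        simpa using this
      · refine (Nat.mul_le_mul_right 1 (Finset.card_erase_le)).trans ?_
        simp; lia
    refine ⟨∑ P ∈ S.attach, C (v P) * q P.1, ?_, ?_⟩
    · apply Submodule.sum_mem
      intro P _
      rw [mem_restrictTotalDegree]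
      refine (totalDegree_mul _ _).trans ?_
      have := hqd P.1
      simp only [totalDegree_C]
      lia
    · ext Q
      simp only [T, LinearMap.coe_mk, AddHom.coe_mk, map_sum, map_mul, eval_C, Finset.sum_apply]
      rw [Finset.sum_eq_single Q]
      · rw [hq1, mul_one]
      · intro P _ hPQ
        rw [hq0 P.1 Q.1 (hSb _ Q.2) (fun h => hPQ (Subtype.ext h.symm)), mul_zero]
      · simp
  rw [htop, finrank_top] at h
  simpa using h

theorem totalDegree_pderiv_le {σ R : Type*} [CommSemiring R] (i : σ) (f : MvPolynomial σ R) :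
    (pderiv i f).totalDegree ≤ f.totalDegree - 1 := by
  classical
  conv_lhs => rw [f.as_sum, map_sum]
  refine totalDegree_finsetSum_le fun s hs => ?_
  rw [pderiv_monomial]
  rcases Nat.eq_zero_or_pos (s i) with h | h
  · simp [h]
  refine (totalDegree_monomial_le _ _).trans ?_
  have h1 := le_totalDegree hs
  have h2 : s.degree = (s - Finsupp.single i 1).degree + 1 := by
    conv_lhs => rw [← tsub_add_cancel_of_le (Finsupp.single_le_iff.mpr (Nat.one_le_iff_ne_zero.mpr h.ne'))]
    rw [map_add, Finsupp.degree_single]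
  change (s - Finsupp.single i 1).degree ≤ _
  change s.degree ≤ _ at h1
  lia

/-! ### Jets along a plane curve -/

section Jets
variable {K : Type*} [Field K]

/-- The Hamiltonian vector field of `f`. -/
noncomputable def hamD (f : MvPolynomial (Fin 2) K) :
    Derivation K (MvPolynomial (Fin 2) K) (MvPolynomial (Fin 2) K) :=
  (pderiv 1 f) • pderiv 0 - (pderiv 0 f) • pderiv 1

theorem hamD_apply (f q : MvPolynomial (Fin 2) K) :
    hamD f q = pderiv 1 f * pderiv 0 q - pderiv 0 f * pderiv 1 q := by
  simp [hamD]

theorem hamD_self (f : MvPolynomial (Fin 2) K) : hamD f f = 0 := by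
  rw [hamD_apply]; ring

theorem totalDegree_hamD_le (f q : MvPolynomial (Fin 2) K) :
    (hamD f q).totalDegree ≤ q.totalDegree + f.totalDegree := by
  rw [hamD_apply]
  have h := fun i => totalDegree_pderiv_le i f
  have h' := fun i => totalDegree_pderiv_le i q
  refine (totalDegree_sub _ _).trans (max_le ?_ ?_) <;>
  refine (totalDegree_mul _ _).trans ?_
  · have := h 1; have := h' 0; lia
  · have := h 0; have := h' 1; lia

theorem hamD_iterate_mul (f q : MvPolynomial (Fin 2) K) (k : ℕ) :
    (hamD f)^[k] (f * q) = f * (hamD f)^[k] q := by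
  induction k with
  | zero => rfl
  | succ k ih =>
    rw [Function.iterate_succ_apply', Function.iterate_succ_apply', ih, Derivation.leibniz, hamD_self]
    simp

theorem totalDegree_hamD_iterate_le (f q : MvPolynomial (Fin 2) K) (k : ℕ) :
    ((hamD f)^[k] q).totalDegree ≤ q.totalDegree + k * f.totalDegree := by
  induction k with
  | zero => simp
  | succ k ih =>
    rw [Function.iterate_succ_apply']
    have := totalDegree_hamD_le f ((hamD f)^[k] q)
    rw [add_mul]; lia

theorem derivation_iterate_mul {A : Type*} [CommRing A] [Algebra K A] (D : Derivation K A A) (a b : A)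
    (k : ℕ) : D^[k] (a * b) =
      ∑ i ∈ Finset.range (k + 1), (k.choose i : A) * (D^[i] a * D^[k - i] b) := by
  have h : ∀ k (c : A), D^[k] c = (D.toLinearMap ^ k) c := fun k c => by
    rw [Module.End.pow_apply]; rfl
  induction k with
  | zero => simp
  | succ k ih =>
    rw [Function.iterate_succ_apply', ih, map_sum]
    have : ∀ i ∈ Finset.range (k + 1), D ((k.choose i : A) * (D^[i] a * D^[k - i] b)) =
        (k.choose i : A) * (D^[i + 1] a * D^[k - i] b) +
          (k.choose i : A) * (D^[i] a * D^[k + 1 - i] b) := by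
      intro i hi
      have hi' : k + 1 - i = (k - i) + 1 := by
        have := Finset.mem_range.mp hi; lia
      rw [hi', Function.iterate_succ_apply', Function.iterate_succ_apply', Derivation.leibniz,
        Derivation.leibniz, Derivation.map_natCast]
      simp only [smul_eq_mul]; ring
    rw [Finset.sum_congr rfl this, Finset.sum_add_distrib, Finset.sum_range_succ' _ (k + 1),
      Finset.sum_range_succ (fun i => (k.choose i : A) * (D^[i + 1] a * D^[k - i] b))]
    have h2 := Finset.sum_range_succ' (fun i => (k.choose i : A) * (D^[i] a * D^[k + 1 - i] b)) k
    rw [h2, Finset.sum_range_succ _ k]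
    have h3 : ∀ i, ((k + 1).choose (i + 1) : A) * (D^[i + 1] a * D^[k + 1 - (i + 1)] b) =
      (k.choose i : A) * (D^[i + 1] a * D^[k - i] b) +
        (k.choose (i + 1) : A) * (D^[i + 1] a * D^[k + 1 - (i + 1)] b) := by
      intro i
      rw [Nat.choose_succ_succ, Nat.add_sub_add_right]; push_cast; ring
    simp only [h3, Finset.sum_add_distrib]
    simp
    ring

/-- `q` vanishes to order `m` at `P` along the flow of `D`. -/
def JetVanish (f : MvPolynomial (Fin 2) K) (P : Fin 2 → K) (m : ℕ) (q : MvPolynomial (Fin 2) K) :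
    Prop :=
  ∀ k < m, eval P ((hamD f)^[k] q) = 0

theorem JetVanish.mul {f q r : MvPolynomial (Fin 2) K} {P : Fin 2 → K} {i j : ℕ}
    (hq : JetVanish f P i q) (hr : JetVanish f P j r) : JetVanish f P (i + j) (q * r) := by
  intro k hk
  rw [derivation_iterate_mul, map_sum]
  refine Finset.sum_eq_zero fun l hl => ?_
  rw [map_mul, map_mul]
  rcases lt_or_ge l i with h | h
  · rw [hq l h]; simp
  · rw [hr (k - l) (by have := Finset.mem_range.mp hl; lia)]; simp

theorem JetVanish.pow {f q : MvPolynomial (Fin 2) K} {P : Fin 2 → K}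
    (hq : JetVanish f P 1 q) (j : ℕ) : JetVanish f P j (q ^ j) := by
  induction j with
  | zero => intro k hk; lia
  | succ j ih => rw [pow_succ]; exact ih.mul hq

theorem jetVanish_one {f q : MvPolynomial (Fin 2) K} {P : Fin 2 → K} :
    JetVanish f P 1 q ↔ eval P q = 0 := by
  simp [JetVanish]

theorem JetVanish.mul_right {f q : MvPolynomial (Fin 2) K} {P : Fin 2 → K} {i : ℕ}
    (hq : JetVanish f P i q) (r : MvPolynomial (Fin 2) K) : JetVanish f P i (q * r) := by
  have := hq.mul (r := r) (j := 0) (fun k hk => by lia)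
  simpa using this

theorem eval_hamD_iterate_pow (f w : MvPolynomial (Fin 2) K) (P : Fin 2 → K) (j : ℕ) :
    eval P ((hamD f)^[j] ((X 0 - C (P 0)) ^ j * w)) =
      j.factorial * eval P (pderiv 1 f) ^ j * eval P w := by
  induction j generalizing w with
  | zero => simp
  | succ j ih =>
    have hz : eval P (X 0 - C (P 0)) = 0 := by simp
    rw [Function.iterate_succ_apply, Derivation.leibniz, Derivation.leibniz_pow]
    have hx : hamD f (X 0 - C (P 0)) = pderiv 1 f := by
      rw [hamD_apply]; simp [pderiv_X]
    rw [hx]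
    have e : (X 0 - C (P 0) : MvPolynomial (Fin 2) K) ^ (j + 1) • (hamD f) w +
        w • (j + 1) • (X 0 - C (P 0) : MvPolynomial (Fin 2) K) ^ (j + 1 - 1) • (pderiv 1) f =
        (X 0 - C (P 0)) ^ j * ((X 0 - C (P 0)) * hamD f w + ((j + 1 : ℕ) : MvPolynomial (Fin 2) K) *
          (w * pderiv 1 f)) := by
      simp only [smul_eq_mul, nsmul_eq_mul, Nat.add_sub_cancel]; ring
    rw [e, ih]
    simp only [map_add, map_mul, hz, map_natCast, Nat.factorial_succ]
    push_cast; ring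

/-- The jet map of order `m` along `S`. -/
noncomputable def jetMap (f : MvPolynomial (Fin 2) K) (S : Finset (Fin 2 → K)) (m : ℕ) :
    MvPolynomial (Fin 2) K →ₗ[K] (S × Fin m → K) where
  toFun q := fun a => eval a.1.1 ((hamD f)^[a.2] q)
  map_add' a b := by
    ext x
    have h : ∀ k (c : MvPolynomial (Fin 2) K), (hamD f)^[k] c = ((hamD f).toLinearMap ^ k) c :=
      fun k c => by rw [Module.End.pow_apply]; rfl
    simp [h]
  map_smul' a b := by
    ext x
    have h : ∀ k (c : MvPolynomial (Fin 2) K), (hamD f)^[k] c = ((hamD f).toLinearMap ^ k) c :=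
      fun k c => by rw [Module.End.pow_apply]; rfl
    simp [h, smul_eval]

theorem jetMap_surjective {f : MvPolynomial (Fin 2) K} {S : Finset (Fin 2 → K)} {m : ℕ}
    (hm : (m.factorial : K) ≠ 0) (hS : ∀ P ∈ S, eval P (pderiv 1 f) ≠ 0) :
    Function.Surjective (jetMap f S m) := by
  classical
  rw [← LinearMap.range_eq_top]
  by_contra hne
  obtain ⟨φ, hφ0, hφ⟩ := Submodule.exists_le_ker_of_lt_top _ (lt_top_iff_ne_top.mpr hne)
  set c : S × Fin m → K := fun a => φ (Pi.single a 1)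
  have hφc : ∀ v, φ v = ∑ a, v a * c a := by
    intro v
    conv_lhs => rw [pi_eq_sum_univ' v]
    simp [c, map_sum]
  obtain ⟨⟨P, k⟩, hPk⟩ : ∃ a, c a ≠ 0 := by
    by_contra! h
    apply hφ0
    ext v
    simp [c] at h
    simp [h]
  obtain ⟨k, hk, hmax⟩ := (Finset.univ.filter fun k => c (P, k) ≠ 0).exists_max_image id
    ⟨k, by simp [hPk]⟩
  obtain ⟨e, he1, he0⟩ := exists_separating S P.1
  set h := (X 0 - C (P.1 0)) ^ (k : ℕ) * e ^ m
  have h0 : φ (jetMap f S m h) = 0 := hφ ⟨h, rfl⟩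
  rw [hφc, Finset.sum_eq_single (P, k)] at h0
  · simp only [jetMap, LinearMap.coe_mk, AddHom.coe_mk, h, eval_hamD_iterate_pow, map_pow, he1,
      one_pow, mul_one] at h0
    have : ((k : ℕ).factorial : K) ≠ 0 := by
      obtain ⟨r, hr⟩ := Nat.factorial_dvd_factorial (show (k : ℕ) ≤ m from k.2.le)
      intro h
      apply hm
      rw [hr]; push_cast; rw [h, zero_mul]
    rcases mul_eq_zero.mp h0 with h0 | h0
    · rcases mul_eq_zero.mp h0 with h0 | h0
      · exact this h0
      · exact hS _ P.2 (eq_zero_of_pow_eq_zero h0)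
    · exact (Finset.mem_filter.mp hk).2 h0
  · rintro ⟨Q, j⟩ _ hne
    by_cases hQ : Q = P
    · subst hQ
      rcases lt_trichotomy j k with hj | hj | hj
      · have : JetVanish f Q.1 (k : ℕ) h :=
          (JetVanish.pow (jetVanish_one.mpr (by simp)) _).mul_right _
        change eval Q.1 ((hamD f)^[j] h) * _ = 0
        rw [this j (by exact_mod_cast hj), zero_mul]
      · exact absurd (by rw [hj]) hne
      · have : c (Q, j) = 0 := by
          by_contra hc
          exact absurd (hmax j (by simp [hc])) (by simpa using hj)
        rw [this, mul_zero]
    · have : JetVanish f Q.1 m h := by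
        rw [show h = e ^ m * (X 0 - C (P.1 0)) ^ (k : ℕ) from mul_comm _ _]
        exact (JetVanish.pow (jetVanish_one.mpr (he0 _ Q.2 (fun h => hQ (Subtype.ext h)))) _).mul_right _
      change eval Q.1 ((hamD f)^[j] h) * _ = 0
      rw [this j j.2, zero_mul]
  · simp

/-- Bezout's inequality with multiplicities. -/
theorem mul_card_le_of_jetVanish {f q : MvPolynomial (Fin 2) K} (hf : Irreducible f)
    (hfq : ¬ f ∣ q) {S : Finset (Fin 2 → K)} {m : ℕ}
    (hm : (m.factorial : K) ≠ 0) (hSf : ∀ P ∈ S, eval P f = 0)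
    (hS : ∀ P ∈ S, eval P (pderiv 1 f) ≠ 0) (hq : ∀ P ∈ S, JetVanish f P m q) :
    m * S.card ≤ f.totalDegree * q.totalDegree := by
  have h := finrank_le_mul_of_surjective hf hfq (jetMap f S m) (jetMap_surjective hm hS)
    (fun r => by
      ext a
      simp [jetMap, hamD_iterate_mul, hSf a.1.1 a.1.2])
    (fun r => by
      ext a
      exact (hq a.1.1 a.1.2).mul_right r a.2 a.2.2)
  simpa [mul_comm] using h

end Jets

/-! ### Standard monomials modulo a plane curve -/

section Std
variable {K : Type*} [Field K]

open Classical in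
/-- Exponents of degree at most `k` not divisible by the leading exponent of `f`. -/
noncomputable def stdExp (f : MvPolynomial (Fin 2) K) (k : ℕ) : Finset (Fin 2 →₀ ℕ) :=
  (expLE 2 k).filter fun m => ¬ MonomialOrder.degLex.degree f ≤ m

theorem mem_stdExp {f : MvPolynomial (Fin 2) K} {k : ℕ} {m : Fin 2 →₀ ℕ} :
    m ∈ stdExp f k ↔ m.degree ≤ k ∧ ¬ MonomialOrder.degLex.degree f ≤ m := by
  simp [stdExp, mem_expLE]

theorem card_stdExp (f : MvPolynomial (Fin 2) K) (k : ℕ) :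
    (stdExp f (k + f.totalDegree)).card + (k + 2).choose 2 = (k + f.totalDegree + 2).choose 2 := by
  classical
  rw [← card_expLE 2 (k + f.totalDegree), stdExp,
    ← Finset.card_filter_add_card_filter_not (s := expLE 2 (k + f.totalDegree))
      (p := fun m => ¬ MonomialOrder.degLex.degree f ≤ m)]
  congr 1
  rw [← card_expLE]
  set β := MonomialOrder.degLex.degree f
  have hβ : β.degree = f.totalDegree := degree_degLexDegree
  refine Finset.card_bij (fun m _ => β + m) ?_ ?_ ?_
  · intro m hm
    rw [mem_expLE] at hm
    simp only [Finset.mem_filter, mem_expLE, not_not, map_add]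
    exact ⟨by lia, le_self_add⟩
  · intro a _ b _ h; exact add_left_cancel h
  · intro b hb
    simp only [Finset.mem_filter, mem_expLE, not_not] at hb
    obtain ⟨c, rfl⟩ := exists_add_of_le hb.2
    refine ⟨c, ?_, rfl⟩
    rw [mem_expLE]
    rw [map_add] at hb
    lia

/-- Twice the number of standard exponents. -/
theorem two_mul_card_stdExp {f : MvPolynomial (Fin 2) K} {d : ℕ} (hd : f.totalDegree = d) {k : ℕ}
    (hk : d ≤ k) : (2 * (stdExp f k).card : ℤ) = d * (2 * k - d + 3) := by
  obtain ⟨k, rfl⟩ := Nat.exists_eq_add_of_le' hk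
  have h := card_stdExp f k
  rw [hd] at h
  have h2 : ∀ n : ℕ, (2 * ((n + 2).choose 2 : ℕ) : ℤ) = (n + 2) * (n + 1) := by
    intro n
    rw [Nat.choose_two_right]
    have : 2 * ((n + 2) * (n + 2 - 1) / 2) = (n + 2) * (n + 2 - 1) :=
      Nat.mul_div_cancel' (Nat.even_mul_pred_self (n + 2)).two_dvd
    rw [show n + 2 - 1 = n + 1 by lia] at this ⊢
    exact_mod_cast this
  have h3 := h2 (k + d)
  have h4 := h2 k
  zify at h
  push_cast at h3 ⊢
  linear_combination 2 * h + h3 - h4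

theorem eq_zero_of_dvd_of_std {f q : MvPolynomial (Fin 2) K} (hf : f ≠ 0)
    (hq : ∀ m ∈ q.support, ¬ MonomialOrder.degLex.degree f ≤ m) (h : f ∣ q) : q = 0 := by
  by_contra hq0
  obtain ⟨r, rfl⟩ := h
  have hr : r ≠ 0 := right_ne_zero_of_mul hq0
  refine hq _ (MonomialOrder.degree_mem_support (m := MonomialOrder.degLex) hq0) ?_
  rw [MonomialOrder.degree_mul hf hr]
  exact le_self_add

theorem support_sum_monomial_subset {S : Finset (Fin 2 →₀ ℕ)} (c : (Fin 2 →₀ ℕ) → K) :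
    (∑ i ∈ S, monomial i (c i)).support ⊆ S := by
  classical
  intro m hm
  rw [mem_support_iff, coeff_sum] at hm
  by_contra h
  apply hm
  refine Finset.sum_eq_zero fun i hi => ?_
  rw [coeff_monomial, if_neg]
  rintro rfl; exact h hi

theorem coeff_sum_monomial {S : Finset (Fin 2 →₀ ℕ)} (c : (Fin 2 →₀ ℕ) → K) {i} (hi : i ∈ S) :
    coeff i (∑ i ∈ S, monomial i (c i)) = c i := by
  classical
  rw [coeff_sum, Finset.sum_eq_single i]
  · simp
  · intro j _ hj; rw [coeff_monomial, if_neg hj]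
  · intro h; exact absurd hi h

theorem std_sum_eq_zero {f : MvPolynomial (Fin 2) K} (hf : f ≠ 0) {k : ℕ}
    (c : (Fin 2 →₀ ℕ) → K) (h : f ∣ ∑ i ∈ stdExp f k, monomial i (c i)) :
    ∀ i ∈ stdExp f k, c i = 0 := by
  intro i hi
  rw [← coeff_sum_monomial c hi, eq_zero_of_dvd_of_std hf _ h, coeff_zero]
  intro m hm
  exact (mem_stdExp.mp (support_sum_monomial_subset c hm)).2

theorem totalDegree_std_sum_le {f : MvPolynomial (Fin 2) K} {k : ℕ} (c : (Fin 2 →₀ ℕ) → K) :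
    (∑ i ∈ stdExp f k, monomial i (c i)).totalDegree ≤ k := by
  refine totalDegree_finsetSum_le fun i hi => (totalDegree_monomial_le _ _).trans ?_
  exact (mem_stdExp.mp hi).1

/-- The polynomials of degree at most `k` modulo `f`. -/
noncomputable abbrev quotLE (f : MvPolynomial (Fin 2) K) (k : ℕ) :
    Submodule K (MvPolynomial (Fin 2) K ⧸ Ideal.span {f}) :=
  (polyLE K 2 k).map (Ideal.Quotient.mkₐ K (Ideal.span {f})).toLinearMap

theorem finrank_quotLE_le {f : MvPolynomial (Fin 2) K} (hf : f ≠ 0) {k : ℕ}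
    (hk : f.totalDegree ≤ k) : Module.finrank K (quotLE f k) ≤ (stdExp f k).card := by
  obtain ⟨k, rfl⟩ := Nat.exists_eq_add_of_le' hk
  have h1 := card_stdExp f k
  set P := polyLE K 2 (k + f.totalDegree)
  set T := (Ideal.Quotient.mkₐ K (Ideal.span {f})).toLinearMap
  have h3 := LinearMap.finrank_range_add_finrank_ker (T.domRestrict P)
  rw [LinearMap.range_domRestrict, finrank_polyLE] at h3
  have hAP : (polyLE K 2 k).map (LinearMap.mulLeft K f) ≤ P := by
    rintro _ ⟨a, ha, rfl⟩
    rw [SetLike.mem_coe, mem_restrictTotalDegree] at ha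
    rw [mem_restrictTotalDegree]
    exact (totalDegree_mul _ _).trans (by lia)
  have h4 : Module.finrank K ((polyLE K 2 k).map (LinearMap.mulLeft K f)) ≤
      Module.finrank K (T.domRestrict P).ker := by
    rw [← LinearEquiv.finrank_eq (Submodule.comapSubtypeEquivOfLe hAP)]
    apply Submodule.finrank_mono
    rintro x ⟨a, _, hx⟩
    rw [LinearMap.mem_ker, LinearMap.domRestrict_apply]
    rw [Submodule.subtype_apply] at hx
    rw [← hx]
    change Ideal.Quotient.mk (Ideal.span {f}) (f * a) = 0
    rw [Ideal.Quotient.eq_zero_iff_mem]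
    exact Ideal.mul_mem_right _ _ (Ideal.mem_span_singleton_self f)
  rw [finrank_mul_polyLE hf] at h4
  change Module.finrank K (P.map T) ≤ _
  omega

end Std

/-! ### Stepanov's method over prime fields -/

section Stepanov
variable {p : ℕ} [hp : Fact p.Prime]

theorem hamD_iterate_mul_pow_char (f a b : MvPolynomial (Fin 2) (ZMod p)) (k : ℕ) :
    (hamD f)^[k] (a * b ^ p) = (hamD f)^[k] a * b ^ p := by
  induction k with
  | zero => rfl
  | succ k ih =>
    have : (p : MvPolynomial (Fin 2) (ZMod p)) = 0 := by
      rw [← map_natCast (C : ZMod p →+* MvPolynomial (Fin 2) (ZMod p)), ZMod.natCast_self, map_zero]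
    rw [Function.iterate_succ_apply', Function.iterate_succ_apply', ih, Derivation.leibniz,
      Derivation.leibniz_pow, nsmul_eq_mul, this]
    simp [mul_comm]

theorem hamD_iterate_sum {K ι : Type*} [Field K] (f : MvPolynomial (Fin 2) K) (k : ℕ) (s : Finset ι)
    (q : ι → MvPolynomial (Fin 2) K) :
    (hamD f)^[k] (∑ i ∈ s, q i) = ∑ i ∈ s, (hamD f)^[k] (q i) := by
  have h : ∀ (c : MvPolynomial (Fin 2) K), (hamD f)^[k] c = ((hamD f).toLinearMap ^ k) c :=
    fun c => by rw [Module.End.pow_apply]; rfl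
  simp only [h, map_sum]

theorem exists_stepanov_coeffs {K : Type*} [Field K] {f : MvPolynomial (Fin 2) K} (hf : f ≠ 0)
    {A J m : ℕ} (hA : f.totalDegree ≤ A)
    (hlt : ∑ k ∈ Finset.range m, (stdExp f (A + J + k * f.totalDegree)).card <
      (stdExp f A).card * (stdExp f J).card) :
    ∃ l : (Fin 2 →₀ ℕ) → (Fin 2 →₀ ℕ) → K, (∃ i ∈ stdExp f A, ∃ j ∈ stdExp f J, l i j ≠ 0) ∧
      ∀ k < m, f ∣ ∑ i ∈ stdExp f A, (hamD f)^[k] (monomial i 1) *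
        ∑ j ∈ stdExp f J, monomial j (l i j) := by
  classical
  set I := Ideal.span {f}
  let Φ : ℕ → (stdExp f A × stdExp f J → K) →ₗ[K] MvPolynomial (Fin 2) K := fun k =>
    { toFun := fun l => ∑ i : stdExp f A, (hamD f)^[k] (monomial i.1 1) *
        ∑ j : stdExp f J, monomial j.1 (l (i, j))
      map_add' := by
        intro a b
        simp only [Pi.add_apply, map_add, Finset.sum_add_distrib, mul_add]
      map_smul' := by
        intro a b
        simp only [Pi.smul_apply, smul_eq_mul, RingHom.id_apply, Finset.smul_sum, ← mul_smul_comm,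
          smul_monomial] }
  have hΦ : ∀ k l, Φ k l ∈ polyLE K 2 (A + J + k * f.totalDegree) := by
    intro k l
    rw [mem_restrictTotalDegree]
    refine totalDegree_finsetSum_le fun i _ => (totalDegree_mul _ _).trans ?_
    have h1 := totalDegree_hamD_iterate_le f (monomial i.1 (1 : K)) k
    have h2 : (monomial i.1 (1 : K)).totalDegree ≤ A :=
      (totalDegree_monomial_le _ _).trans (mem_stdExp.mp i.2).1
    have h3 : (∑ j : stdExp f J, monomial j.1 (l (i, j))).totalDegree ≤ J :=
      totalDegree_finsetSum_le fun j _ =>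
        (totalDegree_monomial_le _ _).trans (mem_stdExp.mp j.2).1
    lia
  let L : (stdExp f A × stdExp f J → K) →ₗ[K] ((k : Fin m) → quotLE f (A + J + k * f.totalDegree)) :=
    LinearMap.pi fun k => LinearMap.codRestrict _
      ((Ideal.Quotient.mkₐ K I).toLinearMap ∘ₗ Φ k) fun l => ⟨Φ k l, hΦ k l, rfl⟩
  have hL : L.ker ≠ ⊥ := by
    apply LinearMap.ker_ne_bot_of_finrank_lt
    rw [Module.finrank_pi_fintype]
    have : Module.finrank K (stdExp f A × stdExp f J → K) = (stdExp f A).card * (stdExp f J).card := by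
      simp
    rw [this]
    refine lt_of_le_of_lt ?_ hlt
    rw [← Fin.sum_univ_eq_sum_range (fun k => (stdExp f (A + J + k * f.totalDegree)).card)]
    refine Finset.sum_le_sum fun k _ => finrank_quotLE_le hf ?_
    exact hA.trans (by rw [add_assoc]; exact Nat.le_add_right _ _)
  obtain ⟨l, hl, hl0⟩ := Submodule.exists_mem_ne_zero_of_ne_bot hL
  have hsum : ∀ k, Φ k l = ∑ i ∈ stdExp f A, (hamD f)^[k] (monomial i 1) *
        ∑ j ∈ stdExp f J, monomial j
          (if h : i ∈ stdExp f A ∧ j ∈ stdExp f J then l (⟨i, h.1⟩, ⟨j, h.2⟩) else 0) := by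
    intro k
    change ∑ i : stdExp f A, (hamD f)^[k] (monomial i.1 1) *
        ∑ j : stdExp f J, monomial j.1 (l (i, j)) = _
    rw [← Finset.sum_coe_sort (stdExp f A)]
    refine Finset.sum_congr rfl fun i _ => ?_
    rw [← Finset.sum_coe_sort (stdExp f J)]
    congr 1
    refine Finset.sum_congr rfl fun j _ => ?_
    rw [dif_pos ⟨i.2, j.2⟩]
  refine ⟨fun i j => if h : i ∈ stdExp f A ∧ j ∈ stdExp f J then l (⟨i, h.1⟩, ⟨j, h.2⟩) else 0,
    ?_, ?_⟩
  · obtain ⟨⟨i, j⟩, hij⟩ := Function.ne_iff.mp hl0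
    refine ⟨i, i.2, j, j.2, ?_⟩
    simpa using hij
  · intro k hk
    have h1 := congr_fun (LinearMap.mem_ker.mp hl) ⟨k, hk⟩
    have h2 := congrArg Subtype.val h1
    change Ideal.Quotient.mk I (Φ k l) = 0 at h2
    rw [Ideal.Quotient.eq_zero_iff_mem, Ideal.mem_span_singleton, hsum] at h2
    exact h2

theorem stepanov_core {f : MvPolynomial (Fin 2) (ZMod p)} (hf : Irreducible f) {A J m : ℕ}
    (hA : f.totalDegree ≤ A) (hAp : f.totalDegree * A + 1 < p) (hm : m < p)
    (hlt : ∑ k ∈ Finset.range m, (stdExp f (A + J + k * f.totalDegree)).card <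
      (stdExp f A).card * (stdExp f J).card)
    (S : Finset (Fin 2 → ZMod p)) (hSf : ∀ P ∈ S, eval P f = 0)
    (hS : ∀ P ∈ S, eval P (pderiv 1 f) ≠ 0) (hSJ : f.totalDegree * J < S.card) :
    m * S.card ≤ f.totalDegree * (A + p * J) := by
  classical
  have hfact : ∀ n < p, (n.factorial : ZMod p) ≠ 0 := by
    intro n hn h
    rw [ZMod.natCast_eq_zero_iff, hp.out.dvd_factorial] at h
    lia
  obtain ⟨l, ⟨i0, hi0, j0, hj0, hl0⟩, hl⟩ := exists_stepanov_coeffs hf.ne_zero hA hlt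
  set b : (Fin 2 →₀ ℕ) → MvPolynomial (Fin 2) (ZMod p) := fun i =>
    ∑ j ∈ stdExp f J, monomial j (l i j) with hb
  set g := ∑ i ∈ stdExp f A, monomial i 1 * b i ^ p with hg
  have hbJ : ∀ i, (b i).totalDegree ≤ J := fun i => totalDegree_std_sum_le _
  have hgd : g.totalDegree ≤ A + p * J := by
    refine totalDegree_finsetSum_le fun i hi => (totalDegree_mul _ _).trans ?_
    have h1 := totalDegree_pow (b i) p
    have h2 := Nat.mul_le_mul_left p (hbJ i)
    have h3 : (monomial i (1 : ZMod p)).totalDegree ≤ A :=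
      (totalDegree_monomial_le _ _).trans (mem_stdExp.mp hi).1
    lia
  have hDg : ∀ k (P : Fin 2 → ZMod p), eval P ((hamD f)^[k] g) =
      eval P (∑ i ∈ stdExp f A, (hamD f)^[k] (monomial i 1) * b i) := by
    intro k P
    rw [hg, hamD_iterate_sum]
    simp only [hamD_iterate_mul_pow_char, map_sum, map_mul, map_pow, ZMod.pow_card]
  have hfg : ¬ f ∣ g := by
    rintro ⟨r, hr⟩
    have hb0 : ∀ P ∈ S, ∀ i ∈ stdExp f A, eval P (b i) = 0 := by
      intro P hP
      apply std_sum_eq_zero hf.ne_zero (k := A)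
      by_contra hdiv
      have := mul_card_le_of_jetVanish (S := {P}) (m := p - 1) hf hdiv
        (hfact _ (by have := hp.out.pos; lia))
        (by simpa using hSf P hP) (by simpa using hS P hP) ?_
      · have h2 : (∑ i ∈ stdExp f A, monomial i (eval P (b i))).totalDegree ≤ A :=
          totalDegree_std_sum_le _
        have h3 := Nat.mul_le_mul_left f.totalDegree h2
        simp only [Finset.card_singleton, mul_one] at this
        lia
      · intro Q hQ k _
        rw [Finset.mem_singleton] at hQ
        subst hQ
        have h1 : eval Q ((hamD f)^[k] g) = 0 := by
          rw [hr, hamD_iterate_mul, map_mul, hSf Q hP, zero_mul]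
        rw [hDg, map_sum] at h1
        rw [hamD_iterate_sum, map_sum, ← h1]
        refine Finset.sum_congr rfl fun i _ => ?_
        have : monomial i (eval Q (b i)) = C (eval Q (b i)) * monomial i 1 := by
          rw [C_mul_monomial, mul_one]
        have h : ∀ (c : MvPolynomial (Fin 2) (ZMod p)),
            (hamD f)^[k] c = ((hamD f).toLinearMap ^ k) c :=
          fun c => by rw [Module.End.pow_apply]; rfl
        rw [this, ← smul_eq_C_mul, h, map_smul, ← h, smul_eval, map_mul, mul_comm]
    have hdvd : f ∣ b i0 := by
      by_contra hnd
      have := card_common_zeros_le hf hnd S hSf fun P hP => hb0 P hP i0 hi0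
      have h2 := Nat.mul_le_mul_left f.totalDegree (hbJ i0)
      lia
    exact hl0 (std_sum_eq_zero hf.ne_zero (l i0) hdvd j0 hj0)
  have h := mul_card_le_of_jetVanish hf hfg (hfact m hm) hSf hS (m := m) ?_
  · exact h.trans (Nat.mul_le_mul_left _ hgd)
  · intro P hP k hk
    rw [hDg]
    obtain ⟨r, hr⟩ := hl k hk
    rw [hr, map_mul, hSf P hP, zero_mul]

theorem stepanov_numeric {p d m a j : ℤ} (hm0 : 0 ≤ m) (hd : 1 ≤ d) (hd12 : d ≤ d ^ 2)
    (hm1 : m * m ≤ p) (hm100 : 100 * d ^ 2 ≤ m) (hJ1 : m + 6 * d ^ 2 ≤ j)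
    (hJ2 : j ≤ m + 7 * d ^ 2) (hA1 : p < 2 * a + 2 * d) (hd24 : d ^ 2 ≤ d ^ 4)
    (hpd : 10000 * d ^ 4 ≤ p) :
    2 * (m * (2 * a + 2 * j - d ^ 2 + 3 * d) + d ^ 2 * (m * (m - 1))) <
      (2 * a - d ^ 2 + 3 * d) * (2 * j - d ^ 2 + 3 * d) := by
  have ha : p - d ^ 2 ≤ 2 * a - d ^ 2 + 3 * d := by linarith
  have hj : 2 * m + 11 * d ^ 2 ≤ 2 * j - d ^ 2 + 3 * d := by linarith
  have hd2 : 1 ≤ d ^ 2 := by linarith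
  have hpm : 100 * m ≤ p := by nlinarith
  have hdp : 100 * d ^ 2 ≤ p := by linarith
  have ha0 : 0 ≤ 2 * a - d ^ 2 + 3 * d := by linarith
  have k1 := mul_le_mul_of_nonneg_left hj ha0
  have k2 := mul_le_mul_of_nonneg_right ha (by positivity : (0 : ℤ) ≤ 11 * d ^ 2)
  have k3 := mul_le_mul_of_nonneg_left hJ2 (by positivity : (0 : ℤ) ≤ 4 * m)
  have k4 := mul_le_mul_of_nonneg_left hm1 (by positivity : (0 : ℤ) ≤ 2 * d ^ 2)
  have k5 := mul_le_mul_of_nonneg_left hpm (by positivity : (0 : ℤ) ≤ d ^ 2)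
  have k6 := mul_le_mul_of_nonneg_left hdp (by positivity : (0 : ℤ) ≤ d ^ 2)
  have k7 := mul_le_mul_of_nonneg_right hd2 (by linarith : (0 : ℤ) ≤ p)
  have k8 : 0 ≤ d ^ 2 * m := by positivity
  have k9 : 0 ≤ m * d ^ 2 := by positivity
  generalize d ^ 2 = D at *
  ring_nf at k1 k2 k3 k4 k5 k6 k7 k8 k9 ⊢
  linarith

theorem stepanov_count {p d m A J t u v : ℕ} (hd : 1 ≤ d) (hd12 : d ≤ d ^ 2)
    (hm1 : m * m ≤ p) (hm100 : 100 * d ^ 2 ≤ m) (hJ1 : m + 6 * d ^ 2 ≤ d * J)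
    (hJ2 : d * J ≤ m + 7 * d ^ 2) (hA1 : p < 2 * (d * A) + 2 * d) (hd24 : d ^ 2 ≤ d ^ 4)
    (hpd : 10000 * d ^ 4 ≤ p)
    (h1 : 2 * (t : ℤ) = m * (2 * (d * A) + 2 * (d * J) - d ^ 2 + 3 * d) + d ^ 2 * (m * (m - 1)))
    (h2 : 2 * (u : ℤ) = d * (2 * A - d + 3)) (h3 : 2 * (v : ℤ) = d * (2 * J - d + 3)) :
    t < u * v := by
  have key := stepanov_numeric (p := p) (d := d) (m := m) (a := d * A) (j := d * J)
    (by positivity) (by exact_mod_cast hd) (by exact_mod_cast hd12) (by exact_mod_cast hm1)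
    (by exact_mod_cast hm100) (by exact_mod_cast hJ1) (by exact_mod_cast hJ2)
    (by exact_mod_cast hA1) (by exact_mod_cast hd24) (by exact_mod_cast hpd)
  have e : (2 * (u : ℤ)) * (2 * v) = (2 * (d * A) - d ^ 2 + 3 * d) * (2 * (d * J) - d ^ 2 + 3 * d) := by
    rw [h2, h3]; ring
  have : (t : ℤ) < u * v := by linarith
  exact_mod_cast this

set_option maxHeartbeats 1600000 in
/-- A plane curve of degree `d` irreducible over `𝔽_p` has at most `p + O(d² √p)` points with
nonvertical tangent, if `p` is large compared to `d⁴`. -/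
theorem stepanov_bound {f : MvPolynomial (Fin 2) (ZMod p)} (hf : Irreducible f) {d : ℕ}
    (hfd : f.totalDegree = d) (hd : 1 ≤ d) (hpd : 10000 * d ^ 4 ≤ p)
    (S : Finset (Fin 2 → ZMod p)) (hSf : ∀ P ∈ S, eval P f = 0)
    (hS : ∀ P ∈ S, eval P (pderiv 1 f) ≠ 0) :
    (S.card : ℝ) ≤ p + 9 * d ^ 2 * √p := by
  set m := Nat.sqrt p with hm
  have hm1 : m * m ≤ p := Nat.sqrt_le p
  have hm2 : p < (m + 1) * (m + 1) := Nat.lt_succ_sqrt p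
  have hd24 : d ^ 2 ≤ d ^ 4 := Nat.pow_le_pow_right hd (by norm_num)
  have hd12 : d ≤ d ^ 2 := by nlinarith
  have hm100 : 100 * d ^ 2 ≤ m := by
    rw [hm, Nat.le_sqrt]; calc _ = 10000 * d ^ 4 := by ring
      _ ≤ p := hpd
  set J := m / d + 1 + 6 * d with hJ
  set A := p / (2 * d) with hA
  have hJ1 : m + 6 * d ^ 2 ≤ d * J := by
    have := Nat.lt_mul_div_succ m (show 0 < d by lia)
    rw [hJ, mul_add, mul_add, mul_one]; nlinarith
  have hJ2 : d * J ≤ m + 7 * d ^ 2 := by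
    have := Nat.mul_div_le m d
    rw [hJ, mul_add, mul_add, mul_one]; nlinarith
  have hA1 : p < 2 * (d * A) + 2 * d := by
    have := Nat.lt_mul_div_succ p (show 0 < 2 * d by lia)
    rw [hA]; nlinarith
  have hA2 : 2 * (d * A) ≤ p := by
    have := Nat.mul_div_le p (2 * d)
    rw [hA]; nlinarith
  have hdA : d ≤ A := by
    rw [hA, Nat.le_div_iff_mul_le (by lia)]
    nlinarith
  have hdJ : d ≤ J := by lia
  rcases le_or_gt S.card (d * J) with hcard | hcard
  · have h1 : S.card ≤ p := by nlinarith
    have h2 : (S.card : ℝ) ≤ p := by exact_mod_cast h1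
    have : 0 ≤ 9 * (d : ℝ) ^ 2 * √p := by positivity
    linarith
  have hcore := stepanov_core hf (A := A) (J := J) (m := m) (hfd ▸ hdA) (by rw [hfd]; nlinarith)
    (by nlinarith) ?_ S hSf hS (by rw [hfd]; exact hcard)
  · rw [hfd] at hcore
    have h3 : m * S.card ≤ m * p + 8 * d ^ 2 * p := by nlinarith
    have h4 : (m : ℝ) * S.card ≤ m * p + 8 * d ^ 2 * p := by exact_mod_cast h3
    have h5 : (p : ℝ) < (m + 1) * (m + 1) := by exact_mod_cast hm2
    have h6 : √(p : ℝ) < m + 1 := by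
      rw [Real.sqrt_lt' (by positivity)]; nlinarith
    have h7 : (100 : ℝ) ≤ m := by exact_mod_cast (by nlinarith : 100 ≤ m)
    have h8 : (p : ℝ) = √p * √p := (Real.mul_self_sqrt (by positivity)).symm
    have h9 : (m : ℝ) ≤ √p := by
      apply Real.le_sqrt_of_sq_le
      exact_mod_cast (by nlinarith : m ^ 2 ≤ p)
    have h10 : (0 : ℝ) < m := by linarith
    have h11 : 8 * √(p : ℝ) ≤ 9 * m := by linarith
    have h12 : 8 * (d : ℝ) ^ 2 * p ≤ m * (9 * d ^ 2 * √p) := by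
      have : 8 * (d : ℝ) ^ 2 * p = (d ^ 2 * √p) * (8 * √p) := by
        conv_lhs => rw [h8]
        ring
      rw [this]
      have := mul_le_mul_of_nonneg_left h11 (by positivity : 0 ≤ (d : ℝ) ^ 2 * √p)
      linarith
    have h13 : (m : ℝ) * S.card ≤ m * (p + 9 * d ^ 2 * √p) := by linarith
    exact le_of_mul_le_mul_left h13 h10
  · have hs : ∀ E, d ≤ E → (2 * (stdExp f E).card : ℤ) = d * (2 * E - d + 3) :=
      fun E hE => two_mul_card_stdExp hfd hE
    have hsum : ∀ n : ℕ, 2 * ((∑ k ∈ Finset.range n, (stdExp f (A + J + k * f.totalDegree)).card : ℕ) : ℤ)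
        = n * (2 * (d * A) + 2 * (d * J) - d ^ 2 + 3 * d) + d ^ 2 * (n * (n - 1)) := by
      intro n
      induction n with
      | zero => simp
      | succ n ih =>
        rw [Finset.sum_range_succ, Nat.cast_add, mul_add, ih, hfd,
          hs _ (hdA.trans (by rw [add_assoc]; exact Nat.le_add_right _ _))]
        push_cast; ring
    have h1 := hsum m
    have h2 := hs A hdA
    have h3 := hs J hdJ
    generalize (∑ k ∈ Finset.range m, (stdExp f (A + J + k * f.totalDegree)).card) = t at h1 ⊢
    clear_value m A J
    exact stepanov_count hd hd12 hm1 hm100 hJ1 hJ2 hA1 hd24 hpd h1 h2 h3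

end Stepanov

section Newton

variable {R : Type*} [CommRing R]

theorem newton_step (q : Polynomial R) {I : Ideal R} {a c : R} {k : ℕ}
    (ha : q.eval a ∈ I ^ (k + 1)) (hc : c * q.derivative.eval a - 1 ∈ I) :
    q.eval (a - c * q.eval a) ∈ I ^ (k + 2) := by
  obtain ⟨t, ht⟩ := q.binomExpansion a (-(c * q.eval a))
  rw [sub_eq_add_neg, ht]
  have h1 : q.eval a * (c * q.derivative.eval a - 1) ∈ I ^ (k + 2) := by
    rw [pow_succ]; exact Ideal.mul_mem_mul ha hc
  have h2 : q.eval a * q.eval a ∈ I ^ (k + 2) := by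
    refine Ideal.pow_le_pow_right (show k + 2 ≤ (k + 1) + (k + 1) by lia) ?_
    rw [pow_add]; exact Ideal.mul_mem_mul ha ha
  have : q.eval a + q.derivative.eval a * -(c * q.eval a) + t * (-(c * q.eval a)) ^ 2 =
      t * c ^ 2 * (q.eval a * q.eval a) - q.eval a * (c * q.derivative.eval a - 1) := by ring
  rw [this]
  exact sub_mem (Ideal.mul_mem_left _ _ h2) h1

/-- Simplified Newton iteration with a fixed approximate inverse `c` of the derivative. -/
def newtonSeq (q : Polynomial R) (a c : R) : ℕ → R
  | 0 => a
  | k + 1 => newtonSeq q a c k - c * q.eval (newtonSeq q a c k)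

theorem newtonSeq_spec (q : Polynomial R) {I : Ideal R} {a c : R} (ha : q.eval a ∈ I)
    (hc : c * q.derivative.eval a - 1 ∈ I) (k : ℕ) :
    q.eval (newtonSeq q a c k) ∈ I ^ (k + 1) ∧ newtonSeq q a c k - a ∈ I := by
  induction k with
  | zero => simpa [newtonSeq] using ha
  | succ k ih =>
    have h1 : q.eval (newtonSeq q a c k) ∈ I := Ideal.pow_le_self (by lia) ih.1
    refine ⟨newton_step q ih.1 ?_, ?_⟩
    · have := q.derivative.sub_dvd_eval_sub (newtonSeq q a c k) a
      have h2 := Ideal.mul_mem_left I c (Ideal.mem_of_dvd I this ih.2)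
      have h3 := add_mem h2 hc
      convert h3 using 1; ring
    · have := sub_mem ih.2 (Ideal.mul_mem_left I c h1)
      convert this using 1; simp only [newtonSeq]; ring

theorem exists_root_of_isAdicComplete (I : Ideal R) [IsAdicComplete I R] (q : Polynomial R)
    {a c : R} (ha : q.eval a ∈ I) (hc : c * q.derivative.eval a - 1 ∈ I) :
    ∃ y, q.eval y = 0 ∧ y - a ∈ I := by
  have hs := newtonSeq_spec q ha hc
  have hstep : ∀ k, newtonSeq q a c k - newtonSeq q a c (k + 1) ∈ I ^ (k + 1) := fun k => by
    simpa [newtonSeq] using Ideal.mul_mem_left _ c (hs k).1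
  have hle : ∀ m n, m ≤ n → newtonSeq q a c m - newtonSeq q a c n ∈ I ^ m := by
    intro m n hmn
    induction n, hmn using Nat.le_induction with
    | base => simp
    | succ n hn ih =>
      have := add_mem ih (Ideal.pow_le_pow_right (by lia : m ≤ n + 1) (hstep n))
      simpa using this
  obtain ⟨L, hL⟩ := IsPrecomplete.prec (I := I) (M := R) inferInstance
    (f := newtonSeq q a c) (fun {m n} hmn => by
      rw [SModEq.sub_mem]; simpa using hle m n hmn)
  have hL' : ∀ k, newtonSeq q a c k - L ∈ I ^ k := fun k => by
    have := hL k; rw [SModEq.sub_mem] at this; simpa using this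
  refine ⟨L, ?_, ?_⟩
  · refine IsHausdorff.haus (I := I) inferInstance _ fun n => ?_
    rw [SModEq.sub_mem]
    have h1 := Ideal.pow_le_pow_right (by lia : n ≤ n + 1) (hs n).1
    have h2 := Ideal.mem_of_dvd _ (q.sub_dvd_eval_sub (newtonSeq q a c n) L) (hL' n)
    simpa using sub_mem h1 h2
  · have h1 := hL' 1
    rw [pow_one] at h1
    have := sub_mem (hs 1).2 h1
    simpa using this

end Newton

theorem exists_minor_ne_zero {R m n : Type*} [CommRing R] [IsDomain R] [Fintype m] [Fintype n]
    [DecidableEq n] (A : Matrix m n R) (h : ∀ v, A.mulVec v = 0 → v = 0) :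
    ∃ e : n → m, (A.submatrix e id).det ≠ 0 := by
  classical
  set K := FractionRing R
  set A' : Matrix m n K := A.map (algebraMap R K) with hA'
  have hcols : LinearIndependent R A.col := by
    rw [← Matrix.mulVec_injective_iff]
    intro v w hvw
    have := h (v - w) (by rw [Matrix.mulVec_sub, sub_eq_zero]; exact hvw)
    exact sub_eq_zero.mp this
  have hcols' : LinearIndependent K A'.col := by
    rw [← LinearIndependent.iff_fractionRing (R := R)]
    exact hcols.map_injOn ((Algebra.linearMap R K).compLeft m) (by
      refine Function.Injective.injOn fun v w hvw => ?_
      funext i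
      exact IsFractionRing.injective R K (congrFun hvw i))
  have hrank : Module.finrank K (Submodule.span K (Set.range A'.row)) = Fintype.card n := by
    rw [← Matrix.rank_eq_finrank_span_row, ← Matrix.rank_transpose]
    exact LinearIndependent.rank_matrix hcols'
  obtain ⟨g, hg, -, hli⟩ := Submodule.exists_fun_fin_finrank_span_eq K (Set.range A'.row)
  choose r hr using hg
  let σ : n ≃ Fin (Module.finrank K (Submodule.span K (Set.range A'.row))) :=
    (Fintype.equivFin n).trans (finCongr hrank.symm)
  refine ⟨r ∘ σ, fun hdet => ?_⟩
  have h1 : LinearIndependent K (A'.submatrix (r ∘ σ) id).row := by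
    have h2 := hli.comp σ σ.injective
    have h3 : (A'.submatrix (r ∘ σ) id).row = g ∘ σ := funext fun i => hr (σ i)
    rwa [h3]
  rw [Matrix.linearIndependent_rows_iff_isUnit, Matrix.isUnit_iff_isUnit_det] at h1
  apply h1.ne_zero
  have : A'.submatrix (r ∘ σ) id = (A.submatrix (r ∘ σ) id).map (algebraMap R K) := rfl
  rw [this, ← RingHom.mapMatrix_apply, ← RingHom.map_det, hdet, map_zero]

section Ruppert

variable {R : Type*} [CommRing R]

/-- The numerator of `F² d((G dx + H dy) / F)`. -/
noncomputable def closedNum (F G H : MvPolynomial (Fin 2) R) : MvPolynomial (Fin 2) R :=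
  pderiv 1 G * F - G * pderiv 1 F - pderiv 0 H * F + H * pderiv 0 F

theorem closedNum_smul_add (F G H G' H' : MvPolynomial (Fin 2) R) (s t : R) :
    closedNum F (s • G + t • G') (s • H + t • H') =
      s • closedNum F G H + t • closedNum F G' H' := by
  simp only [closedNum, map_add, Derivation.map_smul]
  simp only [smul_eq_C_mul]
  ring

theorem totalDegree_closedNum_le {F G H : MvPolynomial (Fin 2) R} {d : ℕ}
    (hF : F.totalDegree ≤ d) (hG : G.totalDegree ≤ d - 1) (hH : H.totalDegree ≤ d - 1) :
    (closedNum F G H).totalDegree ≤ 2 * d := by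
  have h := fun (i : Fin 2) (A : MvPolynomial (Fin 2) R) => totalDegree_pderiv_le i A
  have hmul := fun (A B : MvPolynomial (Fin 2) R) => totalDegree_mul A B
  refine (totalDegree_add _ _).trans (max_le ((totalDegree_sub _ _).trans (max_le
    ((totalDegree_sub _ _).trans (max_le ?_ ?_)) ?_)) ?_)
  · have := hmul (pderiv 1 G) F; have := h 1 G; lia
  · have := hmul G (pderiv 1 F); have := h 1 F; lia
  · have := hmul (pderiv 0 H) F; have := h 0 H; lia
  · have := hmul H (pderiv 0 F); have := h 0 F; lia

/-- The polynomial of degree at most `k` with the given coefficients. -/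
noncomputable def ofCoeffs {n k : ℕ} (v : expLE n k → R) : MvPolynomial (Fin n) R :=
  ∑ m, monomial m.1 (v m)

theorem coeff_ofCoeffs {n k : ℕ} (v : expLE n k → R) (m : expLE n k) :
    coeff m.1 (ofCoeffs v) = v m := by
  classical
  simp [ofCoeffs, coeff_sum, coeff_monomial]

theorem totalDegree_ofCoeffs_le {n k : ℕ} (v : expLE n k → R) :
    (ofCoeffs v).totalDegree ≤ k :=
  totalDegree_finsetSum_le fun m _ => (totalDegree_monomial_le _ _).trans (mem_expLE.mp m.2)

theorem ofCoeffs_coeff {n k : ℕ} {q : MvPolynomial (Fin n) R} (hq : q.totalDegree ≤ k) :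
    ofCoeffs (fun m : expLE n k => coeff m.1 q) = q := by
  classical
  ext m
  by_cases hm : m ∈ expLE n k
  · exact coeff_ofCoeffs _ ⟨m, hm⟩
  · rw [mem_expLE, not_le] at hm
    rw [coeff_eq_zero_of_totalDegree_lt ((totalDegree_ofCoeffs_le _).trans_lt hm),
      coeff_eq_zero_of_totalDegree_lt (hq.trans_lt hm)]

/-- The matrix of `(G, H) ↦ closedNum F G H` on polynomials of degree at most `d - 1`. -/
noncomputable def ruppert (F : MvPolynomial (Fin 2) R) (d : ℕ) :
    Matrix (expLE 2 (2 * d)) (Bool × expLE 2 (d - 1)) R := fun i j =>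
  coeff i.1 (bif j.1 then closedNum F (monomial j.2.1 1) 0 else closedNum F 0 (monomial j.2.1 1))

theorem ruppert_mulVec (F : MvPolynomial (Fin 2) R) (d : ℕ) (v : Bool × expLE 2 (d - 1) → R)
    (i : expLE 2 (2 * d)) : (ruppert F d).mulVec v i =
      coeff i.1 (closedNum F (ofCoeffs fun m => v (true, m)) (ofCoeffs fun m => v (false, m))) := by
  simp only [Matrix.mulVec, dotProduct, Fintype.sum_prod_type, Fintype.sum_bool, ruppert, cond_true,
    cond_false]
  have h2 : closedNum F (ofCoeffs fun m => v (true, m)) (ofCoeffs fun m => v (false, m)) =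
      ∑ m, C (v (true, m)) * closedNum F (monomial m.1 1) 0 +
      ∑ m, C (v (false, m)) * closedNum F 0 (monomial m.1 1) := by
    let L : MvPolynomial (Fin 2) R × MvPolynomial (Fin 2) R →ₗ[R] MvPolynomial (Fin 2) R :=
      { toFun := fun p => closedNum F p.1 p.2
        map_add' := fun p q => by
          simpa using closedNum_smul_add F p.1 p.2 q.1 q.2 1 1
        map_smul' := fun c p => by
          simpa using closedNum_smul_add F p.1 p.2 0 0 c 0 }
    have hL : ∀ G H, closedNum F G H = L (G, 0) + L (0, H) := fun G H => by
      rw [← map_add]; simp [L]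
    have hG : ∀ w : expLE 2 (d - 1) → R, L (ofCoeffs w, 0) =
        ∑ m, C (w m) * closedNum F (monomial m.1 1) 0 := fun w => by
      have : (ofCoeffs w, (0 : MvPolynomial (Fin 2) R)) = ∑ m, w m • (monomial m.1 (1 : R), 0) := by
        ext1
        · simp [ofCoeffs, Prod.fst_sum, smul_monomial]
        · simp [Prod.snd_sum]
      rw [this, map_sum]
      exact Finset.sum_congr rfl fun m _ => by rw [map_smul, smul_eq_C_mul]; rfl
    have hH : ∀ w : expLE 2 (d - 1) → R, L (0, ofCoeffs w) =
        ∑ m, C (w m) * closedNum F 0 (monomial m.1 1) := fun w => by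
      have : ((0 : MvPolynomial (Fin 2) R), ofCoeffs w) = ∑ m, w m • (0, monomial m.1 (1 : R)) := by
        ext1
        · simp [Prod.fst_sum]
        · simp [ofCoeffs, Prod.snd_sum, smul_monomial]
      rw [this, map_sum]
      exact Finset.sum_congr rfl fun m _ => by rw [map_smul, smul_eq_C_mul]; rfl
    rw [hL, hG, hH]
  rw [h2, coeff_add, coeff_sum, coeff_sum]
  simp only [coeff_C_mul, mul_comm]

theorem ruppert_mulVec_eq_zero {F : MvPolynomial (Fin 2) R} {d : ℕ} (hF : F.totalDegree ≤ d)
    {v : Bool × expLE 2 (d - 1) → R} : (ruppert F d).mulVec v = 0 ↔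
      closedNum F (ofCoeffs fun m => v (true, m)) (ofCoeffs fun m => v (false, m)) = 0 := by
  constructor
  · intro h
    ext m
    by_cases hm : m ∈ expLE 2 (2 * d)
    · rw [← ruppert_mulVec F d v ⟨m, hm⟩, h]; simp
    · rw [mem_expLE, not_le] at hm
      rw [coeff_eq_zero_of_totalDegree_lt, coeff_zero]
      exact (totalDegree_closedNum_le hF (totalDegree_ofCoeffs_le _)
        (totalDegree_ofCoeffs_le _)).trans_lt hm
  · intro h
    funext i
    rw [ruppert_mulVec, h]; simp

/-- A minor of the Ruppert matrix, omitting one column. -/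
noncomputable def ruppertMinor (F : MvPolynomial (Fin 2) R) (d : ℕ) (j₀ : Bool × expLE 2 (d - 1))
    (e : {j // j ≠ j₀} → expLE 2 (2 * d)) : R :=
  ((ruppert F d).submatrix e Subtype.val).det

theorem ruppert_map {S : Type*} [CommRing S] (φ : R →+* S) (F : MvPolynomial (Fin 2) R) (d : ℕ) :
    ruppert (map φ F) d = (ruppert F d).map φ := by
  ext i ⟨b, m⟩
  have h : ∀ G H, closedNum (map φ F) (map φ G) (map φ H) = map φ (closedNum F G H) := by
    intro G H; simp only [closedNum, map_add, map_sub, map_mul, pderiv_map]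
  have h0 : (monomial m.1 1 : MvPolynomial (Fin 2) S) = map φ (monomial m.1 1) := by simp
  cases b <;> simp only [ruppert, Matrix.map_apply, cond_true, cond_false] <;>
    rw [h0, ← coeff_map, ← h, map_zero]

theorem ruppertMinor_map {S : Type*} [CommRing S] (φ : R →+* S) (F : MvPolynomial (Fin 2) R)
    (d : ℕ) (j₀ : Bool × expLE 2 (d - 1)) (e : {j // j ≠ j₀} → expLE 2 (2 * d)) :
    ruppertMinor (map φ F) d j₀ e = φ (ruppertMinor F d j₀ e) := by
  rw [ruppertMinor, ruppert_map, ruppertMinor, RingHom.map_det]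
  rfl

end Ruppert

section Criterion

theorem pderiv_pderiv_comm {σ R : Type*} [CommSemiring R] (i j : σ) (f : MvPolynomial σ R) :
    pderiv i (pderiv j f) = pderiv j (pderiv i f) := by
  classical
  ext m
  simp only [coeff_pderiv]
  rw [add_right_comm]
  by_cases h : i = j
  · rw [h]
  · simp [h, Ne.symm h]; ring

variable {K : Type*} [Field K]

theorem exists_dependence_of_ruppertMinor_ne_zero {F : MvPolynomial (Fin 2) K} {d : ℕ}
    (hF : F.totalDegree ≤ d) {j₀ : Bool × expLE 2 (d - 1)}
    {e : {j // j ≠ j₀} → expLE 2 (2 * d)} (hdet : ruppertMinor F d j₀ e ≠ 0)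
    {G H G' H' : MvPolynomial (Fin 2) K} (hG : G.totalDegree ≤ d - 1) (hH : H.totalDegree ≤ d - 1)
    (hG' : G'.totalDegree ≤ d - 1) (hH' : H'.totalDegree ≤ d - 1)
    (h : closedNum F G H = 0) (h' : closedNum F G' H' = 0) :
    ∃ s t : K, (s ≠ 0 ∨ t ≠ 0) ∧ s • G + t • G' = 0 ∧ s • H + t • H' = 0 := by
  classical
  have key : ∀ A B : MvPolynomial (Fin 2) K, A.totalDegree ≤ d - 1 → B.totalDegree ≤ d - 1 →
      closedNum F A B = 0 → coeff j₀.2.1 (bif j₀.1 then A else B) = 0 → A = 0 ∧ B = 0 := by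
    intro A B hA hB hAB hj
    let v : Bool × expLE 2 (d - 1) → K := fun j => coeff j.2.1 (bif j.1 then A else B)
    have hv : (ruppert F d).mulVec v = 0 := by
      rw [ruppert_mulVec_eq_zero hF]
      simp only [v, cond_true, cond_false]
      rwa [ofCoeffs_coeff hA, ofCoeffs_coeff hB]
    have hw : (fun j : {j // j ≠ j₀} => v j.1) = 0 := by
      by_contra hne
      refine hdet (Matrix.exists_mulVec_eq_zero_iff.mp ⟨_, hne, ?_⟩)
      funext i
      have h1 := congrFun hv (e i)
      simp only [Matrix.mulVec, dotProduct, Matrix.submatrix_apply, Pi.zero_apply] at h1 ⊢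
      rw [Fintype.sum_eq_add_sum_subtype_ne _ j₀] at h1
      rw [show v j₀ = 0 from hj, mul_zero, zero_add] at h1
      exact h1
    have hv0 : ∀ j, v j = 0 := fun j => by
      by_cases hj0 : j = j₀
      · rw [hj0]; exact hj
      · exact congrFun hw ⟨j, hj0⟩
    constructor
    · rw [← ofCoeffs_coeff hA]
      have := fun m => hv0 (true, m)
      simp only [v, cond_true] at this
      simp [this, ofCoeffs]
    · rw [← ofCoeffs_coeff hB]
      have := fun m => hv0 (false, m)
      simp only [v, cond_false] at this
      simp [this, ofCoeffs]
  set c := coeff j₀.2.1 (bif j₀.1 then G else H) with hc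
  set c' := coeff j₀.2.1 (bif j₀.1 then G' else H') with hc'
  have hcoef : ∀ s t : K, coeff j₀.2.1 (bif j₀.1 then s • G + t • G' else s • H + t • H') =
      s * c + t * c' := by
    intro s t; rw [hc, hc']; cases j₀.1 <;> simp
  have hdeg : ∀ (s t : K) {A A' : MvPolynomial (Fin 2) K}, A.totalDegree ≤ d - 1 →
      A'.totalDegree ≤ d - 1 → (s • A + t • A').totalDegree ≤ d - 1 := fun s t A A' hA hA' =>
    (totalDegree_add _ _).trans (max_le ((totalDegree_smul_le _ _).trans hA)
      ((totalDegree_smul_le _ _).trans hA'))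
  have main : ∀ s t : K, s * c + t * c' = 0 → s • G + t • G' = 0 ∧ s • H + t • H' = 0 :=
    fun s t hst => key _ _ (hdeg s t hG hG') (hdeg s t hH hH')
      (by rw [closedNum_smul_add, h, h', smul_zero, smul_zero, add_zero])
      (by rw [hcoef, hst])
  by_cases h0 : c = 0
  · exact ⟨1, 0, Or.inl one_ne_zero, main _ _ (by rw [h0]; ring)⟩
  · exact ⟨-c', c, Or.inr h0, main _ _ (by ring)⟩

set_option maxHeartbeats 1000000 in
theorem irreducible_of_ruppertMinor_ne_zero {F : MvPolynomial (Fin 2) K} {d : ℕ} (hd : 1 ≤ d)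
    (hF : F.totalDegree ≤ d)
    (hder : ∀ q : MvPolynomial (Fin 2) K, q.totalDegree ≤ d → q.totalDegree ≠ 0 →
      ∃ i, pderiv i q ≠ 0) {j₀ : Bool × expLE 2 (d - 1)}
    {e : {j // j ≠ j₀} → expLE 2 (2 * d)} (hdet : ruppertMinor F d j₀ e ≠ 0) :
    Irreducible F ∧ F.totalDegree = d := by
  have dep := fun {G H G' H' : MvPolynomial (Fin 2) K} =>
    exists_dependence_of_ruppertMinor_ne_zero (G := G) (H := H) (G' := G') (H' := H') hF hdet
  have hF0 : F ≠ 0 := by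
    rintro rfl
    obtain ⟨s, t, hst, h1, h2⟩ := dep (G := 1) (H := 0) (G' := 0) (H' := 1) (by simp) (by simp)
      (by simp) (by simp) (by simp [closedNum]) (by simp [closedNum])
    simp only [smul_zero, add_zero, zero_add, smul_eq_zero, one_ne_zero, or_false] at h1 h2
    exact hst.elim (fun h => h h1) (fun h => h h2)
  have hFd : F.totalDegree = d := by
    by_contra hne
    obtain ⟨s, t, hst, h1, h2⟩ := dep (G := F) (H := 0) (G' := 0) (H' := F) (by lia) (by simp)
      (by simp) (by lia) (by simp [closedNum]; ring) (by simp [closedNum]; ring)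
    simp only [smul_zero, add_zero, zero_add, smul_eq_zero, hF0, or_false] at h1 h2
    exact hst.elim (fun h => h h1) (fun h => h h2)
  refine ⟨?_, hFd⟩
  have hFu : ¬ IsUnit F := fun hu => by
    rw [MvPolynomial.isUnit_iff_totalDegree_of_isReduced] at hu; lia
  obtain ⟨h, hirr, g, rfl⟩ := WfDvdMonoid.exists_irreducible_factor hFu hF0
  have hh0 := hirr.ne_zero
  have hg0 : g ≠ 0 := right_ne_zero_of_mul hF0
  have hunit : ∀ q : MvPolynomial (Fin 2) K, q ≠ 0 → q.totalDegree = 0 → IsUnit q := by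
    intro q hq hq0
    rw [totalDegree_eq_zero_iff_eq_C] at hq0
    rw [hq0] at hq ⊢
    exact (isUnit_iff_ne_zero.mpr (fun h => hq (by rw [h, C_0]))).map C
  by_cases hgu : IsUnit g
  · exact (irreducible_mul_isUnit hgu).mpr hirr
  exfalso
  have hhd : h.totalDegree ≠ 0 := fun h0 => hirr.not_isUnit (hunit h hh0 h0)
  have hgd : g.totalDegree ≠ 0 := fun h0 => hgu (hunit g hg0 h0)
  have hdeg : h.totalDegree + g.totalDegree = d := by
    rw [← hFd, totalDegree_mul_of_isDomain hh0 hg0]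
  obtain ⟨i, hi⟩ := hder h (by lia) hhd
  have hpd := fun (i : Fin 2) (A : MvPolynomial (Fin 2) K) => totalDegree_pderiv_le i A
  have hm := fun (A B : MvPolynomial (Fin 2) K) => totalDegree_mul A B
  have hfin : ∀ i : Fin 2, i = 0 ∨ i = 1 := by decide
  by_cases hhg : h ∣ g
  · obtain ⟨k, rfl⟩ := hhg
    have hk0 : k ≠ 0 := right_ne_zero_of_mul hg0
    have hk := totalDegree_mul_of_isDomain hh0 hk0
    have b1 : ∀ i, (k * pderiv i h).totalDegree ≤ d - 1 := fun i => by
      have := hm k (pderiv i h); have := hpd i h; lia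
    have b2 : ∀ i, (h * k * pderiv i h).totalDegree ≤ d - 1 := fun i => by
      have := hm (h * k) (pderiv i h); have := hpd i h; lia
    have hcomm : pderiv 1 (pderiv 0 h) = pderiv 0 (pderiv 1 h) := pderiv_pderiv_comm ..
    obtain ⟨s, t, hst, h1, h2⟩ := dep (b1 0) (b1 1) (b2 0) (b2 1)
      (by simp only [closedNum, pderiv_mul, hcomm]; ring)
      (by simp only [closedNum, pderiv_mul, hcomm]; ring)
    have h3 : s • (k * pderiv i h) + t • (h * k * pderiv i h) = 0 := by
      rcases hfin i with rfl | rfl <;> assumption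
    rw [smul_eq_C_mul, smul_eq_C_mul] at h3
    have h4 : (k * pderiv i h) * (C s + C t * h) = 0 := by rw [← h3]; ring
    have h5 := (mul_eq_zero.mp h4).resolve_left (mul_ne_zero hk0 hi)
    by_cases ht : t = 0
    · subst ht
      rw [C_0, zero_mul, add_zero, C_eq_zero] at h5
      exact hst.elim (fun h => h h5) (fun h => h rfl)
    · apply hirr.not_isUnit
      have : h = C (-(s / t)) := by
        have h6 : C t * (h - C (-(s / t))) = 0 := by
          rw [← h5, mul_sub, ← C_mul]
          have : t * -(s / t) = -s := by field_simp
          rw [this, C_neg]; ring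
        exact sub_eq_zero.mp ((mul_eq_zero.mp h6).resolve_left (by simpa using ht))
      refine hunit h hh0 (by rw [this, totalDegree_C])
  · obtain ⟨j, hj⟩ := hder g (by lia) hgd
    have b1 : ∀ i, (g * pderiv i h).totalDegree ≤ d - 1 := fun i => by
      have := hm g (pderiv i h); have := hpd i h; lia
    have b2 : ∀ i, (h * pderiv i g).totalDegree ≤ d - 1 := fun i => by
      have := hm h (pderiv i g); have := hpd i g; lia
    have hcomm : ∀ h : MvPolynomial (Fin 2) K, pderiv 1 (pderiv 0 h) = pderiv 0 (pderiv 1 h) :=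
      fun h => pderiv_pderiv_comm ..
    obtain ⟨s, t, hst, h1, h2⟩ := dep (b1 0) (b1 1) (b2 0) (b2 1)
      (by simp only [closedNum, pderiv_mul, hcomm]; ring)
      (by simp only [closedNum, pderiv_mul, hcomm]; ring)
    have h3 : ∀ i, C s * (g * pderiv i h) + C t * (h * pderiv i g) = 0 := fun i => by
      have := hfin i
      rw [← smul_eq_C_mul, ← smul_eq_C_mul]
      rcases hfin i with h | h
      · rw [h]; exact h1
      · rw [h]; exact h2
    have hs : s = 0 := by
      by_contra hs
      have h4 : h ∣ C s * (g * pderiv i h) :=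
        ⟨- (C t * pderiv i g), by
          rw [eq_neg_of_add_eq_zero_left (h3 i)]; ring⟩
      have hCs : IsUnit (C s : MvPolynomial (Fin 2) K) := (isUnit_iff_ne_zero.mpr hs).map C
      have h5 := ((hCs.dvd_mul_left).mp h4)
      have h6 := (hirr.prime.dvd_or_dvd h5).resolve_left hhg
      obtain ⟨w, hw⟩ := h6
      have hw0 : w ≠ 0 := by rintro rfl; exact hi (by rw [hw, mul_zero])
      have := hpd i h
      rw [hw, totalDegree_mul_of_isDomain hh0 hw0] at this
      lia
    have h4 := h3 j
    rw [hs] at h4 hst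
    rw [C_0, zero_mul, zero_add] at h4
    have h5 := (mul_eq_zero.mp h4).resolve_right (mul_ne_zero hh0 hj)
    rw [C_eq_zero] at h5
    exact hst.elim (fun h => h rfl) (fun h => h h5)

end Criterion

theorem derivation_apply_ringHom {σ R A k : Type*} [Fintype σ] [CommRing R] [CommRing A]
    [CommRing k] [Algebra k A] (φ : MvPolynomial σ R →+* A) (D : Derivation k A A) (hC : ∀ r, D (φ (C r)) = 0)
    (q : MvPolynomial σ R) : D (φ q) = ∑ i, D (φ (X i)) * φ (pderiv i q) := by
  classical
  induction q using MvPolynomial.induction_on with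
  | C r => simp [hC]
  | add p q hp hq => simp only [map_add, hp, hq, mul_add, Finset.sum_add_distrib]
  | mul_X p j hp =>
    simp only [map_mul, Derivation.leibniz, hp, smul_eq_mul, map_add, mul_add,
      Finset.sum_add_distrib, Finset.mul_sum, pderiv_X, Pi.single_apply]
    simp only [apply_ite, map_one, map_zero, mul_one, mul_zero,
      Finset.sum_ite_eq, Finset.mem_univ, if_true]
    rw [mul_comm]
    congr 1
    exact Finset.sum_congr rfl fun i _ => by ring

theorem dvd_of_common_root {S W : Type*} [CommRing S] [IsDomain S] [UniqueFactorizationMonoid S]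
    [CommRing W] [IsDomain W] {φ : S →+* W} (hφ : Function.Injective φ) {y : W}
    {f q : Polynomial S} (hf : Irreducible f) (hfd : f.natDegree ≠ 0)
    (h : f.eval₂ φ y = 0) (hq : q.eval₂ φ y = 0) : f ∣ q := by
  classical
  let K := FractionRing S
  let L := FractionRing W
  let ψ : K →+* L := IsFractionRing.map hφ
  have hψ : ψ.comp (algebraMap S K) = (algebraMap W L).comp φ := by
    ext s; simp [ψ, IsFractionRing.map]
  have hev : ∀ p : Polynomial S, p.eval₂ φ y = 0 →
      (p.map (algebraMap S K)).eval₂ ψ (algebraMap W L y) = 0 := by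
    intro p hp
    rw [Polynomial.eval₂_map, hψ, ← Polynomial.hom_eval₂, hp, map_zero]
  have hprim := hf.isPrimitive hfd
  have hirr : Irreducible (f.map (algebraMap S K)) :=
    hprim.irreducible_iff_irreducible_map_fraction_map.mp hf
  have hdvd : f.map (algebraMap S K) ∣ q.map (algebraMap S K) := by
    by_contra hnd
    obtain ⟨u, v, huv⟩ := (EuclideanDomain.dvd_or_coprime _ _ hirr).resolve_left hnd
    have := congrArg (Polynomial.eval₂ ψ (algebraMap W L y)) huv
    simp [Polynomial.eval₂_mul, Polynomial.eval₂_add, hev f h, hev q hq] at this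
  exact hprim.dvd_of_fraction_map_dvd_fraction_map hdvd

section Branch

variable {τ : Type*}

theorem exists_branch [Finite τ] {f : MvPolynomial (Option τ) ℚ} {P : Option τ → ℚ} (h0 : eval P f = 0)
    (h1 : eval P (pderiv none f) ≠ 0) : ∃ ξ : Option τ → MvPowerSeries τ ℚ,
      (∀ t, ξ (some t) = MvPowerSeries.C (P (some t)) + MvPowerSeries.X t) ∧
      (∀ o, MvPowerSeries.constantCoeff (ξ o) = P o) ∧ aeval ξ f = 0 := by
  classical
  have := Fintype.ofFinite τ
  let W := MvPowerSeries τ ℚ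
  let I : Ideal W := .span (.range MvPowerSeries.X)
  let ζ : Option τ → W := fun o =>
    MvPowerSeries.C (P o) + o.elim 0 MvPowerSeries.X
  have hmod : ∀ g : MvPolynomial (Option τ) ℚ, aeval ζ g - MvPowerSeries.C (eval P g) ∈ I := by
    intro g
    rw [← Ideal.Quotient.mk_eq_mk_iff_sub_mem]
    have : (Ideal.Quotient.mk I).comp (aeval ζ : MvPolynomial (Option τ) ℚ →ₐ[ℚ] W).toRingHom =
        ((Ideal.Quotient.mk I).comp MvPowerSeries.C).comp (eval P) := by
      ext i
      · have : aeval ζ (C i : MvPolynomial (Option τ) ℚ) = MvPowerSeries.C i := by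
          rw [aeval_C]; rfl
        simp only [AlgHom.toRingHom_eq_coe, RingHom.coe_comp, RingHom.coe_coe,
          Function.comp_apply, this, eval_C]
      · simp only [ζ, AlgHom.toRingHom_eq_coe, RingHom.coe_comp, RingHom.coe_coe,
          Function.comp_apply, aeval_X, eval_X, map_add]
        cases i with
        | none => simp
        | some t =>
          have : (Ideal.Quotient.mk I) (MvPowerSeries.X t) = 0 :=
            Ideal.Quotient.eq_zero_iff_mem.mpr (Ideal.subset_span ⟨t, rfl⟩)
          simp [this]
    exact RingHom.congr_fun this g
  let φ : MvPolynomial (Option τ) ℚ →ₐ[ℚ] Polynomial W :=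
    aeval (fun o => o.elim Polynomial.X fun t => Polynomial.C (ζ (some t)))
  have hφ : ∀ (y : W) g, (φ g).eval y = aeval (fun o => o.elim y fun t => ζ (some t)) g := by
    intro y g
    have : ((Polynomial.aeval y).restrictScalars ℚ).comp φ =
        aeval (fun o => o.elim y fun t => ζ (some t)) := by
      ext i
      cases i <;> simp [φ]
    rw [← this]; simp [Polynomial.coe_aeval_eq_eval]
  have hder : ∀ g, (φ g).derivative = φ (pderiv none g) := by
    intro g
    have := derivation_apply_ringHom φ.toRingHom
      (Polynomial.derivative' (R := W)) (fun r => by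
        have : φ (C r) = Polynomial.C (algebraMap ℚ W r) := φ.commutes r
        exact (congrArg Polynomial.derivative this).trans Polynomial.derivative_C) g
    rw [Fintype.sum_option] at this
    simpa [φ] using this
  have hζ : (fun o : Option τ => o.elim (MvPowerSeries.C (P none)) fun t => ζ (some t)) = ζ := by
    funext o; cases o <;> simp [ζ]
  obtain ⟨y, hy, hyI⟩ := exists_root_of_isAdicComplete I (φ f)
    (a := MvPowerSeries.C (P none)) (c := MvPowerSeries.C (eval P (pderiv none f))⁻¹)
    (by rw [hφ, hζ]; simpa [h0] using hmod f)
    (by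
      rw [hder, hφ, hζ]
      have := I.mul_mem_left (MvPowerSeries.C (eval P (pderiv none f))⁻¹) (hmod (pderiv none f))
      rwa [mul_sub, ← map_mul, inv_mul_cancel₀ h1, map_one] at this)
  refine ⟨fun o => o.elim y fun t => ζ (some t), fun t => by simp [ζ], fun o => ?_, by rw [← hφ, hy]⟩
  cases o with
  | some t => simp [ζ]
  | none =>
    have hle : I ≤ RingHom.ker (MvPowerSeries.constantCoeff (σ := τ) (R := ℚ)) := by
      rw [Ideal.span_le]; rintro _ ⟨t, rfl⟩
      exact MvPowerSeries.constantCoeff_X t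
    have := hle hyI
    rw [RingHom.mem_ker, map_sub, MvPowerSeries.constantCoeff_C, sub_eq_zero] at this
    exact this

/-- The shifted embedding of polynomials into power series. -/
theorem aeval_shift_injective (c : τ → ℚ) : Function.Injective
    (aeval (fun t => MvPowerSeries.C (c t) + MvPowerSeries.X t) :
      MvPolynomial τ ℚ →ₐ[ℚ] MvPowerSeries τ ℚ) := by
  have h : (aeval (fun t => MvPowerSeries.C (c t) + MvPowerSeries.X t) :
      MvPolynomial τ ℚ →ₐ[ℚ] MvPowerSeries τ ℚ) =
      (coeToMvPowerSeries.algHom ℚ).comp (aeval fun t => C (c t) + X t) := by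
    ext t; simp
  have h2 : Function.LeftInverse (aeval (fun t => X t - C (c t)) : MvPolynomial τ ℚ →ₐ[ℚ] _)
      (aeval (fun t => C (c t) + X t) : MvPolynomial τ ℚ →ₐ[ℚ] MvPolynomial τ ℚ) := by
    intro q
    rw [← AlgHom.comp_apply]
    have : (aeval fun t => X t - C (c t)).comp (aeval fun t => C (c t) + X t) =
        AlgHom.id ℚ (MvPolynomial τ ℚ) := by
      ext t; simp
    rw [this]; rfl
  rw [h]
  intro p q hpq
  apply h2.injective
  apply MvPolynomial.coe_injective
  simpa using hpq

theorem dvd_of_aeval_branch {f q : MvPolynomial (Option τ) ℚ} (hf : Irreducible f)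
    (hf1 : pderiv none f ≠ 0) {c : τ → ℚ} {ξ : Option τ → MvPowerSeries τ ℚ}
    (hξ : ∀ t, ξ (some t) = MvPowerSeries.C (c t) + MvPowerSeries.X t)
    (h : aeval ξ f = 0) (hq : aeval ξ q = 0) : f ∣ q := by
  classical
  have : IsDomain (MvPowerSeries τ ℚ) := NoZeroDivisors.to_isDomain _
  let E := optionEquivLeft ℚ τ
  let φ : MvPolynomial τ ℚ →ₐ[ℚ] MvPowerSeries τ ℚ :=
    aeval fun t => MvPowerSeries.C (c t) + MvPowerSeries.X t
  have hE : ∀ g, (E g).eval₂ φ.toRingHom (ξ none) = aeval ξ g := by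
    intro g
    induction g using MvPolynomial.induction_on with
    | C r => simp [E, φ, optionEquivLeft_C]
    | add p q hp hq => simp only [map_add, Polynomial.eval₂_add, hp, hq]
    | mul_X p j hp =>
      rw [map_mul, Polynomial.eval₂_mul, hp, map_mul, aeval_X]
      cases j <;> simp [E, φ, hξ]
  have hd : (E f).natDegree ≠ 0 := by
    intro h0
    apply hf1
    obtain ⟨s, hs⟩ := Polynomial.natDegree_eq_zero.mp h0
    have : f = rename some s := by
      apply E.injective
      rw [← hs]
      clear hs
      induction s using MvPolynomial.induction_on with
      | C r => simp [E, optionEquivLeft_C]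
      | add p q hp hq => simp only [map_add, hp, hq]
      | mul_X p j hp => simp [E, hp]
    rw [this]
    exact pderiv_eq_zero_of_notMem_vars fun h => by simpa using vars_rename some s h
  have := dvd_of_common_root (aeval_shift_injective c) (y := ξ none)
    ((MulEquiv.irreducible_iff E).mpr hf) hd
    ((hE f).trans h) ((hE q).trans hq)
  exact (map_dvd_iff E).mp this

end Branch

theorem heisenberg_pow_apply {M : Type*} [AddCommGroup M] [Module ℚ M] {D E Z : Module.End ℚ M}
    (h1 : E * D = D * E + Z) (h2 : D * Z = Z * D) (h3 : E * Z = Z * E) {v : M} (hv : D v = 0)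
    (n : ℕ) : (D ^ n * E ^ n) v = ((-1) ^ n * (n.factorial : ℚ)) • (Z ^ n) v := by
  have hDE : ∀ k : ℕ, D * E ^ (k + 1) = E ^ (k + 1) * D - (k + 1) • (Z * E ^ k) := by
    intro k
    have h4 : D * E = E * D - Z := by rw [h1]; abel
    have hEZ : ∀ k : ℕ, E * (Z * E ^ k) = Z * E ^ (k + 1) := fun k => by
      rw [← mul_assoc, h3, mul_assoc, pow_succ']
    induction k with
    | zero => simp [h4]
    | succ k ih =>
      rw [pow_succ', ← mul_assoc, h4, sub_mul, mul_assoc E D, ih, mul_sub, mul_smul_comm, hEZ,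
        ← mul_assoc, ← pow_succ', add_smul (k + 1) 1 (Z * E ^ (k + 1)), one_smul]
      abel
  have hDZ : ∀ n : ℕ, D ^ n * Z = Z * D ^ n := fun n =>
    ((show Commute D Z from h2).pow_left n).eq
  induction n with
  | zero => simp
  | succ n ih =>
    have : D ^ (n + 1) * E ^ (n + 1) = D ^ n * E ^ (n + 1) * D - (n + 1) • (Z * (D ^ n * E ^ n)) := by
      rw [pow_succ, mul_assoc, hDE, mul_sub, mul_smul_comm, ← mul_assoc, ← mul_assoc, hDZ, mul_assoc Z]
    rw [this, LinearMap.sub_apply, Module.End.mul_apply _ D, hv, map_zero, zero_sub,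
      LinearMap.smul_apply, Module.End.mul_apply Z, ih, map_smul, pow_succ' Z, Module.End.mul_apply,
      Nat.factorial_succ, ← Nat.cast_smul_eq_nsmul ℚ, smul_smul, ← neg_smul]
    congr 1
    push_cast
    ring

namespace MvPowerSeries

variable {τ : Type*}

theorem pderiv_pderiv_comm (i j : τ) (α : MvPowerSeries τ ℚ) :
    pderiv ℚ i (pderiv ℚ j α) = pderiv ℚ j (pderiv ℚ i α) := by
  classical
  ext μ
  simp only [coeff_pderiv]
  by_cases h : i = j
  · rw [h]
  · rw [add_right_comm]
    simp [h, Ne.symm h]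
    ring

theorem pderiv_iterate_eq_zero_iff (t : τ) (n : ℕ) (α : MvPowerSeries τ ℚ) :
    (pderiv ℚ t)^[n] α = 0 ↔ ∀ μ : τ →₀ ℕ, n ≤ μ t → coeff μ α = 0 := by
  classical
  induction n generalizing α with
  | zero => simp [MvPowerSeries.ext_iff]
  | succ n ih =>
    rw [Function.iterate_succ_apply, ih]
    constructor
    · intro h μ hμ
      have h1 : μ - Finsupp.single t 1 + Finsupp.single t 1 = μ := by
        apply tsub_add_cancel_of_le
        rw [Finsupp.single_le_iff]; lia
      have := h (μ - Finsupp.single t 1) (by simp; lia)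
      rw [coeff_pderiv, h1] at this
      exact (mul_eq_zero.mp this).resolve_right (by positivity)
    · intro h μ hμ
      rw [coeff_pderiv, h _ (by simpa using hμ), zero_mul]

theorem coeff_X_mul_eq (t : τ) (α : MvPowerSeries τ ℚ) (μ : τ →₀ ℕ) :
    coeff μ (X t * α) = if 1 ≤ μ t then coeff (μ - Finsupp.single t 1) α else 0 := by
  classical
  rw [X, coeff_monomial_mul]
  simp [Finsupp.single_le_iff]

/-- The derivation `∂_x + ∑ a_j ∂_{z_j}`. -/
noncomputable def transportD (ι : Type*) [Fintype ι] :
    Derivation ℚ (MvPowerSeries (ι ⊕ Option ι) ℚ) (MvPowerSeries (ι ⊕ Option ι) ℚ) :=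
  pderiv ℚ (.inr none) +
    ∑ j, (X (.inl j) : MvPowerSeries (ι ⊕ Option ι) ℚ) • pderiv ℚ (.inr (some j))

theorem transportD_apply {ι : Type*} [Fintype ι] (β : MvPowerSeries (ι ⊕ Option ι) ℚ) :
    transportD ι β =
      pderiv ℚ (.inr none) β + ∑ j, X (.inl j) * pderiv ℚ (.inr (some j)) β := by
  rw [transportD, Derivation.add_apply]
  congr 1
  change Derivation.coeFnAddMonoidHom (∑ j, _) β = _
  rw [map_sum, Finset.sum_apply]
  rfl

theorem exists_coe_eq_of_transport {ι : Type*} [Fintype ι]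
    (α : MvPowerSeries (ι ⊕ Option ι) ℚ)
    (hD : transportD ι α = 0)
    (n : ℕ) (hE : ∀ j, (pderiv ℚ (.inl j))^[n] α = 0) :
    ∃ T : MvPolynomial (ι ⊕ Option ι) ℚ, (T : MvPowerSeries (ι ⊕ Option ι) ℚ) = α := by
  classical
  have hZ : ∀ j, (pderiv ℚ (.inr (some j)))^[n] α = 0 := by
    intro j
    have h := heisenberg_pow_apply (D := (transportD ι : Module.End ℚ (MvPowerSeries (ι ⊕ Option ι) ℚ)))
      (E := (pderiv ℚ (Sum.inl j : ι ⊕ Option ι)).toLinearMap)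
      (Z := (pderiv ℚ (Sum.inr (some j) : ι ⊕ Option ι)).toLinearMap)
      (v := α)
      (by
        ext1 β
        simp only [Module.End.mul_apply, LinearMap.add_apply, Derivation.coeFn_coe, transportD_apply, map_add,
          map_sum, Derivation.leibniz, smul_eq_mul, pderiv_X, Finset.sum_add_distrib]
        rw [pderiv_pderiv_comm, add_assoc]
        congr 2
        · exact Finset.sum_congr rfl fun i _ => by rw [pderiv_pderiv_comm]
        · rw [Finset.sum_eq_single j]
          · simp
          · intro i _ hi; simp [hi]
          · simp)
      (by
        ext1 β
        simp only [Module.End.mul_apply, Derivation.coeFn_coe, transportD_apply, map_add,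
          map_sum, Derivation.leibniz, smul_eq_mul, pderiv_X, Finset.sum_add_distrib]
        rw [pderiv_pderiv_comm]
        simp only [reduceCtorEq, if_false, Pi.single_apply, mul_zero, Finset.sum_const_zero, add_zero]
        congr 1
        exact Finset.sum_congr rfl fun i _ => by rw [pderiv_pderiv_comm])
      (by ext1 β; exact pderiv_pderiv_comm _ _ _)
      hD n
    rw [Module.End.mul_apply, Module.End.pow_apply, Module.End.pow_apply, Module.End.pow_apply] at h
    erw [hE j] at h
    rw [iterate_map_zero] at h
    exact (smul_eq_zero.mp h.symm).resolve_left (by positivity)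
  rw [transportD_apply] at hD
  have hx : ∀ s : ℕ, ∀ μ : ι ⊕ Option ι →₀ ℕ, ∑ j, μ (.inl j) = s → s < μ (.inr none) →
      coeff μ α = 0 := by
    intro s
    induction s with
    | zero =>
      intro μ hs hμ
      have h1 : μ - Finsupp.single (.inr none) 1 + Finsupp.single (.inr none) 1 = μ := by
        apply tsub_add_cancel_of_le
        rw [Finsupp.single_le_iff]; lia
      have := congrArg (coeff (μ - Finsupp.single (.inr none) 1)) hD
      have hz : ∀ j, μ (.inl j) = 0 := fun j => (Finset.sum_eq_zero_iff.mp hs) j (Finset.mem_univ _)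
      simp only [map_add, map_sum, coeff_X_mul_eq, coeff_pderiv, h1, map_zero] at this
      rw [Finset.sum_eq_zero (by intro j _; simp [hz]), add_zero] at this
      exact (mul_eq_zero.mp this).resolve_right (by positivity)
    | succ s ih =>
      intro μ hs hμ
      have h1 : μ - Finsupp.single (.inr none) 1 + Finsupp.single (.inr none) 1 = μ := by
        apply tsub_add_cancel_of_le
        rw [Finsupp.single_le_iff]; lia
      have := congrArg (coeff (μ - Finsupp.single (.inr none) 1)) hD
      simp only [map_add, map_sum, coeff_X_mul_eq, coeff_pderiv, h1, map_zero] at this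
      rw [Finset.sum_eq_zero, add_zero] at this
      · exact (mul_eq_zero.mp this).resolve_right (by positivity)
      · intro j _
        split_ifs with hj
        · rw [ih, zero_mul]
          · have : ∑ i, (if i = j then 1 else 0) = 1 := by simp
            rw [← Nat.add_right_cancel_iff (n := ∑ i, (if i = j then 1 else 0)),
              ← Finset.sum_add_distrib, this, ← hs]
            refine Finset.sum_congr rfl fun i _ => ?_
            simp only [Finsupp.coe_add, Finsupp.coe_tsub, Pi.add_apply, Pi.sub_apply,
              Finsupp.single_apply, reduceCtorEq, if_false, Sum.inl.injEq] at hj ⊢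
            by_cases hij : i = j
            · subst hij; simp at hj ⊢; lia
            · simp [hij, Ne.symm hij]
          · simp; lia
        · rfl
  let b : ι ⊕ Option ι →₀ ℕ := Finsupp.equivFunOnFinite.symm fun _ => n + ∑ _j : ι, n
  refine ⟨trunc' ℚ b α, ?_⟩
  ext μ
  rw [MvPolynomial.coeff_coe, coeff_trunc']
  split_ifs with hle
  · rfl
  · by_contra hne
    apply hle
    have hl : ∀ j, μ (.inl j) < n := fun j => by
      by_contra h
      exact hne ((pderiv_iterate_eq_zero_iff _ _ _).mp (hE j) μ (by lia)).symm
    intro t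
    rcases t with j | _ | j
    · have := hl j; simp [b]; lia
    · by_contra h
      have h2 : ∑ j, μ (.inl j) ≤ ∑ _j : ι, n := Finset.sum_le_sum fun j _ => (hl j).le
      exact hne (hx _ μ rfl (by simp [b] at h h2 ⊢; lia)).symm
    · by_contra h
      exact hne ((pderiv_iterate_eq_zero_iff _ _ _).mp (hZ j) μ (by simp [b] at h; lia)).symm

end MvPowerSeries

theorem totalDegree_eq_zero_of_pderiv {σ K : Type*} [CommRing K] [IsDomain K]
    {q : MvPolynomial σ K} (h : ∀ n : ℕ, 1 ≤ n → n ≤ q.totalDegree → (n : K) ≠ 0)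
    (hq : ∀ i, pderiv i q = 0) : q.totalDegree = 0 := by
  classical
  by_contra hd
  rw [totalDegree_eq_zero_iff] at hd
  push Not at hd
  obtain ⟨m, hm, i, hi⟩ := hd
  have h1 : m - Finsupp.single i 1 + Finsupp.single i 1 = m := by
    apply tsub_add_cancel_of_le
    rw [Finsupp.single_le_iff]; lia
  have := congrArg (coeff (m - Finsupp.single i 1)) (hq i)
  rw [coeff_pderiv, h1, coeff_zero] at this
  have h2 : (((m - Finsupp.single i 1 : σ →₀ ℕ) i : ℕ) : K) + 1 = (m i : ℕ) := by
    rw [← Nat.cast_succ]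
    congr 1
    simp; lia
  rw [h2] at this
  refine (mul_ne_zero (mem_support_iff.mp hm) (h _ (by lia) ?_)) this
  refine le_trans ?_ (le_totalDegree hm)
  exact Finset.single_le_sum (f := fun i => m i) (fun _ _ => Nat.zero_le _)
    (Finsupp.mem_support_iff.mpr hi)

theorem pderiv_iterate_eq_zero {σ K : Type*} [CommSemiring K] (i : σ) {n : ℕ}
    {q : MvPolynomial σ K} (h : q.totalDegree < n) : (pderiv i)^[n] q = 0 := by
  induction n generalizing q with
  | zero => simp at h
  | succ n ih =>
    rw [Function.iterate_succ_apply]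
    by_cases hd : q.totalDegree = 0
    · rw [totalDegree_eq_zero_iff_eq_C.mp hd, pderiv_C, iterate_map_zero]
    · exact ih (by have := totalDegree_pderiv_le i q; lia)

theorem eq_zero_of_dvd_of_totalDegree_lt {σ K : Type*} [CommRing K] [IsDomain K]
    {f q : MvPolynomial σ K} (h : f ∣ q) (hd : q.totalDegree < f.totalDegree) : q = 0 := by
  by_contra hq
  obtain ⟨g, rfl⟩ := h
  rw [totalDegree_mul_of_isDomain (left_ne_zero_of_mul hq) (right_ne_zero_of_mul hq)] at hd
  lia

theorem eq_zero_of_dvd_of_pderiv_eq_zero {σ K : Type*} [CommRing K] [IsDomain K]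
    [UniqueFactorizationMonoid K] [CharZero K] {f q : MvPolynomial σ K} {i : σ} (hf : Prime f)
    (hfi : pderiv i f ≠ 0) (h : f ∣ q) (hq : pderiv i q = 0) : q = 0 := by
  by_contra hq0
  obtain ⟨g, hg, hfg⟩ := (FiniteMultiplicity.of_not_isUnit hf.not_isUnit hq0).exists_eq_pow_mul_and_not_dvd
  obtain ⟨k, hk⟩ : ∃ k, multiplicity f q = k + 1 := by
    refine Nat.exists_eq_succ_of_ne_zero fun h0 => ?_
    rw [h0, pow_zero, one_mul] at hg
    exact hfg (hg ▸ h)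
  have hff : ¬ f ∣ pderiv i f := fun hd => hfi <| eq_zero_of_dvd_of_totalDegree_lt hd <| by
    have h0 : f.totalDegree ≠ 0 := fun h0 => hfi <| by
      rw [totalDegree_eq_zero_iff_eq_C.mp h0, pderiv_C]
    have := totalDegree_pderiv_le i f
    lia
  rw [hk] at hg
  rw [hg, Derivation.leibniz, Derivation.leibniz_pow] at hq
  simp only [add_tsub_cancel_right, smul_eq_mul, nsmul_eq_mul] at hq
  have h1 : f ^ k * (f * pderiv i g + ((k + 1 : ℕ) : MvPolynomial σ K) * (g * pderiv i f)) = 0 := by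
    rw [← hq]; ring
  have h2 := (mul_eq_zero.mp h1).resolve_left (pow_ne_zero _ hf.ne_zero)
  have h3 : f ∣ ((k + 1 : ℕ) : MvPolynomial σ K) * (g * pderiv i f) :=
    ⟨-pderiv i g, by linear_combination h2⟩
  rcases hf.dvd_or_dvd h3 with h4 | h4
  · have h5 : ((k + 1 : ℕ) : MvPolynomial σ K) = C ((k + 1 : ℕ) : K) := by simp
    have h6 := eq_zero_of_dvd_of_totalDegree_lt h4 (by
      rw [h5, totalDegree_C]
      by_contra h0
      exact hfi (by rw [totalDegree_eq_zero_iff_eq_C.mp (by lia : f.totalDegree = 0), pderiv_C]))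
    rw [h5, C_eq_zero] at h6
    exact Nat.cast_ne_zero.mpr (by lia) h6
  · exact (hf.dvd_or_dvd h4).elim hfg hff

section Lines

variable (ι : Type*)

/-- The substitution `z_j = k_j + a_j x`, as a map into polynomials in `x, y` with coefficients
in the ring of polynomials in `a, k`. -/
noncomputable def toLines : MvPolynomial (Option (ι ⊕ Option ι)) ℚ →ₐ[ℚ]
    MvPolynomial (Fin 2) (MvPolynomial (ι ⊕ ι) ℚ) :=
  aeval fun o => o.elim (X 1) <| Sum.elim (fun j => C (X (.inl j))) fun o =>
    o.elim (X 0) fun j => C (X (.inr j)) + C (X (.inl j)) * X 0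

/-- The inverse substitution `k_j = z_j - a_j x`. -/
noncomputable def ofLines : MvPolynomial (Fin 2) (MvPolynomial (ι ⊕ ι) ℚ) →ₐ[ℚ]
    MvPolynomial (Option (ι ⊕ Option ι)) ℚ :=
  aevalTower (aeval <| Sum.elim (fun j => X (some (.inl j))) fun j =>
    X (some (.inr (some j))) - X (some (.inl j)) * X (some (.inr none)))
    ![X (some (.inr none)), X none]

variable {ι}

theorem toLines_ofLines (q : MvPolynomial (Fin 2) (MvPolynomial (ι ⊕ ι) ℚ)) :
    toLines ι (ofLines ι q) = q := by
  induction q using MvPolynomial.induction_on with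
  | C r =>
    rw [ofLines, aevalTower_C]
    induction r using MvPolynomial.induction_on with
    | C r => simp [MvPolynomial.algebraMap_eq]
    | add p q hp hq => simp only [map_add, hp, hq]
    | mul_X p j hp =>
      rw [map_mul, map_mul, hp, aeval_X, map_mul]
      rcases j with j | j <;> simp [toLines]
  | add p q hp hq => simp only [map_add, hp, hq]
  | mul_X p j hp =>
    rw [map_mul, map_mul, hp, ofLines, aevalTower_X]
    fin_cases j <;> simp [toLines]

theorem ofLines_toLines (q : MvPolynomial (Option (ι ⊕ Option ι)) ℚ) :
    ofLines ι (toLines ι q) = q := by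
  have : (ofLines ι).comp (toLines ι) = AlgHom.id ℚ _ := by
    ext t
    rcases t with _ | j | _ | j <;> simp [ofLines, toLines]
  exact DFunLike.congr_fun this q

theorem pderiv_one_toLines [Fintype ι] (q : MvPolynomial (Option (ι ⊕ Option ι)) ℚ) :
    pderiv 1 (toLines ι q) = toLines ι (pderiv none q) := by
  classical
  have := derivation_apply_ringHom (toLines ι).toRingHom
    ((pderiv 1 : Derivation (MvPolynomial (ι ⊕ ι) ℚ) _ _).restrictScalars ℚ)
    (fun r => by
      have : (toLines ι).toRingHom (C r) = C (C r) := by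
        simp [toLines, MvPolynomial.algebraMap_eq]
      rw [this]; simp) q
  rw [Fintype.sum_option] at this
  refine this.trans ?_
  rw [Finset.sum_eq_zero, add_zero]
  · simp [toLines, pderiv_X]
  · intro t _
    rcases t with j | _ | j <;> simp [toLines, pderiv_X]

variable {f : MvPolynomial (Option (ι ⊕ Option ι)) ℚ}
  {c : ι ⊕ Option ι → ℚ} {ξ : Option (ι ⊕ Option ι) → MvPowerSeries (ι ⊕ Option ι) ℚ}

theorem toLines_dvd (hf : Irreducible f) (hf1 : pderiv none f ≠ 0)
    (hξ : ∀ t, ξ (some t) = MvPowerSeries.C (c t) + MvPowerSeries.X t)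
    (h0 : aeval ξ f = 0) {q : MvPolynomial (Fin 2) (MvPolynomial (ι ⊕ ι) ℚ)}
    (hq : aeval ξ (ofLines ι q) = 0) : toLines ι f ∣ q := by
  have := map_dvd (toLines ι) (dvd_of_aeval_branch hf hf1 hξ h0 hq)
  rwa [toLines_ofLines] at this

theorem toLines_irreducible (hf : Irreducible f) : Irreducible (toLines ι f) := by
  let E : MvPolynomial (Option (ι ⊕ Option ι)) ℚ ≃ₐ[ℚ]
      MvPolynomial (Fin 2) (MvPolynomial (ι ⊕ ι) ℚ) :=
    AlgEquiv.ofAlgHom (toLines ι) (ofLines ι) (AlgHom.ext toLines_ofLines)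
      (AlgHom.ext ofLines_toLines)
  exact (MulEquiv.irreducible_iff E).mpr hf

variable [Fintype ι]

theorem transportD_aeval_ofLines (hc : ∀ j, c (.inl j) = 0)
    (hξ : ∀ t, ξ (some t) = MvPowerSeries.C (c t) + MvPowerSeries.X t)
    (q : MvPolynomial (Fin 2) (MvPolynomial (ι ⊕ ι) ℚ)) :
    MvPowerSeries.transportD ι (aeval ξ (ofLines ι q)) = aeval ξ (ofLines ι (pderiv 0 q)) +
      MvPowerSeries.transportD ι (ξ none) * aeval ξ (ofLines ι (pderiv 1 q)) := by
  classical
  have hx : MvPowerSeries.transportD ι (ξ (some (.inr none))) = 1 := by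
    rw [hξ, MvPowerSeries.transportD_apply]
    simp
  have ha : ∀ j, MvPowerSeries.transportD ι (ξ (some (.inl j))) = 0 := fun j => by
    rw [hξ, MvPowerSeries.transportD_apply]
    simp
  have hz : ∀ j, MvPowerSeries.transportD ι (ξ (some (.inr (some j)))) = MvPowerSeries.X (.inl j) :=
    fun j => by
      rw [hξ, MvPowerSeries.transportD_apply]
      simp only [map_add, MvPowerSeries.pderiv_C, MvPowerSeries.pderiv_X, zero_add,
        Pi.single_apply, Sum.inr.injEq, Option.some.injEq, reduceCtorEq, if_false]
      rw [Finset.sum_eq_single j]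
      · simp
      · intro i _ hi; simp [hi.symm]
      · simp
  have := derivation_apply_ringHom ((aeval ξ).comp (ofLines ι)).toRingHom
    (MvPowerSeries.transportD ι) (fun r => by
      change MvPowerSeries.transportD ι (aeval ξ (ofLines ι (C r))) = 0
      rw [ofLines, aevalTower_C]
      induction r using MvPolynomial.induction_on with
      | C r => simp [Derivation.map_algebraMap]
      | add p q hp hq => simp only [map_add, hp, hq, add_zero]
      | mul_X p j hp =>
        rw [map_mul, map_mul, Derivation.leibniz, hp, smul_zero, add_zero, aeval_X]
        rcases j with j | j
        · simp [ha]
        · simp only [Sum.elim_inr, map_sub, map_mul, aeval_X, Derivation.leibniz, ha, hx, hz]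
          rw [hξ, hc]
          simp) q
  rw [Fin.sum_univ_two] at this
  refine this.trans ?_
  change MvPowerSeries.transportD ι (aeval ξ (ofLines ι (X 0))) * aeval ξ (ofLines ι (pderiv 0 q)) +
    MvPowerSeries.transportD ι (aeval ξ (ofLines ι (X 1))) * aeval ξ (ofLines ι (pderiv 1 q)) = _
  rw [ofLines, aevalTower_X, aevalTower_X]
  simp [hx]

theorem pderiv_inl_aeval (hfa : ∀ j, pderiv (some (.inl j)) f = 0)
    (hξ : ∀ t, ξ (some t) = MvPowerSeries.C (c t) + MvPowerSeries.X t)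
    (h0 : aeval ξ f = 0) (h1 : aeval ξ (pderiv none f) ≠ 0) (j : ι) :
    (∀ q : MvPolynomial (Option (ι ⊕ Option ι)) ℚ, MvPowerSeries.pderiv ℚ (.inl j) (aeval ξ q) = aeval ξ (pderiv (some (.inl j)) q)) := by
  classical
  have : IsDomain (MvPowerSeries (ι ⊕ Option ι) ℚ) := NoZeroDivisors.to_isDomain _
  have key : ∀ q : MvPolynomial (Option (ι ⊕ Option ι)) ℚ, MvPowerSeries.pderiv ℚ (.inl j) (aeval ξ q) =
      MvPowerSeries.pderiv ℚ (.inl j) (ξ none) * aeval ξ (pderiv none q) +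
        aeval ξ (pderiv (some (.inl j)) q) := by
    intro q
    have := derivation_apply_ringHom (aeval ξ).toRingHom (MvPowerSeries.pderiv ℚ (.inl j))
      (fun r => by simp [Derivation.map_algebraMap]) q
    rw [Fintype.sum_option] at this
    refine this.trans ?_
    simp only [AlgHom.toRingHom_eq_coe, RingHom.coe_coe, aeval_X]
    congr 1
    rw [Finset.sum_eq_single (.inl j)]
    · simp [hξ]
    · intro t _ ht
      rw [hξ, map_add, MvPowerSeries.pderiv_C, MvPowerSeries.pderiv_X_of_ne ht]
      simp
    · simp
  have h2 := key f
  rw [h0, map_zero, hfa, map_zero, add_zero, eq_comm] at h2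
  intro q
  rw [key q, (mul_eq_zero.mp h2).resolve_right h1, zero_mul, zero_add]

theorem exists_eq_mul_pderiv_of_closedNum_eq_zero (hf : Irreducible f)
    (hfa : ∀ j, pderiv (some (.inl j)) f = 0) (hc : ∀ j, c (.inl j) = 0)
    (hξ : ∀ t, ξ (some t) = MvPowerSeries.C (c t) + MvPowerSeries.X t)
    (h0 : aeval ξ f = 0) (h1 : MvPowerSeries.constantCoeff (aeval ξ (pderiv none f)) ≠ 0)
    {G H : MvPolynomial (Fin 2) (MvPolynomial (ι ⊕ ι) ℚ)}
    (hG : G.totalDegree < (toLines ι f).totalDegree) (hH : H.totalDegree < (toLines ι f).totalDegree)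
    (h : closedNum (toLines ι f) G H = 0) :
    ∃ r, G = C r * pderiv 0 (toLines ι f) ∧ H = C r * pderiv 1 (toLines ι f) := by
  classical
  have : IsDomain (MvPowerSeries (ι ⊕ Option ι) ℚ) := NoZeroDivisors.to_isDomain _
  obtain ⟨Ψ, hΨ⟩ : ∃ Ψ : MvPolynomial (Fin 2) (MvPolynomial (ι ⊕ ι) ℚ) →ₐ[ℚ]
      MvPowerSeries (ι ⊕ Option ι) ℚ, ∀ q, Ψ q = aeval ξ (ofLines ι q) :=
    ⟨(aeval ξ).comp (ofLines ι), fun _ => rfl⟩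
  obtain ⟨D, hDef⟩ : ∃ D, D = MvPowerSeries.transportD ι := ⟨_, rfl⟩
  have hf1 : pderiv none f ≠ 0 := fun h => h1 (by rw [h, map_zero, map_zero])
  set u := aeval ξ (pderiv none f) with hu
  have hu0 : u ≠ 0 := fun h => h1 (by rw [h, map_zero])
  obtain ⟨v, huv⟩ := (MvPowerSeries.isUnit_iff_constantCoeff.mpr (Ne.isUnit h1)).exists_right_inv
  have hD : ∀ q, D (Ψ q) = Ψ (pderiv 0 q) + D (ξ none) * Ψ (pderiv 1 q) :=
    fun q => by
    rw [hΨ, hΨ, hΨ, hDef]; exact transportD_aeval_ofLines hc hξ q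
  set F := toLines ι f with hF
  have hΨF : Ψ F = 0 := by
    rw [hΨ, ofLines_toLines, h0]
  have hΨy : Ψ (pderiv 1 F) = u := by
    rw [hΨ, hF, pderiv_one_toLines, ofLines_toLines]
  have hdvd : ∀ q, Ψ q = 0 → F ∣ q := fun q hq => toLines_dvd hf hf1 hξ h0 ((hΨ q).symm.trans hq)
  have e1 := hD F
  rw [hΨF, map_zero, hΨy] at e1
  obtain ⟨α, hα⟩ : ∃ α, α * u = Ψ H := ⟨Ψ H * v, by rw [mul_assoc, mul_comm v, huv, mul_one]⟩
  have e2 : Ψ G = α * Ψ (pderiv 0 F) := by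
    have := congrArg Ψ h
    simp only [closedNum, map_add, map_sub, map_mul, hΨF, hΨy, mul_zero, map_zero, ← hα] at this
    apply mul_right_cancel₀ hu0
    linear_combination -this
  have hDα : D α = 0 := by
    have e3 := congrArg (fun q => Ψ (pderiv 1 q)) h
    simp only [closedNum, map_add, map_sub, map_mul, hΨF, hΨy, map_zero, ← hα,
      Derivation.leibniz, smul_eq_mul, e2] at e3
    have e4 := hD H
    have e5 := hD (pderiv 1 F)
    rw [hΨy, pderiv_pderiv_comm 0 1] at e5
    rw [← hα, Derivation.leibniz, smul_eq_mul, smul_eq_mul] at e4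
    apply mul_left_cancel₀ (mul_ne_zero hu0 hu0)
    linear_combination u * e4 - u * α * e5 - e3 - (Ψ (pderiv 1 H) - α * Ψ (pderiv 1 (pderiv 1 F))) * e1
  have hE : ∀ j, (MvPowerSeries.pderiv ℚ (.inl j))^[(ofLines ι H).totalDegree + 1] α = 0 := by
    intro j
    have key := pderiv_inl_aeval hfa hξ h0 hu0 j
    have hEu : MvPowerSeries.pderiv ℚ (.inl j) u = 0 := by
      rw [hu, key, pderiv_pderiv_comm, hfa, map_zero, map_zero]
    have h2 : ∀ n, ∀ β, (MvPowerSeries.pderiv ℚ (.inl j))^[n] (β * u) =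
        (MvPowerSeries.pderiv ℚ (.inl j))^[n] β * u := by
      intro n
      induction n with
      | zero => intro β; rfl
      | succ n ih =>
        intro β
        rw [Function.iterate_succ_apply, Function.iterate_succ_apply, Derivation.leibniz, hEu,
          smul_zero, zero_add, smul_eq_mul, mul_comm u, ih]
    have h3 : ∀ n (q : MvPolynomial (Option (ι ⊕ Option ι)) ℚ), (MvPowerSeries.pderiv ℚ (.inl j))^[n] (aeval ξ q) =
        aeval ξ ((pderiv (some (.inl j)))^[n] q) := by
      intro n
      induction n with
      | zero => intro q; rfl
      | succ n ih => intro q; rw [Function.iterate_succ_apply, key, ih]; rfl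
    have h4 := h2 ((ofLines ι H).totalDegree + 1) α
    rw [hα] at h4
    rw [hΨ, h3, pderiv_iterate_eq_zero _ (Nat.lt_succ_self _), map_zero] at h4
    exact (mul_eq_zero.mp h4.symm).resolve_right hu0
  obtain ⟨T, hT⟩ := MvPowerSeries.exists_coe_eq_of_transport α (hDef ▸ hDα) _ hE
  obtain ⟨T₁, hT₁⟩ : ∃ T₁ : MvPolynomial (ι ⊕ Option ι) ℚ, aeval (fun t => ξ (some t)) T₁ = α := by
    refine ⟨aeval (fun t => X t - C (c t)) T, ?_⟩
    rw [← hT]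
    have : (aeval fun t => ξ (some t)).comp (aeval fun t => X t - C (c t)) =
        (coeToMvPowerSeries.algHom ℚ : MvPolynomial (ι ⊕ Option ι) ℚ →ₐ[ℚ] _) := by
      ext1 t; simp [hξ, MvPowerSeries.algebraMap_apply]
    refine (DFunLike.congr_fun this T).trans ?_
    simp
  set q := toLines ι (rename some T₁) with hq
  have hΨq : Ψ q = α := by
    rw [hΨ, hq, ofLines_toLines, aeval_rename, ← hT₁]
    rfl
  have hq1 : pderiv 1 q = 0 := by
    rw [hq, pderiv_one_toLines, pderiv_eq_zero_of_notMem_vars, map_zero]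
    intro h
    simpa using vars_rename some T₁ h
  have hq0 : pderiv 0 q = 0 := by
    have h2 := hD q
    rw [hΨq, hDα, hq1, map_zero, mul_zero, add_zero, eq_comm] at h2
    refine eq_zero_of_dvd_of_pderiv_eq_zero (i := 1) (toLines_irreducible hf).prime
      (fun h => hu0 (by rw [← hΨy, h, map_zero])) (hdvd _ h2) ?_
    rw [pderiv_pderiv_comm, hq1, map_zero]
  have hqC := totalDegree_eq_zero_iff_eq_C.mp (totalDegree_eq_zero_of_pderiv (q := q)
    (fun n hn _ => Nat.cast_ne_zero.mpr (by lia)) (Fin.forall_fin_two.mpr ⟨hq0, hq1⟩))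
  refine ⟨coeff 0 q, ?_, ?_⟩
  · rw [← hqC, ← sub_eq_zero]
    refine eq_zero_of_dvd_of_totalDegree_lt (hdvd _ ?_) ?_
    · rw [map_sub, map_mul, hΨq, e2, sub_self]
    · rw [hqC]
      refine (totalDegree_sub _ _).trans_lt (max_lt hG ((totalDegree_mul _ _).trans_lt ?_))
      rw [totalDegree_C]
      have := totalDegree_pderiv_le 0 F
      lia
  · rw [← hqC, ← sub_eq_zero]
    refine eq_zero_of_dvd_of_totalDegree_lt (hdvd _ ?_) ?_
    · rw [map_sub, map_mul, hΨq, hΨy, hα, sub_self]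
    · rw [hqC]
      refine (totalDegree_sub _ _).trans_lt (max_lt hH ((totalDegree_mul _ _).trans_lt ?_))
      rw [totalDegree_C]
      have := totalDegree_pderiv_le 1 F
      lia

end Lines

theorem prime_rename_of_injective {σ τ R : Type*} [CommRing R] {e : σ → τ}
    (he : Function.Injective e) {p : MvPolynomial σ R} (hp : Prime p) : Prime (rename e p) := by
  have h : rename e p = rename Subtype.val (rename (Equiv.ofInjective e he) p) := by
    rw [rename_rename]; rfl
  rw [h]
  exact (prime_rename_iff (Set.range e)).mpr
    ((MulEquiv.prime_iff (renameEquiv R (Equiv.ofInjective e he))).mpr hp)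

section Slice

variable {m : ℕ} {R S : Type*} [CommRing R] [CommRing S]

/-- The coordinates `(x, y, k_j + a_j x)` of a family of planes. -/
noncomputable def sliceCoord (a k : Fin m → R) : Fin (m + 2) → MvPolynomial (Fin 2) R :=
  Fin.cons (X 0) (Fin.cons (X 1) fun j => C (k j) + C (a j) * X 0)

/-- The restriction of a polynomial to the plane `z = k + a x`. -/
noncomputable def slice (a k : Fin m → R) (f : MvPolynomial (Fin (m + 2)) ℤ) :
    MvPolynomial (Fin 2) R :=
  aeval (sliceCoord a k) f

theorem totalDegree_sliceCoord_le (a k : Fin m → R) (i : Fin (m + 2)) :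
    (sliceCoord a k i).totalDegree ≤ 1 := by
  have hX : ∀ j : Fin 2, (X j : MvPolynomial (Fin 2) R).totalDegree ≤ 1 := fun j => by
    rw [X]; refine (totalDegree_monomial_le _ _).trans (by simp)
  refine Fin.cases (hX 0) (fun i => Fin.cases (hX 1) (fun j => ?_) i) i
  simp only [sliceCoord, Fin.cons_succ]
  refine (totalDegree_add _ _).trans (max_le ?_ ((totalDegree_mul _ _).trans ?_))
  · simp
  · rw [totalDegree_C, zero_add]; exact hX 0

theorem totalDegree_aeval_le {σ τ A : Type*} [CommRing A] {g : σ → MvPolynomial τ A}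
    (hg : ∀ i, (g i).totalDegree ≤ 1) (f : MvPolynomial σ ℤ) :
    (aeval g f).totalDegree ≤ f.totalDegree := by
  rw [aeval_def, eval₂_eq]
  refine totalDegree_finsetSum_le fun n hn => (totalDegree_mul _ _).trans ?_
  have : algebraMap ℤ (MvPolynomial τ A) (coeff n f) = C (algebraMap ℤ A (coeff n f)) := by simp
  rw [this, totalDegree_C, zero_add]
  refine (totalDegree_finsetProd _ _).trans (le_trans (Finset.sum_le_sum fun i _ => ?_)
    (le_totalDegree hn))
  refine (totalDegree_pow _ _).trans ?_
  exact (Nat.mul_le_mul_left _ (hg i)).trans (by simp)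

theorem totalDegree_slice_le (a k : Fin m → R) (f : MvPolynomial (Fin (m + 2)) ℤ) :
    (slice a k f).totalDegree ≤ f.totalDegree :=
  totalDegree_aeval_le (totalDegree_sliceCoord_le a k) f

theorem map_slice (φ : R →+* S) (a k : Fin m → R) (f : MvPolynomial (Fin (m + 2)) ℤ) :
    map φ (slice a k f) = slice (φ ∘ a) (φ ∘ k) f := by
  have : (map φ).comp (aeval (sliceCoord a k)).toRingHom =
      (aeval (sliceCoord (φ ∘ a) (φ ∘ k)) : MvPolynomial (Fin (m + 2)) ℤ →ₐ[ℤ] _).toRingHom := by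
    refine MvPolynomial.ringHom_ext (fun r => by simp) fun i => ?_
    refine Fin.cases (by simp [sliceCoord]) (fun i => Fin.cases ?_ (fun j => ?_) i) i
    · simp [sliceCoord]
    · simp [sliceCoord]
  exact DFunLike.congr_fun this f

theorem eval_slice (a k : Fin m → R) (f : MvPolynomial (Fin (m + 2)) ℤ) (P : Fin 2 → R) :
    eval P (slice a k f) = aeval
      (Fin.cons (P 0) (Fin.cons (P 1) fun j => k j + a j * P 0) : Fin (m + 2) → R) f := by
  have : (eval P).comp (aeval (sliceCoord a k)).toRingHom =
      (aeval (Fin.cons (P 0) (Fin.cons (P 1) fun j => k j + a j * P 0) : Fin (m + 2) → R) :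
        MvPolynomial (Fin (m + 2)) ℤ →ₐ[ℤ] _).toRingHom := by
    refine MvPolynomial.ringHom_ext (fun r => by simp) fun i => ?_
    refine Fin.cases (by simp [sliceCoord]) (fun i => Fin.cases ?_ (fun j => ?_) i) i
    · simp [sliceCoord]
    · simp [sliceCoord]
  exact DFunLike.congr_fun this f

/-- Some slice through the origin has full degree. -/
theorem exists_totalDegree_slice_eq {f : MvPolynomial (Fin (m + 2)) ℤ} (hf : f ≠ 0) :
    ∃ a : Fin m → ℚ, f.totalDegree ≤ (slice a 0 f).totalDegree := by
  classical
  set d := f.totalDegree with hd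
  set g := homogeneousComponent d f with hg
  have hg0 : g ≠ 0 := by
    intro h
    obtain ⟨n, hn, hnd⟩ := Finset.exists_mem_eq_sup f.support (support_nonempty.mpr hf)
      fun n => n.sum fun _ e => e
    have hnd' : n.degree = d := by rw [hd, totalDegree, hnd, Finsupp.degree]; rfl
    have := congrArg (coeff n) h
    rw [hg, coeff_homogeneousComponent, if_pos hnd', coeff_zero] at this
    exact (mem_support_iff.mp hn) this
  obtain ⟨v, hv⟩ : ∃ v : Fin (m + 2) → ℤ, eval v (X 0 * g) ≠ 0 := by
    by_contra! h
    exact mul_ne_zero (X_ne_zero _) hg0 (MvPolynomial.funext fun v => by rw [h v, map_zero])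
  rw [map_mul, eval_X] at hv
  have hv0 : v 0 ≠ 0 := left_ne_zero_of_mul hv
  refine ⟨fun j => v j.succ.succ / v 0, ?_⟩
  set a : Fin m → ℚ := fun j => v j.succ.succ / v 0
  by_contra hlt
  rw [not_le] at hlt
  have h1 : slice a 0 g = 0 := by
    have h2 := homogeneousComponent_eq_zero _ _ hlt
    have hhom : ∀ i, (slice a 0 (homogeneousComponent i f)).IsHomogeneous i := fun i => by
      have := (homogeneousComponent_isHomogeneous i f).aeval (R := ℤ) (S := ℚ) (sliceCoord a 0) (n := 1)
        (by
          intro i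
          refine Fin.cases (isHomogeneous_X _ _) (fun i => Fin.cases (isHomogeneous_X _ _) (fun j => ?_) i) i
          simp only [sliceCoord, Fin.cons_succ, Pi.zero_apply, C_0, zero_add]
          simpa using (isHomogeneous_C _ _).mul (isHomogeneous_X ℚ (0 : Fin 2)))
      rwa [one_mul] at this
    have h3 : slice a 0 f = ∑ i ∈ Finset.range (d + 1), slice a 0 (homogeneousComponent i f) := by
      conv_lhs => rw [← sum_homogeneousComponent (φ := f)]
      simp only [slice, map_sum]
      rfl
    rw [h3, map_sum, Finset.sum_eq_single d] at h2
    · rwa [homogeneousComponent_of_mem (hhom d), if_pos rfl] at h2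
    · intro i _ hi
      rw [homogeneousComponent_of_mem (hhom i), if_neg hi.symm]
    · simp
  have h2 := eval_slice a 0 g ![(v 0 : ℚ), v 1]
  rw [h1, map_zero] at h2
  have h3 : (Fin.cons (![(v 0 : ℚ), v 1] 0) (Fin.cons (![(v 0 : ℚ), v 1] 1)
      fun j => (0 : Fin m → ℚ) j + a j * ![(v 0 : ℚ), v 1] 0) : Fin (m + 2) → ℚ) =
      fun i => algebraMap ℤ ℚ (v i) := by
    funext i
    refine Fin.cases rfl (fun i => Fin.cases rfl (fun j => ?_) i) i
    simp [a, hv0]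
  rw [h3] at h2
  have h4 := (aeval_algebraMap_apply ℚ v g).symm.trans h2.symm
  exact right_ne_zero_of_mul hv (by
    have : ((eval v g : ℤ) : ℚ) = 0 := by simpa [aeval_eq_eval] using h4
    exact_mod_cast this)

end Slice

section Certificate

variable {m : ℕ}

/-- The restriction of a polynomial to the generic plane `z = k + a x`. -/
noncomputable def genericSlice (R : Type*) [CommRing R] (f : MvPolynomial (Fin (m + 2)) ℤ) :
    MvPolynomial (Fin 2) (MvPolynomial (Fin m ⊕ Fin m) R) :=
  slice (fun j => X (.inl j)) (fun j => X (.inr j)) f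

theorem genericSlice_map {R S : Type*} [CommRing R] [CommRing S] (φ : R →+* S)
    (f : MvPolynomial (Fin (m + 2)) ℤ) :
    map (map φ) (genericSlice R f) = genericSlice S f := by
  rw [genericSlice, map_slice, genericSlice]
  congr 1 <;> · funext j; simp

theorem genericSlice_specialize {R : Type*} [CommRing R] (f : MvPolynomial (Fin (m + 2)) ℤ)
    (a k : Fin m → R) : map (eval (Sum.elim a k)) (genericSlice R f) = slice a k f := by
  rw [genericSlice, map_slice]
  congr 1 <;> · funext j; simp

theorem totalDegree_genericSlice {f : MvPolynomial (Fin (m + 2)) ℤ} (hf : f ≠ 0) :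
    (genericSlice ℚ f).totalDegree = f.totalDegree := by
  refine le_antisymm (totalDegree_slice_le _ _ _) ?_
  obtain ⟨a, ha⟩ := exists_totalDegree_slice_eq hf
  refine ha.trans ?_
  rw [← genericSlice_specialize]
  exact Finset.sup_mono (support_map_subset _ _)

/-- The coordinates of the ambient space inside the extended space of lines. -/
def lineEmb (m : ℕ) : Fin (m + 2) → Option (Fin m ⊕ Option (Fin m)) :=
  Fin.cons (some (.inr none)) (Fin.cons none fun j => some (.inr (some j)))

theorem lineEmb_injective : Function.Injective (lineEmb m) := by
  intro i j
  refine Fin.cases (Fin.cases ?_ (fun j => Fin.cases ?_ (fun j => ?_) j) j)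
    (fun i => Fin.cases (Fin.cases ?_ (fun j => Fin.cases ?_ (fun j => ?_) j) j)
      (fun i => Fin.cases ?_ (fun j => Fin.cases ?_ (fun j => ?_) j) j) i) i <;>
  simp [lineEmb]

theorem toLines_rename_lineEmb (f : MvPolynomial (Fin (m + 2)) ℤ) :
    toLines (Fin m) (rename (lineEmb m) (map (Int.castRingHom ℚ) f)) = genericSlice ℚ f := by
  have : ((toLines (Fin m)).toRingHom.comp (rename (lineEmb m)).toRingHom).comp
      (map (Int.castRingHom ℚ)) =
      (aeval (sliceCoord (fun j => X (.inl j)) (fun j => X (.inr j))) :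
        MvPolynomial (Fin (m + 2)) ℤ →ₐ[ℤ]
          MvPolynomial (Fin 2) (MvPolynomial (Fin m ⊕ Fin m) ℚ)).toRingHom := by
    refine MvPolynomial.ringHom_ext (fun r => by simp) fun i => ?_
    refine Fin.cases (by simp [sliceCoord, lineEmb, toLines]) (fun i => Fin.cases ?_ (fun j => ?_) i) i
    · simp [sliceCoord, lineEmb, toLines]
    · simp [sliceCoord, lineEmb, toLines]
  exact DFunLike.congr_fun this f

/-- A polynomial with polynomial coefficients of degree at most `N`. -/
def CoeffDegLE {σ τ R : Type*} [CommRing R] (N : ℕ) (p : MvPolynomial σ (MvPolynomial τ R)) : Prop :=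
  ∀ i, (coeff i p).totalDegree ≤ N

section CoeffDegLE

variable {σ τ R : Type*} [CommRing R] {N M : ℕ} {p q : MvPolynomial σ (MvPolynomial τ R)}

theorem CoeffDegLE.mono (hp : CoeffDegLE N p) (h : N ≤ M) : CoeffDegLE M p :=
  fun i => (hp i).trans h

theorem CoeffDegLE.add (hp : CoeffDegLE N p) (hq : CoeffDegLE N q) : CoeffDegLE N (p + q) :=
  fun i => by rw [coeff_add]; exact (totalDegree_add _ _).trans (max_le (hp i) (hq i))

theorem CoeffDegLE.sub (hp : CoeffDegLE N p) (hq : CoeffDegLE N q) : CoeffDegLE N (p - q) :=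
  fun i => by rw [coeff_sub]; exact (totalDegree_sub _ _).trans (max_le (hp i) (hq i))

theorem CoeffDegLE.mul (hp : CoeffDegLE N p) (hq : CoeffDegLE M q) : CoeffDegLE (N + M) (p * q) :=
  fun i => by
    classical
    rw [coeff_mul]
    exact totalDegree_finsetSum_le fun x _ =>
      (totalDegree_mul _ _).trans (add_le_add (hp _) (hq _))

theorem CoeffDegLE.pderiv (hp : CoeffDegLE N p) (i : σ) : CoeffDegLE N (pderiv i p) :=
  fun j => by
    rw [MvPolynomial.coeff_pderiv]
    refine (totalDegree_mul _ _).trans ?_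
    have : ((j i + 1 : MvPolynomial τ R)).totalDegree = 0 := by
      have := totalDegree_C (σ := τ) ((j i + 1 : R))
      simpa using this
    rw [this]
    exact hp _

theorem CoeffDegLE.monomial_one (i : σ →₀ ℕ) :
    CoeffDegLE 0 (monomial i 1 : MvPolynomial σ (MvPolynomial τ R)) := fun j => by
  classical
  rw [coeff_monomial]; split_ifs <;> simp

theorem CoeffDegLE.zero : CoeffDegLE 0 (0 : MvPolynomial σ (MvPolynomial τ R)) := fun j => by simp

theorem CoeffDegLE.prod_pow {κ : Type*} (g : κ → MvPolynomial σ (MvPolynomial τ R))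
    (hg : ∀ i, CoeffDegLE 1 (g i)) (s : Finset κ) (n : κ → ℕ) :
    CoeffDegLE (∑ i ∈ s, n i) (∏ i ∈ s, g i ^ n i) := by
  classical
  have hpow : ∀ i k, CoeffDegLE k (g i ^ k) := by
    intro i k
    induction k with
    | zero => simpa using CoeffDegLE.monomial_one (τ := τ) (R := R) (0 : σ →₀ ℕ)
    | succ k ih => rw [pow_succ]; exact ih.mul (hg i)
  induction s using Finset.induction_on with
  | empty => simpa using CoeffDegLE.monomial_one (τ := τ) (R := R) (0 : σ →₀ ℕ)
  | insert a s ha ih => rw [Finset.sum_insert ha, Finset.prod_insert ha]; exact (hpow _ _).mul ih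

theorem CoeffDegLE.aeval {κ : Type*} [Fintype κ] {g : κ → MvPolynomial σ (MvPolynomial τ R)}
    (hg : ∀ i, CoeffDegLE 1 (g i)) (f : MvPolynomial κ ℤ) :
    CoeffDegLE f.totalDegree (aeval g f) := by
  classical
  intro i
  rw [aeval_def, eval₂_eq', coeff_sum]
  refine totalDegree_finsetSum_le fun n hn => ?_
  have : algebraMap ℤ (MvPolynomial σ (MvPolynomial τ R)) (coeff n f) =
    C (C (algebraMap ℤ R (coeff n f))) := by simp
  rw [this, coeff_C_mul]
  refine (totalDegree_mul _ _).trans ?_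
  rw [totalDegree_C, zero_add]
  refine (CoeffDegLE.prod_pow g hg Finset.univ n i).trans (le_trans (le_of_eq ?_) (le_totalDegree hn))
  rw [Finsupp.sum_fintype _ _ (fun _ => rfl)]

end CoeffDegLE

theorem coeffDegLE_genericSlice {R : Type*} [CommRing R] (f : MvPolynomial (Fin (m + 2)) ℤ) :
    CoeffDegLE f.totalDegree (genericSlice R f) := by
  classical
  refine CoeffDegLE.aeval (fun i => ?_) f
  have hX : ∀ j : Fin 2, CoeffDegLE 0 (X j : MvPolynomial (Fin 2) (MvPolynomial (Fin m ⊕ Fin m) R)) :=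
    fun j => CoeffDegLE.monomial_one _
  have hX' : ∀ j : Fin m ⊕ Fin m, CoeffDegLE 1
      (C (X j) : MvPolynomial (Fin 2) (MvPolynomial (Fin m ⊕ Fin m) R)) := fun j l => by
    rw [coeff_C]
    split_ifs
    · rw [X]; exact (totalDegree_monomial_le _ _).trans (by simp)
    · simp
  refine Fin.cases ((hX 0).mono zero_le_one) (fun i =>
    Fin.cases ((hX 1).mono zero_le_one) (fun j => ?_) i) i
  simp only [sliceCoord, Fin.cons_succ]
  exact (hX' _).add ((hX' _).mul (hX 0))

theorem totalDegree_ruppert_le {τ R : Type*} [CommRing R] {N d : ℕ}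
    {F : MvPolynomial (Fin 2) (MvPolynomial τ R)} (hF : CoeffDegLE N F) (i j) :
    (ruppert F d i j).totalDegree ≤ N := by
  have h : ∀ G H : MvPolynomial (Fin 2) (MvPolynomial τ R), CoeffDegLE 0 G → CoeffDegLE 0 H →
      CoeffDegLE N (closedNum F G H) := fun G H hG hH => by
    have h1 := ((hG.pderiv 1).mul hF)
    have h2 := (hG.mul (hF.pderiv 1))
    have h3 := ((hH.pderiv 0).mul hF)
    have h4 := (hH.mul (hF.pderiv 0))
    rw [zero_add] at h1 h2 h3 h4
    exact ((h1.sub h2).sub h3).add h4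
  rcases j with ⟨b, l⟩
  cases b
  · exact h _ _ CoeffDegLE.zero (CoeffDegLE.monomial_one _) _
  · exact h _ _ (CoeffDegLE.monomial_one _) CoeffDegLE.zero _

theorem totalDegree_det_le {τ R n : Type*} [CommRing R] [Fintype n] [DecidableEq n] {N : ℕ}
    (A : Matrix n n (MvPolynomial τ R)) (hA : ∀ i j, (A i j).totalDegree ≤ N) :
    A.det.totalDegree ≤ Fintype.card n * N := by
  rw [Matrix.det_apply']
  refine totalDegree_finsetSum_le fun σ _ => (totalDegree_mul _ _).trans ?_
  have : ((Equiv.Perm.sign σ : ℤ) : MvPolynomial τ R).totalDegree = 0 := by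
    have := totalDegree_C (σ := τ) (((Equiv.Perm.sign σ : ℤ) : R))
    simpa using this
  rw [this, zero_add]
  refine (totalDegree_finsetProd _ _).trans ((Finset.sum_le_card_nsmul _ _ _ fun i _ => hA _ _).trans ?_)
  simp

theorem card_ruppert_columns_le {d : ℕ} (hd : 1 ≤ d) (j₀ : Bool × expLE 2 (d - 1)) :
    Fintype.card {j // j ≠ j₀} ≤ d * (d + 1) := by
  rw [Fintype.card_subtype_compl, Fintype.card_prod, Fintype.card_coe, card_expLE]
  refine (Nat.sub_le _ _).trans ?_
  rw [Fintype.card_bool, show d - 1 + 2 = d + 1 by lia, Nat.choose_two_right]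
  have := Nat.div_mul_le_self ((d + 1) * (d + 1 - 1)) 2
  simp only [Nat.add_sub_cancel] at this ⊢
  nlinarith

/-- A nonzero minor of small degree certifying that generic plane sections are irreducible. -/
theorem exists_certificate {f : MvPolynomial (Fin (m + 2)) ℤ} {d : ℕ} (hfd : f.totalDegree = d)
    (hd : 1 ≤ d) (hf : Irreducible (map (Int.castRingHom ℚ) f)) {P : Fin (m + 2) → ℤ}
    (h0 : eval P f = 0) (h1 : eval P (pderiv 1 f) ≠ 0) :
    ∃ j₀ e, ruppertMinor (genericSlice ℤ f) d j₀ e ≠ 0 ∧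
      (ruppertMinor (genericSlice ℤ f) d j₀ e).totalDegree ≤ 2 * d ^ 3 := by
  classical
  have hdeg : ∀ j₀ e, (ruppertMinor (genericSlice ℤ f) d j₀ e).totalDegree ≤ 2 * d ^ 3 := by
    intro j₀ e
    refine (totalDegree_det_le (N := d) _ fun i j => ?_).trans ?_
    · have := totalDegree_ruppert_le (d := d) (coeffDegLE_genericSlice (R := ℤ) f) (e i) j.1
      rwa [hfd] at this
    · refine (Nat.mul_le_mul_right _ (card_ruppert_columns_le hd j₀)).trans ?_
      nlinarith [Nat.mul_le_mul_left (d ^ 2) hd]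
  suffices h : ∃ j₀ e, ruppertMinor (genericSlice ℚ f) d j₀ e ≠ 0 by
    obtain ⟨j₀, e, h⟩ := h
    refine ⟨j₀, e, fun h' => h ?_, hdeg j₀ e⟩
    rw [← genericSlice_map (Int.castRingHom ℚ) f, ruppertMinor_map, h', map_zero]
  have hf0 : f ≠ 0 := by rintro rfl; simp at hf
  obtain ⟨g, hg⟩ : ∃ g, g = rename (lineEmb m) (map (Int.castRingHom ℚ) f) := ⟨_, rfl⟩
  obtain ⟨Q, hQ⟩ : ∃ Q : Option (Fin m ⊕ Option (Fin m)) → ℚ, Q = fun o => o.elim (P 1 : ℚ)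
    (Sum.elim (fun _ => 0) fun o => o.elim (P 0 : ℚ) fun j => P j.succ.succ) := ⟨_, rfl⟩
  have hQe : Q ∘ lineEmb m = fun i => Int.castRingHom ℚ (P i) := by
    funext i
    refine Fin.cases (by simp [hQ, lineEmb]) (fun i => Fin.cases ?_ (fun j => ?_) i) i <;>
      simp [hQ, lineEmb]
  have hev : ∀ q : MvPolynomial (Fin (m + 2)) ℤ,
      eval Q (rename (lineEmb m) (map (Int.castRingHom ℚ) q)) = ((eval P q : ℤ) : ℚ) := fun q => by
    rw [eval_rename, hQe, eval_map, ← eq_intCast (Int.castRingHom ℚ), eval, coe_eval₂Hom, eval₂_comp_left]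
    rfl
  have hgi : Irreducible g := by
    rw [hg]; exact (prime_rename_of_injective lineEmb_injective hf.prime).irreducible
  have hg1 : pderiv none g = rename (lineEmb m) (map (Int.castRingHom ℚ) (pderiv 1 f)) := by
    have : lineEmb m 1 = none := rfl
    rw [hg, ← this, pderiv_rename lineEmb_injective, pderiv_map]
  obtain ⟨ξ, hξ, hξ0, hξf⟩ := exists_branch (f := g) (P := Q)
    (by rw [hg, hev, h0, Int.cast_zero]) (by rw [hg1, hev]; exact_mod_cast h1)
  have hga : ∀ j, pderiv (some (.inl j)) g = 0 := fun j => by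
    refine pderiv_eq_zero_of_notMem_vars fun hj => ?_
    rw [hg] at hj
    obtain ⟨i, -, hi⟩ := Finset.mem_image.mp (vars_rename _ _ hj)
    revert hi
    refine Fin.cases (by simp [lineEmb]) (fun i => Fin.cases ?_ (fun j => ?_) i) i <;>
      simp [lineEmb]
  have hξ1 : MvPowerSeries.constantCoeff (aeval ξ (pderiv none g)) ≠ 0 := by
    have : MvPowerSeries.constantCoeff (aeval ξ (pderiv none g)) = eval Q (pderiv none g) := by
      have h : (MvPowerSeries.constantCoeff (σ := Fin m ⊕ Option (Fin m)) (R := ℚ)).comp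
          (aeval ξ : MvPolynomial _ ℚ →ₐ[ℚ] _).toRingHom = eval Q := by
        refine MvPolynomial.ringHom_ext (fun r => by simp) fun i => by simp [hξ0]
      exact DFunLike.congr_fun h _
    rw [this, hg1, hev]; exact_mod_cast h1
  have hFg : toLines (Fin m) g = genericSlice ℚ f := by rw [hg, toLines_rename_lineEmb]
  have hFd : (genericSlice ℚ f).totalDegree = d := by rw [totalDegree_genericSlice hf0, hfd]
  have key : ∀ G H : MvPolynomial (Fin 2) (MvPolynomial (Fin m ⊕ Fin m) ℚ),
      G.totalDegree < d → H.totalDegree < d → closedNum (genericSlice ℚ f) G H = 0 →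
      ∃ r, G = C r * pderiv 0 (genericSlice ℚ f) ∧ H = C r * pderiv 1 (genericSlice ℚ f) := by
    intro G H hG hH h
    have := exists_eq_mul_pderiv_of_closedNum_eq_zero (c := fun t => Q (some t)) (G := G) (H := H)
      hgi hga (fun j => by simp [hQ]) hξ hξf hξ1
    rw [hFg, hFd] at this
    exact this hG hH h
  have hF1 : pderiv 1 (genericSlice ℚ f) ≠ 0 := by
    intro h
    have h2 := pderiv_one_toLines (ι := Fin m) g
    have h3 := ofLines_toLines (ι := Fin m) (pderiv none g)
    rw [← h2, hFg, h, map_zero] at h3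
    refine h1 ?_
    have h4 := hev (pderiv 1 f)
    rw [← hg1, ← h3, map_zero] at h4
    exact_mod_cast h4.symm
  obtain ⟨m₀, hm₀⟩ := ne_zero_iff.mp hF1
  have hm₀' : m₀ ∈ expLE 2 (d - 1) := by
    rw [mem_expLE]
    have h1 := le_totalDegree (mem_support_iff.mpr hm₀)
    have h2 := totalDegree_pderiv_le 1 (genericSlice ℚ f)
    rw [hFd] at h2
    refine le_trans (le_of_eq ?_) (h1.trans h2)
    rfl
  refine ⟨(false, ⟨m₀, hm₀'⟩), ?_⟩
  set j₀ : Bool × expLE 2 (d - 1) := (false, ⟨m₀, hm₀'⟩) with hj₀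
  have hinj : ∀ v : {j // j ≠ j₀} → MvPolynomial (Fin m ⊕ Fin m) ℚ,
      ((ruppert (genericSlice ℚ f) d).submatrix id Subtype.val).mulVec v = 0 → v = 0 := by
    intro v hv
    obtain ⟨w, hw⟩ : ∃ w : Bool × expLE 2 (d - 1) → MvPolynomial (Fin m ⊕ Fin m) ℚ,
      w = fun j => if h : j ≠ j₀ then v ⟨j, h⟩ else 0 := ⟨_, rfl⟩
    have hw0 : w j₀ = 0 := by simp [hw]
    have hwv : ∀ j : {j // j ≠ j₀}, w j.1 = v j := fun j => by simp [hw, j.2]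
    have hmul : (ruppert (genericSlice ℚ f) d).mulVec w = 0 := by
      rw [← hv]
      funext i
      simp only [Matrix.mulVec, dotProduct, Matrix.submatrix_apply, id]
      rw [Fintype.sum_eq_add_sum_subtype_ne _ j₀, hw0, mul_zero, zero_add]
      exact Finset.sum_congr rfl fun j _ => by rw [hwv]
    rw [ruppert_mulVec_eq_zero hFd.le] at hmul
    obtain ⟨r, hG, hH⟩ := key _ _
      ((totalDegree_ofCoeffs_le _).trans_lt (by lia)) ((totalDegree_ofCoeffs_le _).trans_lt (by lia)) hmul
    have hr : r = 0 := by
      have h2 := congrArg (coeff m₀) hH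
      rw [coeff_C_mul, show m₀ = (⟨m₀, hm₀'⟩ : expLE 2 (d - 1)).1 from rfl, coeff_ofCoeffs] at h2
      exact (mul_eq_zero.mp (h2.symm.trans hw0)).resolve_right hm₀
    rw [hr, C_0, zero_mul] at hG hH
    funext j
    rw [← hwv]
    rcases j with ⟨⟨b, l⟩, hj⟩
    cases b
    · have h2 := congrArg (coeff l.1) hH
      rwa [coeff_ofCoeffs, coeff_zero] at h2
    · have h2 := congrArg (coeff l.1) hG
      rwa [coeff_ofCoeffs, coeff_zero] at h2
  obtain ⟨e, he⟩ := exists_minor_ne_zero _ hinj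
  exact ⟨e, he⟩

end Certificate

section Mertens

open Real Finset

theorem log_factorial_eq_sum (n : ℕ) : Real.log (n.factorial : ℝ) =
    ∑ p ∈ (Ioc 0 n).filter Nat.Prime, (n.factorial.factorization p : ℝ) * Real.log p := by
  rw [Real.log_nat_eq_sum_factorization, Finsupp.sum]
  refine Finset.sum_subset (fun p hp => ?_) fun p _ hp => ?_
  · rw [Nat.support_factorization, Nat.mem_primeFactors] at hp
    rw [mem_filter, mem_Ioc]
    exact ⟨⟨hp.1.pos, (Nat.Prime.dvd_factorial hp.1).mp hp.2.1⟩, hp.1⟩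
  · rw [Finsupp.notMem_support_iff.mp hp]; simp

theorem factorization_factorial_le {p n : ℕ} (hp : p.Prime) :
    (n.factorial.factorization p : ℝ) ≤ n / (p - 1) := by
  have := Fact.mk hp
  have h := sub_one_mul_padicValNat_factorial (p := p) n
  have h2 : (p - 1) * padicValNat p n.factorial ≤ n := h ▸ Nat.sub_le _ _
  rw [Nat.factorization_def _ hp]
  have hp1 : (1 : ℝ) < p := by exact_mod_cast hp.one_lt
  rw [le_div_iff₀ (by linarith)]
  have h3 : (((p - 1) * padicValNat p n.factorial : ℕ) : ℝ) ≤ n := by exact_mod_cast h2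
  rw [Nat.cast_mul, Nat.cast_sub hp.one_lt.le] at h3
  push_cast at h3
  linarith

theorem le_factorization_factorial {p n : ℕ} (hp : p.Prime) :
    (n : ℝ) / p - 1 ≤ n.factorial.factorization p := by
  have := Fact.mk hp
  have h : n / p ≤ padicValNat p n.factorial := by
    rw [padicValNat_factorial (lt_add_one (Nat.log p n))]
    rcases Nat.lt_or_ge n p with h | h
    · rw [Nat.div_eq_of_lt h]; exact Nat.zero_le _
    · have := Finset.single_le_sum (f := fun i => n / p ^ i) (s := Ico 1 (Nat.log p n + 1))
        (fun _ _ => Nat.zero_le _) (a := 1) (mem_Ico.mpr ⟨le_rfl, by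
          have := Nat.log_pos hp.one_lt h; lia⟩)
      simpa using this
  rw [Nat.factorization_def _ hp]
  have h2 : (n : ℝ) / p < (n / p : ℕ) + 1 := by
    rw [div_lt_iff₀ (by exact_mod_cast hp.pos)]
    exact_mod_cast (by
      have := Nat.div_add_mod n p
      have h3 := Nat.mod_lt n hp.pos
      nlinarith : n < (n / p + 1) * p)
  have h3 : ((n / p : ℕ) : ℝ) ≤ padicValNat p n.factorial := by exact_mod_cast h
  linarith

theorem exists_log_le_sum_log_div : ∃ K : ℝ, 0 ≤ K ∧ ∀ n : ℕ, 1 ≤ n →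
    Real.log n - K ≤ ∑ p ∈ (Ioc 0 n).filter Nat.Prime, Real.log p / p := by
  have hs : Summable fun n : ℕ => 1 / (n : ℝ) ^ (3 / 2 : ℝ) :=
    Real.summable_one_div_nat_rpow.mpr (by norm_num)
  refine ⟨1 + 4 * ∑' n : ℕ, 1 / (n : ℝ) ^ (3 / 2 : ℝ), by positivity, fun n hn => ?_⟩
  have hn0 : (0 : ℝ) < n := by exact_mod_cast hn
  have h1 : (n : ℝ) * Real.log n - n ≤ Real.log n.factorial := by
    have h2 : ((n : ℝ) / Real.exp 1) ^ n ≤ n.factorial := by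
      have h3 : (n : ℝ) ^ n / n.factorial ≤ Real.exp n := by
        have := Real.pow_div_factorial_le_exp (n : ℝ) hn0.le n
        exact this
      rw [div_pow, ← Real.exp_nat_mul, mul_one, div_le_iff₀ (Real.exp_pos _)]
      rwa [div_le_iff₀ (by positivity), mul_comm] at h3
    have h4 := Real.log_le_log (by positivity) h2
    rw [Real.log_pow, Real.log_div hn0.ne' (Real.exp_pos 1).ne', Real.log_exp] at h4
    linarith
  rw [log_factorial_eq_sum] at h1
  have h2 : ∀ p ∈ (Ioc 0 n).filter Nat.Prime, (n.factorial.factorization p : ℝ) * Real.log p ≤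
      n * (Real.log p / p + 4 * (1 / (p : ℝ) ^ (3 / 2 : ℝ))) := by
    intro p hp
    have hp := (mem_filter.mp hp).2
    have hp2 : (2 : ℝ) ≤ p := by exact_mod_cast hp.two_le
    have hlog : 0 ≤ Real.log p := Real.log_nonneg (by linarith)
    refine (mul_le_mul_of_nonneg_right (factorization_factorial_le hp) hlog).trans ?_
    rw [div_mul_eq_mul_div, mul_div_assoc]
    refine mul_le_mul_of_nonneg_left ?_ hn0.le
    have h5 : Real.log p ≤ 2 * √p := by
      have := Real.log_le_sub_one_of_pos (Real.sqrt_pos.mpr (by linarith : (0 : ℝ) < p))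
      rw [Real.log_sqrt (by linarith)] at this
      linarith
    have h6 : (p : ℝ) ^ (3 / 2 : ℝ) = p * √p := by
      rw [Real.sqrt_eq_rpow, ← Real.rpow_one_add' (by linarith) (by norm_num)]; norm_num
    have hsq : √(p : ℝ) * √p = p := Real.mul_self_sqrt (by linarith)
    have hsp : 0 < √(p : ℝ) := Real.sqrt_pos.mpr (by linarith)
    rw [h6]
    have h7 : Real.log p / (p - 1) - Real.log p / p = Real.log p / (p * (p - 1)) := by
      field_simp [show (p : ℝ) - 1 ≠ 0 by linarith]; ring
    have h8 : Real.log p / (p * (p - 1)) ≤ 4 * (1 / (p * √p)) := by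
      rw [mul_one_div, div_le_div_iff₀ (by nlinarith) (by positivity)]
      calc Real.log p * (p * √p) ≤ 2 * √p * (p * √p) := by gcongr
        _ = 2 * p * (√p * √p) := by ring
        _ = 2 * p * p := by rw [hsq]
        _ ≤ 4 * (p * (p - 1)) := by nlinarith
    linarith
  have h3 := h1.trans (Finset.sum_le_sum h2)
  rw [← Finset.mul_sum, Finset.sum_add_distrib, ← Finset.mul_sum] at h3
  have h4 := hs.sum_le_tsum ((Ioc 0 n).filter Nat.Prime) (fun _ _ => by positivity)
  have h5 : Real.log n - 1 ≤ ∑ p ∈ (Ioc 0 n).filter Nat.Prime, Real.log p / p +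
      4 * ∑ p ∈ (Ioc 0 n).filter Nat.Prime, 1 / (p : ℝ) ^ (3 / 2 : ℝ) := by
    refine le_of_mul_le_mul_left ?_ hn0
    linarith
  linarith

theorem sum_log_prime_le (n : ℕ) :
    ∑ p ∈ (Ioc 0 n).filter Nat.Prime, Real.log p ≤ Real.log 4 * n := by
  have := Chebyshev.theta_le_log4_mul_x (x := n) (by positivity)
  rwa [Chebyshev.theta, Nat.floor_natCast] at this

theorem sum_log_div_le {n : ℕ} (hn : 1 ≤ n) :
    ∑ p ∈ (Ioc 0 n).filter Nat.Prime, Real.log p / p ≤ Real.log n + Real.log 4 := by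
  have hn0 : (0 : ℝ) < n := by exact_mod_cast hn
  have h1 : Real.log n.factorial ≤ n * Real.log n := by
    rw [← Real.log_pow]
    exact Real.log_le_log (by positivity) (by exact_mod_cast Nat.factorial_le_pow n)
  rw [log_factorial_eq_sum] at h1
  have h2 : ∀ p ∈ (Ioc 0 n).filter Nat.Prime, n * (Real.log p / p) - Real.log p ≤
      (n.factorial.factorization p : ℝ) * Real.log p := by
    intro p hp
    have hp := (mem_filter.mp hp).2
    have := mul_le_mul_of_nonneg_right (le_factorization_factorial (n := n) hp)
      (Real.log_nonneg (by exact_mod_cast hp.one_lt.le : (1 : ℝ) ≤ p))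
    refine le_trans (le_of_eq ?_) this
    ring
  have h3 := (Finset.sum_le_sum h2).trans h1
  rw [Finset.sum_sub_distrib, ← Finset.mul_sum] at h3
  have h4 := sum_log_prime_le n
  refine le_of_mul_le_mul_left ?_ hn0
  linarith

theorem exists_log_sub_le_sum_log_div : ∃ K : ℝ, 0 ≤ K ∧ ∀ X n : ℕ, 1 ≤ X → X ≤ n →
    Real.log n - Real.log X - K ≤ ∑ p ∈ (Ioc X n).filter Nat.Prime, Real.log p / p := by
  obtain ⟨K, hK, h⟩ := exists_log_le_sum_log_div
  refine ⟨K + Real.log 4, add_nonneg hK (Real.log_nonneg (by norm_num)), fun X n hX hn => ?_⟩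
  have h1 := h n (hX.trans hn)
  have h2 := sum_log_div_le hX
  have h3 : (Ioc 0 n).filter Nat.Prime =
      (Ioc 0 X).filter Nat.Prime ∪ (Ioc X n).filter Nat.Prime := by
    rw [← Finset.filter_union, Finset.Ioc_union_Ioc_eq_Ioc (Nat.zero_le X) hn]
  rw [h3, Finset.sum_union] at h1
  · linarith
  · exact Finset.disjoint_filter_filter (Finset.Ioc_disjoint_Ioc_of_le le_rfl)

theorem sum_log_div_mul_sqrt_le_dyadic (k : ℕ) : ∀ X : ℕ, 1 ≤ X →
    ∑ p ∈ (Ioc X (2 ^ k * X)).filter Nat.Prime, Real.log p / (p * √p) ≤ 10 / √X := by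
  induction k with
  | zero => intro X _; simp only [pow_zero, one_mul, Ioc_self, filter_empty, sum_empty]; positivity
  | succ k ih =>
    intro X hX
    have hX0 : (0 : ℝ) < X := by exact_mod_cast hX
    have h3 : (Ioc X (2 ^ (k + 1) * X)).filter Nat.Prime =
        (Ioc X (2 * X)).filter Nat.Prime ∪ (Ioc (2 * X) (2 ^ k * (2 * X))).filter Nat.Prime := by
      rw [← Finset.filter_union, Finset.Ioc_union_Ioc_eq_Ioc (by lia)
        (Nat.le_mul_of_pos_left _ (by positivity)), pow_succ, mul_assoc]
    rw [h3, Finset.sum_union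
      (Finset.disjoint_filter_filter (Finset.Ioc_disjoint_Ioc_of_le le_rfl))]
    have h4 := ih (2 * X) (by lia)
    have hsX : 0 < √(X : ℝ) := Real.sqrt_pos.mpr hX0
    have h5 : ∑ p ∈ (Ioc X (2 * X)).filter Nat.Prime, Real.log p / (p * √p) ≤
        Real.log 4 * 2 / √X := by
      have : ∑ p ∈ (Ioc X (2 * X)).filter Nat.Prime, Real.log p / (p * √p) ≤
          ∑ p ∈ (Ioc X (2 * X)).filter Nat.Prime, Real.log p / (X * √X) := by
        refine Finset.sum_le_sum fun p hp => ?_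
        have hp' := mem_Ioc.mp (mem_filter.mp hp).1
        have hpX : (X : ℝ) ≤ p := by exact_mod_cast hp'.1.le
        have : 0 ≤ Real.log p := Real.log_nonneg (by exact_mod_cast (hX.trans hp'.1.le))
        gcongr
      refine this.trans ?_
      rw [← Finset.sum_div, div_le_div_iff₀ (by positivity) hsX]
      have h6 : ∑ p ∈ (Ioc X (2 * X)).filter Nat.Prime, Real.log p ≤ Real.log 4 * (2 * X : ℕ) := by
        refine le_trans (Finset.sum_le_sum_of_subset_of_nonneg
          (Finset.filter_subset_filter _ (Finset.Ioc_subset_Ioc_left (Nat.zero_le X)))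
          fun p hp _ => Real.log_natCast_nonneg _) (sum_log_prime_le (2 * X))
      push_cast at h6
      nlinarith
    have h7 : √((2 * X : ℕ) : ℝ) = √2 * √X := by push_cast; rw [Real.sqrt_mul (by norm_num)]
    rw [h7] at h4
    have hlog : Real.log 4 < 1.3864 := by
      rw [show (4 : ℝ) = 2 ^ 2 by norm_num, Real.log_pow]
      have := Real.log_two_lt_d9
      push_cast; linarith
    have h8 : (1.4142 : ℝ) < √2 := by
      rw [Real.lt_sqrt (by norm_num)]; norm_num
    have h9 : 10 / (√2 * √X) ≤ 7.0712 / √X := by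
      rw [div_le_div_iff₀ (by positivity) hsX]; nlinarith
    have h10 : Real.log 4 * 2 / √X ≤ 2.7728 / √X := by gcongr; linarith
    have h11 : (10 : ℝ) / √X = 2.7728 / √X + 7.2272 / √X := by rw [← add_div]; norm_num
    have h12 : 7.0712 / √(X : ℝ) ≤ 7.2272 / √X := by gcongr; norm_num
    linarith

theorem sum_log_div_mul_sqrt_le {X : ℕ} (hX : 1 ≤ X) (n : ℕ) :
    ∑ p ∈ (Ioc X n).filter Nat.Prime, Real.log p / (p * √p) ≤ 10 / √X := by
  refine le_trans (Finset.sum_le_sum_of_subset_of_nonneg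
    (Finset.filter_subset_filter _ (Finset.Ioc_subset_Ioc_right ?_)) fun p hp _ => ?_)
    (sum_log_div_mul_sqrt_le_dyadic n X hX)
  · exact n.lt_two_pow_self.le.trans (Nat.le_mul_of_pos_right _ hX)
  · exact div_nonneg (Real.log_natCast_nonneg _) (by positivity)

end Mertens

section Determinant

theorem choose_card_two_le_sum {ι : Type*} (s : Finset ι) (r : ι → ℕ) (hr : Set.InjOn r s) :
    s.card.choose 2 ≤ ∑ i ∈ s, r i := by
  classical
  rw [← Finset.card_image_of_injOn hr, ← Finset.sum_image (f := fun x => x) hr]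
  generalize s.image r = t
  induction t using Finset.induction_on_max with
  | empty => simp
  | insert a t ha ih =>
    have hat : a ∉ t := fun h => lt_irrefl _ (ha a h)
    have hc : t.card ≤ a := by
      have := Finset.card_le_card (fun x hx => Finset.mem_range.mpr (ha x hx) : t ⊆ Finset.range a)
      rwa [Finset.card_range] at this
    rw [Finset.card_insert_of_notMem hat, Finset.sum_insert hat, Nat.choose_succ_succ' _ 1,
      Nat.choose_one_right]
    exact add_le_add hc ih

/-- A determinant whose rows are, class by class, values of polynomials at multiples of `p` is
divisible by a large power of `p`. -/
theorem pow_dvd_det_of_classes {n κ : Type*} [Fintype n] [DecidableEq n] [Fintype κ] [DecidableEq κ]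
    (cl : n → κ) (p : ℤ) (A : Matrix n n ℤ) {N : ℕ}
    (hN : N = ∑ c, (Finset.univ.filter fun i => cl i = c).card.choose 2)
    (h : ∀ c, ∃ (G : n → Polynomial ℤ) (u : n → ℤ), ∀ i, cl i = c → ∀ j,
      p ^ N ∣ A i j - (G j).eval (p * u i)) : p ^ N ∣ A.det := by
  choose G u hGu using h
  set A' : Matrix n n ℤ := fun i j => (G (cl i) j).eval (p * u (cl i) i) with hA'
  have h1 : p ^ N ∣ A.det - A'.det := by
    rw [← Ideal.mem_span_singleton, ← Ideal.Quotient.eq, RingHom.map_det, RingHom.map_det]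
    congr 1
    ext i j
    exact (Ideal.Quotient.eq.mpr (Ideal.mem_span_singleton.mpr (hGu _ i rfl j)))
  suffices h2 : p ^ N ∣ A'.det by
    have := dvd_add h1 h2
    rwa [sub_add_cancel] at this
  obtain ⟨M, hM⟩ : ∃ M : ℕ, ∀ c j, (G c j).natDegree < M := by
    refine ⟨(Finset.univ.sup fun x : κ × n => (G x.1 x.2).natDegree) + 1, fun c j => Nat.lt_succ_of_le ?_⟩
    exact Finset.le_sup (f := fun x : κ × n => (G x.1 x.2).natDegree) (Finset.mem_univ (c, j))
  set R : n → Fin M → n → ℤ := fun i k => (p ^ (k : ℕ) * u (cl i) i ^ (k : ℕ)) •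
    fun j => (G (cl i) j).coeff k with hR
  have h3 : A' = fun i => ∑ k, R i k := by
    funext i j
    rw [Finset.sum_apply]
    simp only [hA', hR, Pi.smul_apply, smul_eq_mul]
    rw [Polynomial.eval_eq_sum_range' (hM (cl i) j), ← Fin.sum_univ_eq_sum_range
      (fun k => (G (cl i) j).coeff k * (p * u (cl i) i) ^ k)]
    exact Finset.sum_congr rfl fun k _ => by rw [mul_pow]; ring
  have h4 : A'.det = ∑ r : n → Fin M, Matrix.det fun i => R i (r i) := by
    have := (Matrix.detRowAlternating (n := n) (R := ℤ)).toMultilinearMap.map_sum (g := R)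
    rw [h3]
    exact this
  rw [h4]
  refine Finset.dvd_sum fun r _ => ?_
  have h5 : (Matrix.det fun i => R i (r i)) = (∏ i, (p ^ (r i : ℕ) * u (cl i) i ^ (r i : ℕ))) *
      Matrix.det fun i j => (G (cl i) j).coeff (r i) :=
    (Matrix.detRowAlternating (n := n) (R := ℤ)).toMultilinearMap.map_smul_univ _ _
  rw [h5]
  by_cases hinj : ∀ i i', cl i = cl i' → (r i : ℕ) = r i' → i = i'
  · refine Dvd.dvd.mul_right ?_ _
    rw [Finset.prod_mul_distrib, Finset.prod_pow_eq_pow_sum]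
    refine Dvd.dvd.mul_right (pow_dvd_pow _ ?_) _
    rw [hN, ← Finset.sum_fiberwise (s := Finset.univ) (g := cl) (f := fun i => (r i : ℕ))]
    refine Finset.sum_le_sum fun c _ => choose_card_two_le_sum _ _ fun i hi i' hi' hr => ?_
    simp only [Finset.coe_filter, Finset.mem_univ, true_and, Set.mem_ofPred_eq] at hi hi'
    exact hinj i i' (hi.trans hi'.symm) hr
  · push Not at hinj
    obtain ⟨i, i', hc, hr, hne⟩ := hinj
    have : (Matrix.det fun i j => (G (cl i) j).coeff (r i)) = 0 :=
      Matrix.det_zero_of_row_eq hne (by funext j; simp only [hc, hr])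
    rw [this, mul_zero]
    exact dvd_zero _

end Determinant

section Branch

/-- Evaluation of an integral bivariate polynomial at a pair of elements of a ring. -/
noncomputable def pairEval {A : Type*} [CommRing A] (a b : A) : MvPolynomial (Fin 2) ℤ →+* A :=
  eval₂Hom (Int.castRingHom A) ![a, b]

theorem derivative_pairEval_C_X {A : Type*} [CommRing A] (a : A) (F : MvPolynomial (Fin 2) ℤ) :
    Polynomial.derivative (pairEval (Polynomial.C a) Polynomial.X F) =
      pairEval (Polynomial.C a) Polynomial.X (pderiv 1 F) := by
  induction F using MvPolynomial.induction_on with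
  | C r => simp [pairEval]
  | add f g hf hg => simp only [map_add, hf, hg]
  | mul_X f i hf =>
    have h0 : pairEval (Polynomial.C a) Polynomial.X (X 0) = Polynomial.C a := by simp [pairEval]
    have h1 : pairEval (Polynomial.C a) Polynomial.X (X 1) = Polynomial.X := by simp [pairEval]
    rw [map_mul, Polynomial.derivative_mul, hf, Derivation.leibniz, map_add, smul_eq_mul,
      smul_eq_mul, map_mul, map_mul]
    refine Fin.cases ?_ (fun i => ?_) i
    · rw [h0, pderiv_X_of_ne (by decide), map_zero, Polynomial.derivative_C]
      ring
    · rw [Subsingleton.elim i 0, Fin.succ_zero_eq_one, h1, pderiv_X_self, map_one,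
        Polynomial.derivative_X]
      ring

theorem eval_pairEval_C_X {A : Type*} [CommRing A] (a b : A) (F : MvPolynomial (Fin 2) ℤ) :
    Polynomial.eval b (pairEval (Polynomial.C a) Polynomial.X F) = pairEval a b F := by
  have : (Polynomial.evalRingHom b).comp
      (pairEval (Polynomial.C a) Polynomial.X) =
      pairEval a b := by
    refine MvPolynomial.ringHom_ext (fun r => by simp [pairEval]) fun i => ?_
    fin_cases i <;> simp [pairEval]
  exact DFunLike.congr_fun this F

theorem ringHom_pairEval {A B : Type*} [CommRing A] [CommRing B] (θ : A →+* B) (a b : A)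
    (F : MvPolynomial (Fin 2) ℤ) : θ (pairEval a b F) = pairEval (θ a) (θ b) F := by
  have : θ.comp (pairEval a b) =
      pairEval (θ a) (θ b) := by
    refine MvPolynomial.ringHom_ext (fun r => by simp [pairEval]) fun i => ?_
    fin_cases i <;> simp [pairEval]
  exact DFunLike.congr_fun this F

theorem pairEval_int (F : MvPolynomial (Fin 2) ℤ) (P : Fin 2 → ℤ) :
    pairEval (P 0) (P 1) F = eval P F := by
  rw [pairEval, eval, coe_eval₂Hom, coe_eval₂Hom, ← RingHom.eq_intCast' (RingHom.id ℤ)]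
  congr 1
  funext i; fin_cases i <;> rfl

theorem dvd_sub_of_dvd_eval {p : ℕ} (hp : p.Prime) {N : ℕ} {G : Polynomial ℤ} {y y' : ℤ}
    (h0 : G.eval y = 0) (h1 : ¬ (p : ℤ) ∣ G.derivative.eval y) (hy : (p : ℤ) ∣ y' - y)
    (h : (p : ℤ) ^ N ∣ G.eval y') : (p : ℤ) ^ N ∣ y - y' := by
  obtain ⟨k, hk⟩ := G.binomExpansion y (y' - y)
  rw [add_sub_cancel, h0, zero_add] at hk
  rw [hk] at h
  have h2 : (p : ℤ) ^ N ∣ (G.derivative.eval y + k * (y' - y)) * (y' - y) := by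
    convert h using 1; ring
  have hcop : IsCoprime ((p : ℤ) ^ N) (G.derivative.eval y + k * (y' - y)) := by
    refine IsCoprime.pow_left ((Nat.prime_iff_prime_int.mp hp).coprime_iff_not_dvd.mpr fun h3 => h1 ?_)
    exact (dvd_add_left (hy.mul_left k)).mp h3
  rw [← dvd_neg, neg_sub]
  exact hcop.dvd_of_dvd_mul_left h2

/-- Integral points in one residue class lie, up to a high power of `p`, on one polynomial branch. -/
theorem exists_padic_branch {p : ℕ} (hp : p.Prime) (F : MvPolynomial (Fin 2) ℤ) (Q : Fin 2 → ℤ)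
    (h0 : eval Q F = 0) (h1 : ¬ (p : ℤ) ∣ eval Q (pderiv 1 F)) (N : ℕ) :
    ∃ ψ : Polynomial ℤ, ∀ (P : Fin 2 → ℤ) (u : ℤ), eval P F = 0 → P 0 = Q 0 + p * u →
      (p : ℤ) ∣ P 1 - Q 1 → (p : ℤ) ^ N ∣ P 1 - ψ.eval (p * u) := by
  obtain ⟨q, hq⟩ : ∃ q : Polynomial (Polynomial ℤ),
    q = pairEval (Polynomial.C (Polynomial.C (Q 0) + Polynomial.X)) Polynomial.X F := ⟨_, rfl⟩
  set I : Ideal (Polynomial ℤ) := Ideal.span {Polynomial.C (p : ℤ), Polynomial.X} with hI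
  have hmem : ∀ g : Polynomial ℤ, (p : ℤ) ∣ g.eval 0 → g ∈ I := by
    intro g hg
    rw [← Polynomial.coeff_zero_eq_eval_zero] at hg
    obtain ⟨t, ht⟩ := hg
    rw [← Polynomial.divX_mul_X_add g, ht, Polynomial.C_mul]
    exact I.add_mem (I.mul_mem_left _ (Ideal.subset_span (by simp)))
      (I.mul_mem_right _ (Ideal.subset_span (by simp)))
  have hev : ∀ q' : MvPolynomial (Fin 2) ℤ, (Polynomial.eval (Polynomial.C (Q 1))
      (pairEval (Polynomial.C (Polynomial.C (Q 0) + Polynomial.X)) Polynomial.X q')).eval 0 =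
      eval Q q' := by
    intro q'
    rw [eval_pairEval_C_X, ← Polynomial.coe_evalRingHom, ringHom_pairEval]
    simpa using pairEval_int q' Q
  obtain ⟨c, w, hcw⟩ : IsCoprime (eval Q (pderiv 1 F)) (p : ℤ) :=
    ((Nat.prime_iff_prime_int.mp hp).coprime_iff_not_dvd.mpr h1).symm
  have hspec := newtonSeq_spec (I := I) (q := q) (a := Polynomial.C (Q 1)) (c := Polynomial.C c)
    (hmem _ (by rw [hq, hev, h0]; exact dvd_zero _)) (hmem _ (by
      rw [hq, derivative_pairEval_C_X, Polynomial.eval_sub, Polynomial.eval_mul, hev,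
        Polynomial.eval_C, Polynomial.eval_one]
      exact ⟨-w, by linarith⟩)) N
  obtain ⟨ψ, hψ⟩ : ∃ ψ, ψ = newtonSeq q (Polynomial.C (Q 1)) (Polynomial.C c) N := ⟨_, rfl⟩
  rw [← hψ] at hspec
  refine ⟨ψ, fun P u hP hx hy => ?_⟩
  have hθI : ∀ k, ∀ g ∈ I ^ k, (p : ℤ) ^ k ∣ g.eval (p * u) := by
    intro k g hg
    have h2 : I.map (Polynomial.evalRingHom (p * u : ℤ)) ≤ Ideal.span {(p : ℤ)} := by
      rw [hI, Ideal.map_span, Ideal.span_le]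
      rintro _ ⟨g, hg, rfl⟩
      rcases hg with rfl | rfl
      · simp
      · simp [Ideal.mem_span_singleton]
    have h3 := Ideal.mem_map_of_mem (Polynomial.evalRingHom (p * u : ℤ)) hg
    rw [Ideal.map_pow] at h3
    have h4 := Ideal.pow_right_mono h2 k h3
    rwa [Ideal.span_singleton_pow, Ideal.mem_span_singleton] at h4
  have hψ0 : (p : ℤ) ∣ ψ.eval (p * u) - Q 1 := by
    have := hθI 1 _ (by rw [pow_one]; exact hspec.2)
    simpa using this
  have hψN : (p : ℤ) ^ N ∣ Polynomial.eval (ψ.eval (p * u))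
      (pairEval (Polynomial.C (P 0)) Polynomial.X F) := by
    refine (pow_dvd_pow _ N.le_succ).trans ?_
    have := hθI _ _ hspec.1
    rw [hq, eval_pairEval_C_X, ← Polynomial.coe_evalRingHom, ringHom_pairEval] at this
    rw [eval_pairEval_C_X, hx]
    simpa using this
  refine dvd_sub_of_dvd_eval hp (G := pairEval (Polynomial.C (P 0)) Polynomial.X F)
    ?_ ?_ ?_ hψN
  · rw [eval_pairEval_C_X, pairEval_int, hP]
  · rw [derivative_pairEval_C_X, eval_pairEval_C_X, pairEval_int]
    intro h
    refine h1 ?_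
    have h2 : (p : ℤ) ∣ eval P (pderiv 1 F) - eval Q (pderiv 1 F) := by
      rw [← Ideal.mem_span_singleton, ← Ideal.Quotient.eq, ← pairEval_int, ← pairEval_int,
        ringHom_pairEval, ringHom_pairEval]
      have e0 := Ideal.Quotient.eq.mpr (Ideal.mem_span_singleton.mpr (⟨u, by linarith⟩ :
        (p : ℤ) ∣ P 0 - Q 0))
      have e1 := Ideal.Quotient.eq.mpr (Ideal.mem_span_singleton.mpr hy)
      rw [e0, e1]
    exact (dvd_sub_right h).mp h2
  · have := dvd_sub hψ0 hy
    rwa [sub_sub_sub_cancel_right] at this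

end Branch

section LocalDivisibility

/-- The determinant of values of polynomials at integral points of a plane curve is divisible by
a power of `p` controlled by the number of points of the reduced curve. -/
theorem exists_pow_dvd_det_eval {p : ℕ} (hp : p.Prime) (F : MvPolynomial (Fin 2) ℤ) {n : Type*}
    [Fintype n] [DecidableEq n] (g : n → MvPolynomial (Fin 2) ℤ) (P : n → Fin 2 → ℤ)
    (hP : ∀ i, eval (P i) F = 0) (T : Finset (Fin 2 → ZMod p))
    (hT : ∀ i, ¬ (p : ℤ) ∣ eval (P i) (pderiv 1 F) → (fun j => (P i j : ZMod p)) ∈ T)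
    {U : ℝ} (hU : 0 < U) (hTU : (T.card : ℝ) ≤ U) :
    ∃ e : ℕ, (p : ℤ) ^ e ∣ (Matrix.of fun i j => eval (P i) (g j)).det ∧
      ((Fintype.card n : ℝ) ^ 2 - 2 * Fintype.card n *
        (Finset.univ.filter fun i => (p : ℤ) ∣ eval (P i) (pderiv 1 F)).card) / U -
        Fintype.card n ≤ 2 * e := by
  classical
  have := Fact.mk hp
  set bad : n → Prop := fun i => (p : ℤ) ∣ eval (P i) (pderiv 1 F) with hbad
  set cl : n → n ⊕ (Fin 2 → ZMod p) := fun i =>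
    if bad i then .inl i else .inr fun j => (P i j : ZMod p) with hcl
  refine ⟨_, pow_dvd_det_of_classes cl p _ rfl ?_, ?_⟩
  · generalize (∑ c, (Finset.univ.filter fun i => cl i = c).card.choose 2) = N
    rintro (i | c)
    · refine ⟨fun j => Polynomial.C (eval (P i) (g j)), 0, fun i' hi' j => ?_⟩
      have : i' = i := by
        simp only [hcl] at hi'
        split_ifs at hi'
        exact Sum.inl_injective hi'
      rw [this]
      simp
    · by_cases hc : ∃ i, cl i = .inr c
      · obtain ⟨i, hi⟩ := hc
        have key : ∀ i, cl i = .inr c → ¬ bad i ∧ ∀ j, (P i j : ZMod p) = c j := by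
          intro i hi
          simp only [hcl] at hi
          split_ifs at hi with h
          exact ⟨h, fun j => congrFun (Sum.inr_injective hi) j⟩
        obtain ⟨hb, hic⟩ := key i hi
        obtain ⟨ψ, hψ⟩ := exists_padic_branch hp F (P i) (hP i) hb N
        have hdiv : ∀ i', cl i' = .inr c → ∀ j, (p : ℤ) ∣ P i' j - P i j := fun i' hi' j => by
          rw [← ZMod.intCast_zmod_eq_zero_iff_dvd]
          push_cast
          rw [(key i' hi').2 j, hic j, sub_self]
        refine ⟨fun j => pairEval (Polynomial.C (P i 0) + Polynomial.X) ψ (g j),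
          fun i' => (P i' 0 - P i 0) / p, fun i' hi' j => ?_⟩
        have hu : P i' 0 = P i 0 + p * ((P i' 0 - P i 0) / p) := by
          rw [Int.mul_ediv_cancel' (hdiv i' hi' 0)]; ring
        have h2 := hψ (P i') _ (hP i') hu (hdiv i' hi' 1)
        rw [Matrix.of_apply, ← pairEval_int, ← Polynomial.coe_evalRingHom, ringHom_pairEval,
          ← Ideal.mem_span_singleton, ← Ideal.Quotient.eq, ringHom_pairEval, ringHom_pairEval]
        rw [← Ideal.mem_span_singleton, ← Ideal.Quotient.eq] at h2
        simp only [Polynomial.coe_evalRingHom, Polynomial.eval_add, Polynomial.eval_C,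
          Polynomial.eval_X]
        rw [← hu, h2]
      · exact ⟨0, 0, fun i hi => absurd ⟨i, hi⟩ hc⟩
  · set s := Fintype.card n
    set nc : (Fin 2 → ZMod p) → ℕ := fun c => (Finset.univ.filter fun i => cl i = .inr c).card
    set b := (Finset.univ.filter fun i => bad i).card
    have hsum : ∑ c ∈ T, nc c = s - b := by
      have h1 : (Finset.univ.filter fun i => ¬ bad i).card = ∑ c ∈ T, nc c := by
        rw [Finset.card_eq_sum_card_fiberwise (f := fun i => fun j => (P i j : ZMod p)) (t := T)
          (fun i hi => hT i (by simpa using hi))]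
        refine Finset.sum_congr rfl fun c _ => ?_
        congr 1
        ext i
        simp only [Finset.mem_filter, Finset.mem_univ, true_and, hcl]
        split_ifs with h <;> simp [h]
      rw [← h1]
      have := Finset.card_filter_add_card_filter_not (s := (Finset.univ : Finset n)) bad
      rw [Finset.card_univ] at this
      lia
    have hbs : b ≤ s := Finset.card_le_univ _
    have hge : ∑ c ∈ T, (nc c).choose 2 ≤
        ∑ c, (Finset.univ.filter fun i => cl i = c).card.choose 2 := by
      rw [Fintype.sum_sum_type]
      exact (Finset.sum_le_univ_sum_of_nonneg fun _ => Nat.zero_le _).trans (Nat.le_add_left _ _)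
    have hge' : (∑ c ∈ T, ((nc c : ℝ) ^ 2 - nc c)) ≤
        2 * ((∑ c, (Finset.univ.filter fun i => cl i = c).card.choose 2 : ℕ) : ℝ) := by
      refine le_trans (le_of_eq ?_) (mul_le_mul_of_nonneg_left (Nat.cast_le.mpr hge) zero_le_two)
      rw [Nat.cast_sum, Finset.mul_sum]
      exact Finset.sum_congr rfl fun c _ => by rw [Nat.cast_choose_two]; ring
    refine le_trans ?_ hge'
    have hsum' : ∑ c ∈ T, (nc c : ℝ) = s - b := by
      rw [← Nat.cast_sum, hsum, Nat.cast_sub hbs]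
    rw [Finset.sum_sub_distrib, hsum']
    have hcs := sq_sum_le_card_mul_sum_sq (s := T) (f := fun c => (nc c : ℝ))
    rw [hsum'] at hcs
    have hsq : 0 ≤ ∑ c ∈ T, (nc c : ℝ) ^ 2 := Finset.sum_nonneg fun _ _ => by positivity
    have h3 : ((s : ℝ) ^ 2 - 2 * s * b) / U ≤ ∑ c ∈ T, (nc c : ℝ) ^ 2 := by
      rw [div_le_iff₀ hU]
      have := mul_le_mul_of_nonneg_right hTU hsq
      nlinarith [sq_nonneg (b : ℝ)]
    have hb0 : (0 : ℝ) ≤ b := Nat.cast_nonneg _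
    linarith

end LocalDivisibility

section Reduction

theorem exists_pderiv_ne_zero_of_natCast_ne_zero {σ K : Type*} [Field K] {d : ℕ}
    (h : ∀ n, 1 ≤ n → n ≤ d → (n : K) ≠ 0) (q : MvPolynomial σ K) (hq : q.totalDegree ≤ d)
    (hq0 : q.totalDegree ≠ 0) : ∃ i, pderiv i q ≠ 0 := by
  by_contra! h'
  exact hq0 (totalDegree_eq_zero_of_pderiv (fun n h1 h2 => h n h1 (h2.trans hq)) h')

theorem irreducible_map_of_ruppertMinor_ne_zero {K : Type*} [Field K] {d : ℕ}
    {F : MvPolynomial (Fin 2) ℤ} (hd : 1 ≤ d) (hF : F.totalDegree ≤ d)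
    (h : ∀ n, 1 ≤ n → n ≤ d → (n : K) ≠ 0) {j₀ : Bool × expLE 2 (d - 1)}
    {e : {j // j ≠ j₀} → expLE 2 (2 * d)} (hdet : ((ruppertMinor F d j₀ e : ℤ) : K) ≠ 0) :
    Irreducible (map (Int.castRingHom K) F) ∧ (map (Int.castRingHom K) F).totalDegree = d := by
  refine irreducible_of_ruppertMinor_ne_zero hd ?_
    (exists_pderiv_ne_zero_of_natCast_ne_zero h) (j₀ := j₀) (e := e) ?_
  · exact (Finset.sup_mono (support_map_subset _ _)).trans hF
  · rw [ruppertMinor_map]; exact hdet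

theorem exists_pow_dvd_det_of_ruppertMinor {p d : ℕ} (hp : p.Prime) (hd : 1 ≤ d)
    (hpd : 10000 * d ^ 4 ≤ p) {F : MvPolynomial (Fin 2) ℤ} (hF : F.totalDegree ≤ d)
    {j₀ : Bool × expLE 2 (d - 1)} {e : {j // j ≠ j₀} → expLE 2 (2 * d)}
    (hdet : ¬ (p : ℤ) ∣ ruppertMinor F d j₀ e) {n : Type*}
    [Fintype n] [DecidableEq n] (g : n → MvPolynomial (Fin 2) ℤ) (P : n → Fin 2 → ℤ)
    (hP : ∀ i, eval (P i) F = 0) :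
    ∃ e : ℕ, (p : ℤ) ^ e ∣ (Matrix.of fun i j => eval (P i) (g j)).det ∧
      ((Fintype.card n : ℝ) ^ 2 - 2 * Fintype.card n *
        (Finset.univ.filter fun i => (p : ℤ) ∣ eval (P i) (pderiv 1 F)).card) /
          (p + 9 * d ^ 2 * √p) - Fintype.card n ≤ 2 * e := by
  classical
  have := Fact.mk hp
  have hdp : d < p := by
    have : d ^ 1 ≤ d ^ 4 := Nat.pow_le_pow_right hd (by norm_num)
    lia
  obtain ⟨hirr, hdeg⟩ := irreducible_map_of_ruppertMinor_ne_zero (K := ZMod p) hd hF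
    (fun n h1 h2 h => by
      rw [ZMod.natCast_eq_zero_iff] at h
      exact absurd (Nat.le_of_dvd h1 h) (by lia))
    (by rwa [Ne, ZMod.intCast_zmod_eq_zero_iff_dvd])
  have hev : ∀ (q : MvPolynomial (Fin 2) ℤ) (Q : Fin 2 → ℤ),
      eval (fun j => (Q j : ZMod p)) (map (Int.castRingHom (ZMod p)) q) = ((eval Q q : ℤ) : ZMod p) :=
    fun q Q => by
      rw [eval_map, ← eq_intCast (Int.castRingHom (ZMod p)), eval, coe_eval₂Hom, eval₂_comp_left]
      rfl
  refine exists_pow_dvd_det_eval hp F g P hP (Finset.univ.filter fun c =>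
    eval c (map (Int.castRingHom (ZMod p)) F) = 0 ∧
      eval c (pderiv 1 (map (Int.castRingHom (ZMod p)) F)) ≠ 0) (fun i hi => ?_) ?_ ?_
  · rw [Finset.mem_filter]
    refine ⟨Finset.mem_univ _, ?_, ?_⟩
    · rw [hev, hP, Int.cast_zero]
    · rwa [pderiv_map, hev, Ne, ZMod.intCast_zmod_eq_zero_iff_dvd]
  · have : (0 : ℝ) < p := by exact_mod_cast hp.pos
    positivity
  · exact stepanov_bound hirr hdeg hd hpd _ (fun c hc => (Finset.mem_filter.mp hc).2.1)
      fun c hc => (Finset.mem_filter.mp hc).2.2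

end Reduction

section Height

variable {R : Type*} [CommRing R]

/-- The Kronecker substitution `x ↦ T`, `y ↦ T ^ M`. -/
noncomputable def kronecker (R : Type*) [CommRing R] (M : ℕ) :
    MvPolynomial (Fin 2) R →+* Polynomial R :=
  eval₂Hom Polynomial.C ![Polynomial.X, Polynomial.X ^ M]

theorem kronecker_eq (M : ℕ) (F : MvPolynomial (Fin 2) R) : kronecker R M F =
    ∑ m ∈ F.support, Polynomial.monomial (m 0 + M * m 1) (coeff m F) := by
  rw [kronecker, coe_eval₂Hom, eval₂_eq']
  refine Finset.sum_congr rfl fun m _ => ?_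
  rw [Fin.prod_univ_two, ← Polynomial.C_mul_X_pow_eq_monomial]
  simp [pow_add, pow_mul]

theorem kronecker_map {S : Type*} [CommRing S] (φ : R →+* S) (M : ℕ) (F : MvPolynomial (Fin 2) R) :
    kronecker S M (map φ F) = (kronecker R M F).map φ := by
  have : (kronecker S M).comp (map φ) = (Polynomial.mapRingHom φ).comp (kronecker R M) := by
    refine MvPolynomial.ringHom_ext (fun r => by simp [kronecker]) fun i => ?_
    fin_cases i <;> simp [kronecker]
  exact DFunLike.congr_fun this F

theorem apply_le_totalDegree {F : MvPolynomial (Fin 2) R} {m : Fin 2 →₀ ℕ} (hm : m ∈ F.support) :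
    m 0 + m 1 ≤ F.totalDegree := by
  have := le_totalDegree hm
  rwa [Finsupp.sum_fintype _ _ (fun _ => rfl), Fin.sum_univ_two] at this

theorem natDegree_kronecker_le {M : ℕ} (hM : 1 ≤ M) (F : MvPolynomial (Fin 2) R) :
    (kronecker R M F).natDegree ≤ M * F.totalDegree := by
  rw [kronecker_eq]
  refine Polynomial.natDegree_sum_le_of_forall_le _ _ fun m hm =>
    (Polynomial.natDegree_monomial_le _).trans ?_
  have := apply_le_totalDegree hm
  nlinarith

theorem coeff_kronecker {M : ℕ} {F : MvPolynomial (Fin 2) R} (hM : F.totalDegree < M)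
    {m : Fin 2 →₀ ℕ} (hm : m 0 < M) : (kronecker R M F).coeff (m 0 + M * m 1) = coeff m F := by
  classical
  rw [kronecker_eq, Polynomial.finsetSum_coeff]
  simp only [Polynomial.coeff_monomial]
  have h : ∀ n ∈ F.support, (n 0 + M * n 1 = m 0 + M * m 1 ↔ n = m) := by
    intro n hn
    refine ⟨fun h => ?_, fun h => by rw [h]⟩
    have hn0 : n 0 < M := by have := apply_le_totalDegree hn; lia
    have e0 : n 0 = m 0 := by
      have := congrArg (· % M) h
      simpa [Nat.add_mul_mod_self_left, Nat.mod_eq_of_lt hn0, Nat.mod_eq_of_lt hm] using this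
    have e1 : n 1 = m 1 := by
      rw [e0] at h
      exact Nat.eq_of_mul_eq_mul_left (by lia) (Nat.add_left_cancel h)
    ext i; fin_cases i
    · exact e0
    · exact e1
  rw [Finset.sum_congr rfl fun n hn => if_congr (h n hn) rfl rfl, Finset.sum_ite_eq']
  split_ifs with h'
  · rfl
  · exact (notMem_support_iff.mp h').symm

theorem abs_coeff_kronecker_le {M : ℕ} {F : MvPolynomial (Fin 2) ℤ} {H : ℝ}
    (hH : ∀ m, |((coeff m F : ℤ) : ℝ)| ≤ H) (k : ℕ) :
    |((kronecker ℤ M F).coeff k : ℝ)| ≤ F.support.card * H := by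
  rw [kronecker_eq, Polynomial.finsetSum_coeff, Int.cast_sum]
  refine (Finset.abs_sum_le_sum_abs _ _).trans ?_
  rw [← nsmul_eq_mul]
  refine Finset.sum_le_card_nsmul _ _ _ fun m _ => ?_
  rw [Polynomial.coeff_monomial]
  split_ifs
  · exact hH m
  · simpa using (abs_nonneg _).trans (hH m)

theorem abs_coeff_le_of_dvd {M : ℕ} {F g : MvPolynomial (Fin 2) ℤ} (hg : g ≠ 0)
    (hFM : F.totalDegree < M) (hgM : g.totalDegree < M)
    (hprim : ∀ r : ℤ, (∀ m, r ∣ coeff m F) → IsUnit r)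
    (hdvd : map (Int.castRingHom ℚ) F ∣ map (Int.castRingHom ℚ) g) {H : ℝ}
    (hH : ∀ m, |((coeff m g : ℤ) : ℝ)| ≤ H) (m : Fin 2 →₀ ℕ) :
    |((coeff m F : ℤ) : ℝ)| ≤ 2 ^ (M * F.totalDegree) * ((M * g.totalDegree + 1) * (g.support.card * H)) := by
  have hM : 1 ≤ M := by lia
  have hH0 : 0 ≤ H := (abs_nonneg _).trans (hH 0)
  by_cases hm : m ∈ F.support
  swap
  · rw [notMem_support_iff.mp hm, Int.cast_zero, abs_zero]; positivity
  have hlt : ∀ n ∈ F.support, n 0 < M := fun n hn => by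
    have := apply_le_totalDegree hn; lia
  have hprim' : (kronecker ℤ M F).IsPrimitive := by
    intro r hr
    refine hprim r fun n => ?_
    by_cases hn : n ∈ F.support
    · rw [← coeff_kronecker hFM (hlt n hn)]
      exact (Polynomial.C_dvd_iff_dvd_coeff _ _).mp hr _
    · rw [notMem_support_iff.mp hn]; exact dvd_zero _
  have hdvd' : kronecker ℤ M F ∣ kronecker ℤ M g := by
    refine hprim'.dvd_of_fraction_map_dvd_fraction_map (K := ℚ) ?_
    have := map_dvd (kronecker ℚ M) hdvd
    rwa [kronecker_map, kronecker_map] at this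
  obtain ⟨q, hq⟩ := hdvd'
  have hg0 : kronecker ℤ M g ≠ 0 := by
    obtain ⟨n, hn⟩ := ne_zero_iff.mp hg
    intro h
    refine hn ?_
    have hn' := apply_le_totalDegree (mem_support_iff.mpr hn)
    rw [← coeff_kronecker hgM (by lia), h, Polynomial.coeff_zero]
  have hq0 : q ≠ 0 := by rintro rfl; exact hg0 (by rw [hq, mul_zero])
  set ι := Int.castRingHom ℂ with hι
  have h1 : 1 ≤ (q.map ι).mahlerMeasure := by
    refine Polynomial.one_le_mahlerMeasure_of_one_le_norm_leadingCoeff ?_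
    rw [Polynomial.leadingCoeff_map_of_injective (RingHom.injective_int ι), hι, eq_intCast,
      Complex.norm_intCast]
    exact_mod_cast Int.one_le_abs (Polynomial.leadingCoeff_ne_zero.mpr hq0)
  have h2 := Polynomial.norm_coeff_le_choose_mul_mahlerMeasure_of_one_le_mahlerMeasure
    (m 0 + M * m 1) ((kronecker ℤ M F).map ι) (q.map ι) h1
  rw [← Polynomial.map_mul, ← hq, Polynomial.coeff_map, coeff_kronecker hFM (hlt m hm), hι,
    eq_intCast, Complex.norm_intCast] at h2
  refine h2.trans (mul_le_mul ?_ ?_ (Polynomial.mahlerMeasure_nonneg _) (by positivity))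
  · refine le_trans (Nat.cast_le.mpr (Nat.choose_le_two_pow _ _)) ?_
    push_cast
    refine pow_le_pow_right₀ one_le_two (le_trans (Polynomial.natDegree_map_le) ?_)
    exact natDegree_kronecker_le hM F
  · refine (Polynomial.mahlerMeasure_le_sum_norm_coeff _).trans ?_
    rw [Polynomial.sum_over_range _ (fun _ => norm_zero)]
    refine (Finset.sum_le_card_nsmul _ _ (g.support.card * H) fun k _ => ?_).trans ?_
    · rw [Polynomial.coeff_map, eq_intCast, Complex.norm_intCast]
      exact abs_coeff_kronecker_le hH k
    · rw [nsmul_eq_mul, Finset.card_range]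
      have : ((Polynomial.map (Int.castRingHom ℂ) (kronecker ℤ M g)).natDegree + 1 : ℕ) ≤
          ((M * g.totalDegree + 1 : ℕ) : ℝ) := by
        exact_mod_cast Nat.succ_le_succ
          (Polynomial.natDegree_map_le.trans (natDegree_kronecker_le hM g))
      refine mul_le_mul_of_nonneg_right ?_ (by positivity)
      push_cast at this ⊢
      exact this

theorem abs_eval_monomial_le {B : ℝ} {P : Fin 2 → ℤ} (hB : 1 ≤ B)
    (hP : ∀ i, (|P i| : ℝ) ≤ B) {m : Fin 2 →₀ ℕ} {k : ℕ} (hm : m.degree ≤ k) :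
    |((eval P (monomial m 1) : ℤ) : ℝ)| ≤ B ^ k := by
  have hm' : m 0 + m 1 ≤ k := by
    rw [Finsupp.degree_eq_sum, Fin.sum_univ_two] at hm; exact hm
  rw [eval_monomial, Finsupp.prod_fintype _ _ (fun _ => pow_zero _), Fin.prod_univ_two, one_mul,
    Int.cast_mul, Int.cast_pow, Int.cast_pow, abs_mul, abs_pow, abs_pow]
  calc |(P 0 : ℝ)| ^ m 0 * |(P 1 : ℝ)| ^ m 1 ≤ B ^ m 0 * B ^ m 1 := by
        gcongr
        · exact hP 0
        · exact hP 1
    _ = B ^ (m 0 + m 1) := (pow_add _ _ _).symm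
    _ ≤ B ^ k := pow_le_pow_right₀ hB hm'

/-- Siegel's lemma: a polynomial with small coefficients through given points. -/
theorem exists_small_vanishing {B : ℝ} (hB : 1 ≤ B) (S : Finset (Fin 2 → ℤ))
    (hS : ∀ P ∈ S, ∀ i, (|P i| : ℝ) ≤ B) {k : ℕ} (hS0 : 0 < S.card)
    (hk : 3 * S.card ≤ 2 * (k + 2).choose 2) :
    ∃ g : MvPolynomial (Fin 2) ℤ, g ≠ 0 ∧ g.totalDegree ≤ k ∧ (∀ P ∈ S, eval P g = 0) ∧
      ∀ m, |((coeff m g : ℤ) : ℝ)| ≤ ((k + 2).choose 2 * B ^ k) ^ 2 := by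
  let _ := Matrix.seminormedAddCommGroup (m := S) (n := expLE 2 k) (α := ℤ)
  set A : Matrix S (expLE 2 k) ℤ := fun P m => eval P.1 (monomial m.1 1) with hA
  have hcard : Fintype.card (expLE 2 k) = (k + 2).choose 2 := by
    rw [Fintype.card_coe, card_expLE]
  obtain ⟨t, ht0, hAt, ht⟩ := Int.Matrix.exists_ne_zero_int_vec_norm_le A
    (by rw [hcard, Fintype.card_coe]; lia) (by rw [Fintype.card_coe]; exact hS0)
  have hnorm : max 1 ‖A‖ ≤ B ^ k := by
    refine max_le (one_le_pow₀ hB) ((Matrix.norm_le_iff (by positivity)).mpr fun P m => ?_)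
    rw [Int.norm_eq_abs]
    exact abs_eval_monomial_le hB (hS P.1 P.2) (mem_expLE.mp m.2)
  have hbase : (1 : ℝ) ≤ (k + 2).choose 2 * B ^ k := by
    have h1 : (1 : ℝ) ≤ (k + 2).choose 2 := by
      exact_mod_cast Nat.choose_pos (by lia)
    exact one_le_mul_of_one_le_of_one_le h1 (one_le_pow₀ hB)
  have ht' : ‖t‖ ≤ ((k + 2).choose 2 * B ^ k) ^ 2 := by
    refine ht.trans ?_
    rw [hcard, Fintype.card_coe]
    have h1 : (((k + 2).choose 2 : ℕ) * max 1 ‖A‖ : ℝ) ≤ (k + 2).choose 2 * B ^ k := by gcongr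
    have hS' : (3 * S.card : ℝ) ≤ 2 * (k + 2).choose 2 := by exact_mod_cast hk
    have hS0' : (0 : ℝ) < S.card := by exact_mod_cast hS0
    have hexp : (S.card : ℝ) / ((k + 2).choose 2 - S.card) ≤ 2 := by
      rw [div_le_iff₀ (by linarith)]; linarith
    have hexp0 : 0 ≤ (S.card : ℝ) / ((k + 2).choose 2 - S.card) :=
      div_nonneg hS0'.le (by linarith)
    refine (Real.rpow_le_rpow (by positivity) h1 hexp0).trans ?_
    refine (Real.rpow_le_rpow_of_exponent_le hbase hexp).trans ?_
    rw [← Real.rpow_natCast]; norm_num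
  refine ⟨ofCoeffs t, fun h => ht0 ?_, totalDegree_ofCoeffs_le _, fun P hP => ?_, fun m => ?_⟩
  · funext m
    have := congrArg (coeff m.1) h
    rwa [coeff_ofCoeffs, coeff_zero] at this
  · have := congrFun hAt ⟨P, hP⟩
    simp only [Matrix.mulVec, dotProduct, hA, Pi.zero_apply] at this
    rw [ofCoeffs, map_sum, ← this]
    refine Finset.sum_congr rfl fun m _ => ?_
    rw [eval_monomial, eval_monomial, one_mul, mul_comm]
  · by_cases hm : m ∈ expLE 2 k
    · have h := coeff_ofCoeffs t ⟨m, hm⟩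
      rw [show coeff m (ofCoeffs t) = t ⟨m, hm⟩ from h, ← Int.norm_eq_abs]
      exact (norm_le_pi_norm t _).trans ht'
    · have : coeff m (ofCoeffs t) = 0 := by
        by_contra h
        have h2 := le_totalDegree (mem_support_iff.mpr h)
        exact hm (mem_expLE.mpr (le_trans (le_of_eq (by rfl)) (h2.trans (totalDegree_ofCoeffs_le t))))
      rw [this, Int.cast_zero, abs_zero]
      positivity

theorem card_support_le {k : ℕ} {g : MvPolynomial (Fin 2) R} (hg : g.totalDegree ≤ k) :
    g.support.card ≤ (k + 2).choose 2 := by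
  rw [← card_expLE]
  exact Finset.card_le_card fun m hm =>
    mem_expLE.mpr (le_trans (le_of_eq (by rfl)) ((le_totalDegree hm).trans hg))

theorem eval_map_intCast {σ : Type*} (q : MvPolynomial σ ℤ) (Q : σ → ℤ) :
    eval (fun j => (Q j : ℚ)) (map (Int.castRingHom ℚ) q) = ((eval Q q : ℤ) : ℚ) := by
  rw [eval_map, ← eq_intCast (Int.castRingHom ℚ), eval, coe_eval₂Hom, eval₂_comp_left]
  rfl

theorem card_common_int_zeros_le {F : MvPolynomial (Fin 2) ℤ} {g : MvPolynomial (Fin 2) ℚ}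
    {k l : ℕ} (hF : Irreducible (map (Int.castRingHom ℚ) F)) (hFk : F.totalDegree ≤ k)
    (hgl : g.totalDegree ≤ l) (hFg : ¬ map (Int.castRingHom ℚ) F ∣ g) (S : Finset (Fin 2 → ℤ))
    (hSF : ∀ P ∈ S, eval P F = 0) (hSg : ∀ P ∈ S, eval (fun i => (P i : ℚ)) g = 0) :
    S.card ≤ k * l := by
  have hinj : Function.Injective fun (P : Fin 2 → ℤ) i => (P i : ℚ) := fun P Q h => by
    funext i; exact Int.cast_injective (α := ℚ) (congrFun h i)
  have h := card_common_zeros_le hF hFg (S.map ⟨_, hinj⟩)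
    (by
      intro P hP
      obtain ⟨Q, hQ, rfl⟩ := Finset.mem_map.mp hP
      simp only [Function.Embedding.coeFn_mk]
      rw [eval_map_intCast, hSF Q hQ, Int.cast_zero])
    (by
      intro P hP
      obtain ⟨Q, hQ, rfl⟩ := Finset.mem_map.mp hP
      exact hSg Q hQ)
  rw [Finset.card_map] at h
  exact h.trans (Nat.mul_le_mul ((Finset.sup_mono (support_map_subset _ _)).trans hFk) hgl)

/-- A primitive irreducible plane curve with many integral points in a box has small height. -/
theorem abs_coeff_le_of_card_le {F : MvPolynomial (Fin 2) ℤ} {d : ℕ} (hd : 1 ≤ d)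
    (hFd : F.totalDegree = d) (hF : Irreducible (map (Int.castRingHom ℚ) F))
    (hprim : ∀ r : ℤ, (∀ m, r ∣ coeff m F) → IsUnit r) {B : ℝ} (hB : 1 ≤ B)
    {S : Finset (Fin 2 → ℤ)} (hS : ∀ P ∈ S, ∀ i, (|P i| : ℝ) ≤ B) (hSF : ∀ P ∈ S, eval P F = 0)
    (hcard : 3 * d ^ 2 + 1 ≤ S.card) (m : Fin 2 →₀ ℕ) :
    |((coeff m F : ℤ) : ℝ)| ≤ Real.exp (22 * (d ^ 2 + d * Real.log B)) := by
  obtain ⟨S', hS'S, hS'⟩ := Finset.exists_subset_card_eq hcard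
  have hch : 2 * (3 * d + 2).choose 2 = (3 * d + 2) * (3 * d + 1) := by
    have h := Nat.triangle_succ (3 * d + 1)
    rw [Nat.choose_two_right, Nat.mul_div_cancel']
    · rfl
    · exact (Nat.even_mul_pred_self _).two_dvd
  obtain ⟨g, hg0, hgd, hgS, hgH⟩ := exists_small_vanishing hB S' (fun P hP => hS P (hS'S hP))
    (k := 3 * d) (by lia) (by rw [hch, hS']; nlinarith)
  have hdvd : map (Int.castRingHom ℚ) F ∣ map (Int.castRingHom ℚ) g := by
    by_contra h
    have h2 := card_common_int_zeros_le hF hFd.le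
      ((Finset.sup_mono (support_map_subset _ _)).trans hgd) h S'
      (fun P hP => hSF P (hS'S hP)) fun P hP => by rw [eval_map_intCast, hgS P hP, Int.cast_zero]
    rw [hS'] at h2
    nlinarith
  refine (abs_coeff_le_of_dvd (M := 3 * d + 1) hg0 (by lia) (by lia) hprim hdvd hgH m).trans ?_
  obtain ⟨h, hh⟩ : ∃ h, h = (3 * d + 2).choose 2 := ⟨_, rfl⟩
  have hsupp : (g.support.card : ℝ) ≤ h := by rw [hh]; exact_mod_cast card_support_le hgd
  have hd1 : (1 : ℝ) ≤ d := by exact_mod_cast hd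
  have hhd : (h : ℝ) ≤ 10 * d ^ 2 := by
    have : 2 * (h : ℝ) = (3 * d + 2) * (3 * d + 1) := by rw [hh]; exact_mod_cast hch
    nlinarith
  have hgd' : (g.totalDegree : ℝ) ≤ 3 * d := by exact_mod_cast hgd
  rw [← hh, hFd]
  have hB0 : 0 < B := by linarith
  have hBk : (B ^ (3 * d)) ^ 2 = Real.exp (6 * d * Real.log B) := by
    rw [← pow_mul, ← Real.rpow_natCast, Real.rpow_def_of_pos hB0]
    congr 1; push_cast; ring
  have h2 : (2 : ℝ) ^ ((3 * d + 1) * d) ≤ Real.exp (4 * d ^ 2) := by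
    have : (2 : ℝ) ≤ Real.exp 1 := by have := Real.add_one_le_exp (1 : ℝ); linarith
    refine (pow_le_pow_left₀ (by norm_num) this _).trans ?_
    rw [← Real.exp_nat_mul, mul_one, Real.exp_le_exp]
    push_cast; nlinarith
  have h3 : (((3 * d + 1 : ℕ) : ℝ) * g.totalDegree + 1) ≤ 13 * d ^ 2 := by
    push_cast; nlinarith
  have hde : (d : ℝ) ≤ Real.exp d := by have := Real.add_one_le_exp (d : ℝ); linarith
  have h13 : (13000 : ℝ) ≤ Real.exp 10 := by
    have := Real.exp_one_gt_d9
    have h : Real.exp 10 = Real.exp 1 ^ 10 := by rw [← Real.exp_nat_mul]; norm_num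
    rw [h]
    refine le_trans (by norm_num) (pow_le_pow_left₀ (by norm_num) this.le 10)
  calc (2 : ℝ) ^ ((3 * d + 1) * d) * ((((3 * d + 1 : ℕ) : ℝ) * g.totalDegree + 1) *
        (g.support.card * (h * B ^ (3 * d)) ^ 2))
      ≤ Real.exp (4 * d ^ 2) * ((13 * d ^ 2) * ((10 * d ^ 2) * ((10 * d ^ 2) * B ^ (3 * d)) ^ 2)) := by
        have := hsupp.trans hhd
        gcongr
    _ = Real.exp (4 * d ^ 2) * (13000 * d ^ 8 * Real.exp (6 * d * Real.log B)) := by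
        rw [mul_pow, hBk]; ring
    _ ≤ Real.exp (4 * d ^ 2) * (Real.exp 10 * Real.exp d ^ 8 * Real.exp (6 * d * Real.log B)) := by
        gcongr
    _ = Real.exp (4 * d ^ 2 + (10 + 8 * d + 6 * d * Real.log B)) := by
        rw [Real.exp_add, Real.exp_add, Real.exp_add, ← Real.exp_nat_mul]; norm_num
    _ ≤ Real.exp (22 * (d ^ 2 + d * Real.log B)) := by
        rw [Real.exp_le_exp]
        have := mul_nonneg (by linarith : (0 : ℝ) ≤ d) (Real.log_nonneg hB)
        nlinarith

end Height

section Bounds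

theorem abs_coeff_pderiv_le {F : MvPolynomial (Fin 2) ℤ} {d : ℕ} (hF : F.totalDegree ≤ d) {H : ℝ}
    (hH : ∀ m, |((coeff m F : ℤ) : ℝ)| ≤ H) (i : Fin 2) (m : Fin 2 →₀ ℕ) :
    |((coeff m (pderiv i F) : ℤ) : ℝ)| ≤ d * H := by
  have hH0 : 0 ≤ H := (abs_nonneg _).trans (hH 0)
  rw [coeff_pderiv]
  by_cases h : m + Finsupp.single i 1 ∈ F.support
  · have h1 := apply_le_totalDegree h
    have h2 : m i + 1 ≤ d := by
      have : (m + Finsupp.single i 1 : Fin 2 →₀ ℕ) i = m i + 1 := by simp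
      fin_cases i <;> simp only [Fin.zero_eta, Fin.mk_one] at this ⊢ <;> lia
    rw [Int.cast_mul, abs_mul, mul_comm]
    refine mul_le_mul ?_ (hH _) (abs_nonneg _) (by positivity)
    have : ((m i + 1 : ℕ) : ℝ) ≤ d := by exact_mod_cast h2
    push_cast at this ⊢
    rwa [abs_of_nonneg (by positivity)]
  · rw [notMem_support_iff.mp h, zero_mul, Int.cast_zero, abs_zero]
    positivity

theorem abs_coeff_mul_monomial_le {F : MvPolynomial (Fin 2) ℤ} {H c : ℝ} (hc : 0 ≤ c)
    (hH : ∀ m, |((coeff m F : ℤ) : ℝ)| ≤ H) (n : Fin 2 →₀ ℕ) {a : ℤ} (ha : (|a| : ℝ) ≤ c)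
    (m : Fin 2 →₀ ℕ) : |((coeff m (monomial n a * F) : ℤ) : ℝ)| ≤ c * H := by
  have hH0 : 0 ≤ H := (abs_nonneg _).trans (hH 0)
  rw [coeff_monomial_mul']
  split_ifs
  · rw [Int.cast_mul, abs_mul]
    exact mul_le_mul ha (hH _) (abs_nonneg _) hc
  · rw [Int.cast_zero, abs_zero]; positivity

theorem abs_ruppert_le {F : MvPolynomial (Fin 2) ℤ} {d : ℕ} (hF : F.totalDegree ≤ d) {H : ℝ}
    (hH : ∀ m, |((coeff m F : ℤ) : ℝ)| ≤ H) (i : expLE 2 (2 * d)) (j : Bool × expLE 2 (d - 1)) :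
    |((ruppert F d i j : ℤ) : ℝ)| ≤ 2 * d * H := by
  have hm : ∀ k, ((j.2 : Fin 2 →₀ ℕ) k : ℝ) ≤ d := fun k => by
    have := mem_expLE.mp j.2.2
    have h2 : (j.2 : Fin 2 →₀ ℕ) k ≤ (j.2 : Fin 2 →₀ ℕ).degree := Finsupp.le_degree k _
    exact_mod_cast (by lia : (j.2 : Fin 2 →₀ ℕ) k ≤ d)
  have key : ∀ k : Fin 2,
      |((coeff i.1 (pderiv k (monomial j.2.1 (1 : ℤ)) * F - monomial j.2.1 1 * pderiv k F) : ℤ) : ℝ)| ≤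
        2 * d * H := fun k => by
    rw [coeff_sub, Int.cast_sub]
    refine (abs_sub _ _).trans ?_
    have h1 := abs_coeff_mul_monomial_le (c := d) (by positivity) hH
      (j.2.1 - Finsupp.single k 1) (a := j.2.1 k) (by simpa using hm k) i.1
    have h2 := abs_coeff_mul_monomial_le (c := 1) zero_le_one (abs_coeff_pderiv_le hF hH k)
      j.2.1 (a := 1) (by simp) i.1
    rw [pderiv_monomial, one_mul]
    linarith
  obtain ⟨b, j⟩ := j
  cases b
  · rw [ruppert, cond_false, ← abs_neg]
    convert key 0 using 2
    rw [← Int.cast_neg, ← coeff_neg]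
    congr 2
    simp only [closedNum, map_zero, zero_mul, zero_sub, sub_zero]
    ring
  · rw [ruppert, cond_true]
    convert key 1 using 3
    simp [closedNum]

theorem abs_ruppertMinor_le {F : MvPolynomial (Fin 2) ℤ} {d : ℕ} (hd : 1 ≤ d)
    (hF : F.totalDegree ≤ d) {H : ℝ} (hH1 : 1 ≤ H) (hH : ∀ m, |((coeff m F : ℤ) : ℝ)| ≤ H)
    (j₀ : Bool × expLE 2 (d - 1)) (e : {j // j ≠ j₀} → expLE 2 (2 * d)) :
    |((ruppertMinor F d j₀ e : ℤ) : ℝ)| ≤ (4 * d ^ 3 * H) ^ (d * (d + 1)) := by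
  classical
  have h := Matrix.det_le (A := ((ruppert F d).submatrix e Subtype.val).map (Int.castRingHom ℝ))
    (abv := AbsoluteValue.abs) (x := 2 * d * H) fun i j => abs_ruppert_le hF hH (e i) j.1
  have hr := card_ruppert_columns_le hd j₀
  obtain ⟨r, hr'⟩ : ∃ r, r = Fintype.card {j // j ≠ j₀} := ⟨_, rfl⟩
  rw [← hr'] at h hr
  have hd1 : (1 : ℝ) ≤ d := by exact_mod_cast hd
  have hr2 : (r : ℝ) ≤ 2 * d ^ 2 := by
    have : (r : ℝ) ≤ d * (d + 1) := by exact_mod_cast hr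
    nlinarith
  have hbase : 1 ≤ 4 * (d : ℝ) ^ 3 * H := by
    have : (1 : ℝ) ≤ d ^ 3 := one_le_pow₀ hd1
    nlinarith
  have hdet : (AbsoluteValue.abs : AbsoluteValue ℝ ℝ) (((ruppert F d).submatrix e Subtype.val).map
      (Int.castRingHom ℝ)).det = |((ruppertMinor F d j₀ e : ℤ) : ℝ)| := by
    rw [ruppertMinor, ← eq_intCast (Int.castRingHom ℝ) (Matrix.det _), RingHom.map_det]; rfl
  rw [hdet, nsmul_eq_mul] at h
  calc |((ruppertMinor F d j₀ e : ℤ) : ℝ)| ≤ (r.factorial : ℝ) * (2 * d * H) ^ r := h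
    _ ≤ (r : ℝ) ^ r * (2 * d * H) ^ r := by
      gcongr
      exact_mod_cast Nat.factorial_le_pow r
    _ = (r * (2 * d * H)) ^ r := (mul_pow _ _ _).symm
    _ ≤ (4 * d ^ 3 * H) ^ r := by
      refine pow_le_pow_left₀ (by positivity) ?_ _
      calc (r : ℝ) * (2 * d * H) ≤ (2 * d ^ 2) * (2 * d * H) := by gcongr
        _ = 4 * d ^ 3 * H := by ring
    _ ≤ _ := pow_le_pow_right₀ hbase hr

theorem abs_eval_le {g : MvPolynomial (Fin 2) ℤ} {k : ℕ} (hg : g.totalDegree ≤ k) {B H : ℝ}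
    (hB : 1 ≤ B) (hH : ∀ m, |((coeff m g : ℤ) : ℝ)| ≤ H) {P : Fin 2 → ℤ}
    (hP : ∀ i, (|P i| : ℝ) ≤ B) :
    |((eval P g : ℤ) : ℝ)| ≤ (k + 2).choose 2 * (H * B ^ k) := by
  have hH0 : 0 ≤ H := (abs_nonneg _).trans (hH 0)
  conv_lhs => rw [as_sum g, map_sum, Int.cast_sum]
  refine (Finset.abs_sum_le_sum_abs _ _).trans ?_
  refine (Finset.sum_le_card_nsmul _ _ (H * B ^ k) fun m hm => ?_).trans ?_
  · have h1 : m.degree ≤ k := le_trans (le_of_eq (by rfl)) ((le_totalDegree hm).trans hg)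
    have h2 := abs_eval_monomial_le hB hP h1
    have h3 : eval P (monomial m (coeff m g)) = coeff m g * eval P (monomial m 1) := by
      rw [eval_monomial, eval_monomial, one_mul]
    rw [h3, Int.cast_mul, abs_mul]
    exact mul_le_mul (hH m) h2 (abs_nonneg _) hH0
  · rw [nsmul_eq_mul]
    have : (g.support.card : ℝ) ≤ ((k + 2).choose 2 : ℕ) := by exact_mod_cast card_support_le hg
    gcongr

theorem sum_degree_stdExp_le {K : Type*} [Field K] (f : MvPolynomial (Fin 2) K) (k : ℕ) :
    2 * ∑ m ∈ stdExp f k, m.degree ≤ f.totalDegree * (k * (k + 1)) := by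
  classical
  set β := MonomialOrder.degLex.degree f with hβ
  have hβd : β 0 + β 1 = f.totalDegree := by
    have : β.degree = f.totalDegree := degree_degLexDegree
    rwa [Finsupp.degree_eq_sum, Fin.sum_univ_two] at this
  have hdeg : ∀ m : Fin 2 →₀ ℕ, m.degree = m 0 + m 1 := fun m => by
    rw [Finsupp.degree_eq_sum, Fin.sum_univ_two]
  have hfib : ∀ j ∈ Finset.range (k + 1),
      ((stdExp f k).filter fun m => m.degree = j).card ≤ f.totalDegree := by
    intro j _
    rw [← Finset.card_range f.totalDegree]
    refine Finset.card_le_card_of_injOn (fun m => if m 0 < β 0 then m 0 else β 0 + m 1) ?_ ?_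
    · intro m hm
      have hm' := (mem_stdExp.mp (Finset.mem_filter.mp hm).1).2
      have : m 0 < β 0 ∨ m 1 < β 1 := by
        by_contra! h
        refine hm' fun i => ?_
        fin_cases i
        · exact h.1
        · exact h.2
      simp only [Finset.coe_range, Set.mem_Iio]
      split_ifs <;> lia
    · intro m hm n hn h
      have hm' := (Finset.mem_filter.mp hm).2
      have hn' := (Finset.mem_filter.mp hn).2
      rw [hdeg] at hm' hn'
      have : m 0 = n 0 ∧ m 1 = n 1 := by
        simp only at h
        split_ifs at h <;> lia
      ext i
      fin_cases i
      · exact this.1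
      · exact this.2
  have h1 : ∑ m ∈ stdExp f k, m.degree ≤ ∑ j ∈ Finset.range (k + 1), f.totalDegree * j := by
    rw [← Finset.sum_fiberwise_of_maps_to (s := stdExp f k) (t := Finset.range (k + 1))
      (g := fun m => m.degree) (fun m hm => by
        rw [Finset.mem_range]; have := (mem_stdExp.mp hm).1; lia)]
    refine Finset.sum_le_sum fun j hj => ?_
    rw [Finset.sum_congr rfl fun m hm => (Finset.mem_filter.mp hm).2, Finset.sum_const, smul_eq_mul]
    exact Nat.mul_le_mul_right _ (hfib j hj)
  rw [← Finset.mul_sum] at h1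
  have h2 := Finset.sum_range_id_mul_two (k + 1)
  rw [Nat.add_sub_cancel] at h2
  nlinarith

theorem abs_det_le_of_columns {n : Type*} [Fintype n] [DecidableEq n] (A : Matrix n n ℤ) {B : ℝ}
    {w : n → ℕ} (hA : ∀ i j, |((A i j : ℤ) : ℝ)| ≤ B ^ w j) :
    |((A.det : ℤ) : ℝ)| ≤ (Fintype.card n).factorial * B ^ ∑ j, w j := by
  rw [Matrix.det_apply', Int.cast_sum]
  refine (Finset.abs_sum_le_sum_abs _ _).trans ?_
  refine (Finset.sum_le_card_nsmul _ _ (B ^ ∑ j, w j) fun σ _ => ?_).trans ?_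
  · rw [Int.cast_mul, Int.cast_prod, abs_mul, Finset.abs_prod]
    have h1 : |(((Equiv.Perm.sign σ : ℤˣ) : ℤ) : ℝ)| = 1 := by
      rcases Int.units_eq_one_or (Equiv.Perm.sign σ) with h | h <;> simp [h]
    rw [Int.cast_id, h1, one_mul, ← Finset.prod_pow_eq_pow_sum]
    exact Finset.prod_le_prod (fun _ _ => abs_nonneg _) fun j _ => hA _ _
  · rw [Finset.card_univ, Fintype.card_perm, nsmul_eq_mul]

theorem sum_mul_log_le_of_pow_dvd {N : ℤ} (hN : N ≠ 0) {T : Finset ℕ} (hT : ∀ p ∈ T, p.Prime)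
    {e : ℕ → ℕ} (he : ∀ p ∈ T, (p : ℤ) ^ e p ∣ N) :
    ∑ p ∈ T, (e p : ℝ) * Real.log p ≤ Real.log |(N : ℝ)| := by
  have h1 : (∏ p ∈ T, (p : ℤ) ^ e p) ∣ N := by
    refine Finset.prod_dvd_of_coprime (fun p hp q hq hpq => ?_) he
    exact IsCoprime.pow (Nat.isCoprime_iff_coprime.mpr ((Nat.coprime_primes (hT p hp) (hT q hq)).mpr hpq))
  have h2 : ((∏ p ∈ T, (p : ℤ) ^ e p : ℤ) : ℝ) ≤ |(N : ℝ)| := by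
    have := Int.le_of_dvd (abs_pos.mpr hN) ((dvd_abs _ _).mpr h1)
    exact_mod_cast this
  have hpos : ∀ p ∈ T, (0 : ℝ) < p := fun p hp => by exact_mod_cast (hT p hp).pos
  have h3 : (0 : ℝ) < ∏ p ∈ T, (p : ℝ) ^ e p := Finset.prod_pos fun p hp => pow_pos (hpos p hp) _
  push_cast at h2
  refine le_trans (le_of_eq ?_) (Real.log_le_log h3 h2)
  rw [Real.log_prod fun p hp => (pow_pos (hpos p hp) _).ne']
  exact Finset.sum_congr rfl fun p _ => (Real.log_pow _ _).symm

theorem sum_log_le_of_dvd {N : ℤ} (hN : N ≠ 0) {T : Finset ℕ} (hT : ∀ p ∈ T, p.Prime)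
    (hd : ∀ p ∈ T, (p : ℤ) ∣ N) : ∑ p ∈ T, Real.log p ≤ Real.log |(N : ℝ)| := by
  simpa using sum_mul_log_le_of_pow_dvd hN hT (e := fun _ => 1) (by simpa using hd)

theorem ruppertMinor_C_mul {R : Type*} [CommRing R] (c : R) (F : MvPolynomial (Fin 2) R) (d : ℕ)
    (j₀ : Bool × expLE 2 (d - 1)) (e : {j // j ≠ j₀} → expLE 2 (2 * d)) :
    ruppertMinor (C c * F) d j₀ e =
      c ^ Fintype.card {j // j ≠ j₀} * ruppertMinor F d j₀ e := by
  have h : ∀ G H, closedNum (C c * F) G H = C c * closedNum F G H := by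
    intro G H
    simp only [closedNum, pderiv_C_mul]
    ring
  rw [ruppertMinor, ruppertMinor, ← Matrix.det_smul]
  congr 1
  ext i ⟨⟨b, m⟩, hj⟩
  cases b <;> simp [ruppert, h, coeff_C_mul]

theorem pderiv_ne_zero_of_ruppertMinor_ne_zero {R : Type*} [CommRing R]
    {F : MvPolynomial (Fin 2) R} {d : ℕ} (hd : 2 ≤ d) {j₀ : Bool × expLE 2 (d - 1)}
    {e : {j // j ≠ j₀} → expLE 2 (2 * d)} (h : ruppertMinor F d j₀ e ≠ 0) : pderiv 1 F ≠ 0 := by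
  intro h0
  have hcol : ∀ m : expLE 2 (d - 1), (m : Fin 2 →₀ ℕ) 1 = 0 → (true, m) = j₀ := by
    intro m hm
    by_contra hne
    refine h (Matrix.det_eq_zero_of_column_eq_zero ⟨(true, m), hne⟩ fun i => ?_)
    simp [ruppert, closedNum, h0, pderiv_monomial, hm]
  have h1 := hcol ⟨0, mem_expLE.mpr (by simp)⟩ (by simp)
  have h2 := hcol ⟨Finsupp.single 0 1, mem_expLE.mpr (by simp; lia)⟩ (by simp)
  have := congrArg (fun j : Bool × expLE 2 (d - 1) => (j.2 : Fin 2 →₀ ℕ) 0) (h1.trans h2.symm)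
  simp at this

theorem exists_primitive {σ : Type*} {F : MvPolynomial σ ℤ} (hF : F ≠ 0) :
    ∃ (c : ℤ) (G : MvPolynomial σ ℤ), c ≠ 0 ∧ F = C c * G ∧
      ∀ r : ℤ, (∀ m, r ∣ coeff m G) → IsUnit r := by
  obtain ⟨c, hc⟩ : ∃ c, c = F.support.gcd fun m => coeff m F := ⟨_, rfl⟩
  have hdvd : C c ∣ F := by
    rw [C_dvd_iff_dvd_coeff]
    intro m
    by_cases hm : m ∈ F.support
    · rw [hc]; exact Finset.gcd_dvd hm
    · rw [notMem_support_iff.mp hm]; exact dvd_zero _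
  obtain ⟨G, hG⟩ := hdvd
  have hc0 : c ≠ 0 := by rintro rfl; simp [hF] at hG
  refine ⟨c, G, hc0, hG, fun r hr => ?_⟩
  have h1 : c * r ∣ c := by
    conv_rhs => rw [hc]
    refine Finset.dvd_gcd fun m _ => ?_
    rw [hG, coeff_C_mul]
    exact mul_dvd_mul_left _ (hr m)
  exact isUnit_of_dvd_one ((mul_dvd_mul_iff_left hc0).mp (by simpa using h1))

end Bounds

section DeterminantMethod

theorem exists_determinant_lower_bound : ∃ K : ℝ, 0 ≤ K ∧ ∀ {d X Q : ℕ}, 1 ≤ d →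
    10000 * d ^ 4 ≤ X → X ≤ Q → ∀ {F : MvPolynomial (Fin 2) ℤ}, F.totalDegree ≤ d →
    ∀ {j₀ : Bool × expLE 2 (d - 1)} {e : {j // j ≠ j₀} → expLE 2 (2 * d)},
    ruppertMinor F d j₀ e ≠ 0 → Real.log |((ruppertMinor F d j₀ e : ℤ) : ℝ)| ≤ X →
    ∀ {n : Type} [Fintype n] [DecidableEq n] (g : n → MvPolynomial (Fin 2) ℤ)
      (P : n → Fin 2 → ℤ), (∀ i, eval (P i) F = 0) → (∀ i, eval (P i) (pderiv 1 F) ≠ 0) →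
    (∀ i, 2 * Real.log |((eval (P i) (pderiv 1 F) : ℤ) : ℝ)| ≤ X) →
    (Matrix.of fun i j => eval (P i) (g j)).det ≠ 0 →
    (Fintype.card n : ℝ) ^ 2 * (Real.log Q - Real.log X - K - 3) -
      Fintype.card n * (Real.log 4 * Q) ≤
      2 * Real.log |(((Matrix.of fun i j => eval (P i) (g j)).det : ℤ) : ℝ)| := by
  classical
  obtain ⟨K, hK0, hK⟩ := exists_log_sub_le_sum_log_div
  refine ⟨K, hK0, ?_⟩
  intro d X Q hd hX hXQ F hF j₀ e hΔ hΔX n _ _ g P hPF hPy hPX hdet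
  obtain ⟨N, hN⟩ : ∃ N, N = (Matrix.of fun i j => eval (P i) (g j)).det := ⟨_, rfl⟩
  obtain ⟨Δ, hΔ'⟩ : ∃ Δ, Δ = ruppertMinor F d j₀ e := ⟨_, rfl⟩
  obtain ⟨s, hs⟩ : ∃ s : ℝ, s = Fintype.card n := ⟨_, rfl⟩
  obtain ⟨y, hy⟩ : ∃ y : n → ℤ, y = fun i => eval (P i) (pderiv 1 F) := ⟨_, rfl⟩
  have hs0 : 0 ≤ s := hs ▸ Nat.cast_nonneg _
  have hd1 : (1 : ℝ) ≤ d := by exact_mod_cast hd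
  have hX1 : 1 ≤ X := by
    have := Nat.one_le_pow 4 d hd
    lia
  have hX0 : (0 : ℝ) < X := by exact_mod_cast hX1
  obtain ⟨T, hT⟩ : ∃ T, T = (Finset.Ioc X Q).filter Nat.Prime := ⟨_, rfl⟩
  obtain ⟨T₁, hT₁⟩ : ∃ T₁, T₁ = T.filter fun p : ℕ => ¬ (p : ℤ) ∣ Δ := ⟨_, rfl⟩
  have hTp : ∀ p ∈ T, p.Prime ∧ X < p := fun p hp => by
    rw [hT, Finset.mem_filter, Finset.mem_Ioc] at hp
    exact ⟨hp.2, hp.1.1⟩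
  have hT₁T : T₁ ⊆ T := hT₁ ▸ Finset.filter_subset _ _
  obtain ⟨c, hc⟩ : ∃ c : ℕ → ℝ, ∀ p, c p = (Finset.univ.filter fun i => (p : ℤ) ∣ y i).card :=
    ⟨_, fun _ => rfl⟩
  have hlogp : ∀ p ∈ T, 0 ≤ Real.log p := fun p hp => Real.log_natCast_nonneg _
  have hexp : ∀ p, ∃ k : ℕ, p ∈ T₁ → (p : ℤ) ^ k ∣ N ∧
      (s ^ 2 - 2 * s * c p) / (p + 9 * d ^ 2 * √p) - s ≤ 2 * k := by
    intro p
    by_cases hp : p ∈ T₁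
    · have hp' := hTp p (hT₁T hp)
      have hpΔ : ¬ (p : ℤ) ∣ ruppertMinor F d j₀ e := by
        rw [hT₁] at hp; exact hΔ' ▸ (Finset.mem_filter.mp hp).2
      obtain ⟨k, hk, hk'⟩ := exists_pow_dvd_det_of_ruppertMinor hp'.1 hd (by lia) hF hpΔ g P hPF
      refine ⟨k, fun _ => ⟨hN ▸ hk, ?_⟩⟩
      rw [hs, hc, hy]
      exact hk'
    · exact ⟨0, fun h => absurd h hp⟩
  choose k hk using hexp
  have hterm : ∀ p ∈ T₁, s ^ 2 * (Real.log p / p) - 9 * d ^ 2 * s ^ 2 * (Real.log p / (p * √p)) -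
      2 * s / X * (c p * Real.log p) - s * Real.log p ≤ 2 * (k p * Real.log p) := by
    intro p hp
    obtain ⟨hpp, hXp⟩ := hTp p (hT₁T hp)
    have hl := hlogp p (hT₁T hp)
    have hp0 : (0 : ℝ) < p := by exact_mod_cast hpp.pos
    have hXp' : (X : ℝ) ≤ p := by exact_mod_cast hXp.le
    have hsq : 0 < √(p : ℝ) := Real.sqrt_pos.mpr hp0
    obtain ⟨r, hr⟩ : ∃ r, r = √(p : ℝ) := ⟨_, rfl⟩
    have hrp : r * r = p := hr ▸ Real.mul_self_sqrt hp0.le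
    rw [← hr] at hsq ⊢
    have hc0 : 0 ≤ c p := hc p ▸ Nat.cast_nonneg _
    have h := (hk p hp).2
    rw [← hr] at h
    have hU : 0 < (p : ℝ) + 9 * d ^ 2 * r := by positivity
    have h1 : 1 / (p : ℝ) - 9 * d ^ 2 / (p * r) ≤ 1 / (p + 9 * d ^ 2 * r) := by
      rw [← hrp] at hU ⊢
      rw [le_div_iff₀ hU]
      have : (1 / (r * r) - 9 * (d : ℝ) ^ 2 / (r * r * r)) * (r * r + 9 * d ^ 2 * r) =
          1 - (9 * (d : ℝ) ^ 2 / r) ^ 2 := by field_simp; ring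
      rw [this]
      nlinarith [sq_nonneg (9 * (d : ℝ) ^ 2 / r)]
    have h2 : 1 / (p + 9 * d ^ 2 * r) ≤ 1 / (X : ℝ) := by
      apply one_div_le_one_div_of_le hX0
      have : 0 ≤ 9 * (d : ℝ) ^ 2 * r := by positivity
      linarith
    have h3 : s ^ 2 * (1 / (p : ℝ) - 9 * d ^ 2 / (p * r)) - 2 * s * c p * (1 / X) ≤
        (s ^ 2 - 2 * s * c p) / (p + 9 * d ^ 2 * r) := by
      have e1 := mul_le_mul_of_nonneg_left h1 (sq_nonneg s)
      have e2 := mul_le_mul_of_nonneg_left h2 (by positivity : 0 ≤ 2 * s * c p)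
      have e3 : (s ^ 2 - 2 * s * c p) / (p + 9 * d ^ 2 * r) =
        s ^ 2 * (1 / (p + 9 * d ^ 2 * r)) - 2 * s * c p * (1 / (p + 9 * d ^ 2 * r)) := by ring
      rw [e3]; linarith
    have h4 := mul_le_mul_of_nonneg_right (h3.trans (by linarith : _ ≤ 2 * (k p : ℝ) + s)) hl
    refine le_trans (le_of_eq ?_) ((sub_le_sub_right h4 (s * Real.log p)).trans (le_of_eq ?_))
    · field_simp
    · ring
  have hsum := Finset.sum_le_sum hterm
  simp only [Finset.sum_sub_distrib, ← Finset.mul_sum] at hsum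
  have hub : ∑ p ∈ T₁, (k p : ℝ) * Real.log p ≤ Real.log |(N : ℝ)| :=
    sum_mul_log_le_of_pow_dvd (hN ▸ hdet) (fun p hp => (hTp p (hT₁T hp)).1) fun p hp => (hk p hp).1
  have hmain : Real.log Q - Real.log X - K - 1 ≤ ∑ p ∈ T₁, Real.log p / p := by
    have h1 := hK X Q hX1 hXQ
    rw [← hT, ← Finset.sum_filter_not_add_sum_filter T (fun p : ℕ => (p : ℤ) ∣ Δ), ← hT₁] at h1
    have h2 : ∑ p ∈ T.filter (fun p : ℕ => (p : ℤ) ∣ Δ), Real.log p / p ≤ 1 := by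
      have h3 : ∑ p ∈ T.filter (fun p : ℕ => (p : ℤ) ∣ Δ), Real.log p / p ≤
          ∑ p ∈ T.filter (fun p : ℕ => (p : ℤ) ∣ Δ), Real.log p / X := by
        refine Finset.sum_le_sum fun p hp => ?_
        have hp' := (Finset.mem_filter.mp hp).1
        exact div_le_div_of_nonneg_left (hlogp p hp') hX0 (by exact_mod_cast (hTp p hp').2.le)
      have h4 := sum_log_le_of_dvd (N := Δ) (hΔ' ▸ hΔ)
        (T := T.filter (fun p : ℕ => (p : ℤ) ∣ Δ))
        (fun p hp => (hTp p (Finset.mem_filter.mp hp).1).1) fun p hp => (Finset.mem_filter.mp hp).2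
      rw [← Finset.sum_div] at h3
      refine h3.trans ((div_le_one hX0).mpr (h4.trans ?_))
      rw [hΔ']; exact hΔX
    linarith
  have hsqrt : 9 * d ^ 2 * s ^ 2 * ∑ p ∈ T₁, Real.log p / (p * √p) ≤ s ^ 2 := by
    have h1 : ∑ p ∈ T₁, Real.log p / (p * √p) ≤ 10 / √X := by
      refine le_trans ?_ (sum_log_div_mul_sqrt_le hX1 Q)
      rw [← hT]
      exact Finset.sum_le_sum_of_subset_of_nonneg hT₁T fun p hp _ =>
        div_nonneg (hlogp p hp) (by positivity)
    have h2 : 100 * (d : ℝ) ^ 2 ≤ √X := by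
      refine Real.le_sqrt_of_sq_le ?_
      have : ((10000 * d ^ 4 : ℕ) : ℝ) ≤ X := by exact_mod_cast hX
      push_cast at this
      calc _ = 10000 * (d : ℝ) ^ 4 := by ring
        _ ≤ X := this
    have h3 : (0 : ℝ) < √X := Real.sqrt_pos.mpr hX0
    calc 9 * d ^ 2 * s ^ 2 * ∑ p ∈ T₁, Real.log p / (p * √p) ≤ 9 * d ^ 2 * s ^ 2 * (10 / √X) := by
          gcongr
      _ = s ^ 2 * ((90 * d ^ 2) / √X) := by ring
      _ ≤ s ^ 2 * 1 := by
          refine mul_le_mul_of_nonneg_left ((div_le_one h3).mpr ?_) (sq_nonneg s)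
          nlinarith [sq_nonneg (d : ℝ)]
      _ = s ^ 2 := mul_one _
  have hcsum : 2 * s / X * ∑ p ∈ T₁, c p * Real.log p ≤ s ^ 2 := by
    have h1 : ∑ p ∈ T₁, c p * Real.log p =
        ∑ i, ∑ p ∈ T₁.filter (fun p : ℕ => (p : ℤ) ∣ y i), Real.log p := by
      simp only [Finset.sum_filter]
      rw [Finset.sum_comm]
      refine Finset.sum_congr rfl fun p _ => ?_
      rw [hc, ← Finset.sum_filter, Finset.sum_const, nsmul_eq_mul]
    have h2 : ∑ p ∈ T₁, c p * Real.log p ≤ s * (X / 2) := by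
      rw [h1, hs, ← nsmul_eq_mul, ← Finset.card_univ]
      refine Finset.sum_le_card_nsmul _ _ _ fun i _ => ?_
      have h3 := sum_log_le_of_dvd (N := y i) (by rw [hy]; exact hPy i)
        (T := T₁.filter (fun p : ℕ => (p : ℤ) ∣ y i))
        (fun p hp => (hTp p (hT₁T (Finset.mem_filter.mp hp).1)).1)
        fun p hp => (Finset.mem_filter.mp hp).2
      have h4 := hPX i
      have h5 : y i = eval (P i) (pderiv 1 F) := by rw [hy]
      rw [← h5] at h4
      linarith
    calc _ ≤ 2 * s / X * (s * (X / 2)) := by gcongr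
      _ = s ^ 2 := by field_simp
  have hlin : s * ∑ p ∈ T₁, Real.log p ≤ s * (Real.log 4 * Q) := by
    refine mul_le_mul_of_nonneg_left (le_trans ?_ (sum_log_prime_le Q)) hs0
    refine Finset.sum_le_sum_of_subset_of_nonneg (fun p hp => ?_) fun p _ _ =>
      Real.log_natCast_nonneg _
    have hp' := hT₁T hp
    rw [hT, Finset.mem_filter, Finset.mem_Ioc] at hp'
    rw [Finset.mem_filter, Finset.mem_Ioc]
    exact ⟨⟨by lia, hp'.1.2⟩, hp'.2⟩
  rw [← hs, ← hN]
  have := mul_le_mul_of_nonneg_left hmain (sq_nonneg s)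
  nlinarith

end DeterminantMethod

section PlaneCurves

theorem determinant_numeric {s d D Q L lX lQ K ldet : ℝ} (hd : 1 ≤ d) (hdD : d ≤ D)
    (hs : 2 * s = d * (2 * D - d + 3)) (hQs : Q ≤ s) (hL0 : 0 ≤ L) (hLD : L ≤ D)
    (hlQ : K + 16 + lX + L / d ≤ lQ)
    (hdet : 2 * ldet ≤ 2 * (s * Real.log s) + d * (D * (D + 1)) * L)
    (hlow : s ^ 2 * (lQ - lX - K - 3) - s * (Real.log 4 * Q) ≤ 2 * ldet) : False := by
  have hs0 : 0 < s := by nlinarith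
  have hD0 : 0 ≤ D := by linarith
  have hlog4 : Real.log 4 ≤ 2 := by
    rw [show (4 : ℝ) = 2 ^ 2 by norm_num, Real.log_pow]
    have := Real.log_two_lt_d9
    push_cast; linarith
  have h1 : s ^ 2 * (13 + L / d) ≤ s ^ 2 * (lQ - lX - K - 3) :=
    mul_le_mul_of_nonneg_left (by linarith) (sq_nonneg s)
  have h2 : s * (Real.log 4 * Q) ≤ 2 * s ^ 2 := by
    have h4 : 0 ≤ Real.log 4 := Real.log_nonneg (by norm_num)
    have h5 : Real.log 4 * Q ≤ 2 * s :=
      (mul_le_mul_of_nonneg_left hQs h4).trans (mul_le_mul_of_nonneg_right hlog4 hs0.le)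
    nlinarith
  have h3 : s * Real.log s ≤ s * s := by
    refine mul_le_mul_of_nonneg_left ?_ hs0.le
    have := Real.log_le_sub_one_of_pos hs0
    linarith
  obtain ⟨E, hE⟩ : ∃ E, E = D - (d - 3) / 2 := ⟨_, rfl⟩
  have hsE : s = d * E := by rw [hE]; linarith
  have h4 : s ^ 2 * (L / d) = d * E ^ 2 * L := by
    rw [hsE]; field_simp
  have h5 : D * (D + 1) - E ^ 2 ≤ d * D := by
    rw [hE]; nlinarith
  have h6 : d * (D * (D + 1)) * L ≤ d * E ^ 2 * L + d * (d * D) * L := by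
    have : 0 ≤ d * L := by positivity
    nlinarith
  have h7 : d * (d * D) * L ≤ 4 * s ^ 2 := by
    have hDs : d * D ≤ 2 * s := by nlinarith
    calc d * (d * D) * L ≤ d * (d * D) * D := by gcongr
      _ = (d * D) ^ 2 := by ring
      _ ≤ (2 * s) ^ 2 := by gcongr
      _ = _ := by ring
  nlinarith [sq_nonneg s, mul_pos hs0 hs0]

/-- Either few points, or a nonsingular matrix of standard monomials evaluated at the points. -/
theorem card_le_or_exists_det_ne_zero {F : MvPolynomial (Fin 2) ℤ} {d : ℕ}
    (hF : Irreducible (map (Int.castRingHom ℚ) F)) (hFd : F.totalDegree ≤ d) (D : ℕ)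
    (S : Finset (Fin 2 → ℤ)) (hSF : ∀ P ∈ S, eval P F = 0) :
    S.card ≤ d * D ∨ ∃ P : stdExp (map (Int.castRingHom ℚ) F) D → Fin 2 → ℤ, (∀ i, P i ∈ S) ∧
      (Matrix.of fun i j : stdExp (map (Int.castRingHom ℚ) F) D =>
        eval (P i) (monomial j.1 (1 : ℤ))).det ≠ 0 := by
  classical
  obtain ⟨f, hf⟩ : ∃ f, f = map (Int.castRingHom ℚ) F := ⟨_, rfl⟩
  rw [← hf]
  by_cases h : ∀ v, (Matrix.of fun (P : S) (j : stdExp f D) =>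
      eval P.1 (monomial j.1 (1 : ℤ))).mulVec v = 0 → v = 0
  · obtain ⟨e, he⟩ := exists_minor_ne_zero _ h
    exact .inr ⟨fun i => (e i).1, fun i => (e i).2, he⟩
  · left
    push Not at h
    obtain ⟨v, hv, hv0⟩ := h
    obtain ⟨c, hc⟩ : ∃ c : (Fin 2 →₀ ℕ) → ℚ, c = fun m =>
      if hm : m ∈ stdExp f D then (v ⟨m, hm⟩ : ℚ) else 0 := ⟨_, rfl⟩
    have hcv : ∀ m : stdExp f D, c m = v m := fun m => by rw [hc]; simp
    refine card_common_int_zeros_le (g := ∑ i ∈ stdExp f D, monomial i (c i)) hF hFd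
      (totalDegree_std_sum_le c) (fun hdvd => hv0 ?_) S hSF fun P hP => ?_
    · rw [← hf] at hdvd
      have := std_sum_eq_zero (hf ▸ hF.ne_zero) c hdvd
      funext m
      have h2 := this m m.2
      rw [hcv] at h2
      exact_mod_cast h2
    · have h2 := congrFun hv ⟨P, hP⟩
      simp only [Matrix.mulVec, dotProduct, Matrix.of_apply, Pi.zero_apply] at h2
      have h3 := congrArg (Int.cast : ℤ → ℚ) h2
      rw [Int.cast_sum, Int.cast_zero] at h3
      rw [map_sum, ← Finset.sum_coe_sort, ← h3]
      refine Finset.sum_congr rfl fun m _ => ?_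
      rw [hcv, Int.cast_mul, ← eval_map_intCast, map_monomial, eval_monomial, eval_monomial]
      simp [mul_comm]

end PlaneCurves

section PlaneCurves

theorem exp_mul_rpow_eq {B : ℝ} (hB : 1 ≤ B) (k : ℕ) : B ^ k = Real.exp (k * Real.log B) := by
  rw [← Real.rpow_natCast, Real.rpow_def_of_pos (by linarith), mul_comm]

theorem log_height_bounds {F : MvPolynomial (Fin 2) ℤ} {d : ℕ} (hd : 1 ≤ d)
    (hF : F.totalDegree ≤ d) {B : ℝ} (hB : 1 ≤ B)
    (hH : ∀ m, |((coeff m F : ℤ) : ℝ)| ≤ Real.exp (22 * (d ^ 2 + d * Real.log B))) :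
    (∀ j₀ e, ruppertMinor F d j₀ e ≠ 0 → Real.log |((ruppertMinor F d j₀ e : ℤ) : ℝ)| ≤
      10000 * (d ^ 4 + d ^ 3 * Real.log B)) ∧
    ∀ P : Fin 2 → ℤ, (∀ i, (|P i| : ℝ) ≤ B) → eval P (pderiv 1 F) ≠ 0 →
      2 * Real.log |((eval P (pderiv 1 F) : ℤ) : ℝ)| ≤ 10000 * (d ^ 4 + d ^ 3 * Real.log B) := by
  have hL := Real.log_nonneg hB
  obtain ⟨L, hL'⟩ : ∃ L, L = Real.log B := ⟨_, rfl⟩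
  have hd1 : (1 : ℝ) ≤ d := by exact_mod_cast hd
  obtain ⟨x, hx⟩ : ∃ x : ℝ, x = d := ⟨_, rfl⟩
  have hlogd : Real.log d ≤ d := (Real.log_le_sub_one_of_pos (by linarith)).trans (by linarith)
  have hlog4 : Real.log 4 ≤ 2 := by
    rw [show (4 : ℝ) = 2 ^ 2 by norm_num, Real.log_pow]
    have := Real.log_two_lt_d9
    push_cast; linarith
  have hlogc : Real.log (4 * d ^ 3) ≤ 5 * d ^ 2 := by
    rw [Real.log_mul (by norm_num) (by positivity), Real.log_pow]
    push_cast; nlinarith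
  refine ⟨fun j₀ e hne => ?_, fun P hP hne => ?_⟩
  · have h1 := abs_ruppertMinor_le hd hF (Real.one_le_exp (by positivity)) hH j₀ e
    have h2 := Real.log_le_log (abs_pos.mpr (by exact_mod_cast hne)) h1
    rw [Real.log_pow, Real.log_mul (by positivity) (Real.exp_ne_zero _), Real.log_exp] at h2
    refine h2.trans ?_
    rw [← hL'] at hL ⊢
    calc ((d * (d + 1) : ℕ) : ℝ) * (Real.log (4 * d ^ 3) + 22 * (d ^ 2 + d * L))
        ≤ (2 * d ^ 2) * (5 * d ^ 2 + 22 * (d ^ 2 + d * L)) := by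
          refine mul_le_mul ?_ (by linarith) ?_ (by positivity)
          · push_cast; nlinarith
          · have : 0 ≤ Real.log (4 * d ^ 3) :=
              Real.log_nonneg (by have : (1 : ℝ) ≤ d ^ 3 := one_le_pow₀ hd1
                                  linarith)
            positivity
      _ = 54 * d ^ 4 + 44 * (d ^ 3 * L) := by ring
      _ ≤ _ := by
          have : 0 ≤ (d : ℝ) ^ 3 * L := by positivity
          have : 0 ≤ (d : ℝ) ^ 4 := by positivity
          linarith
  · have h1 := abs_eval_le (k := d) ((totalDegree_pderiv_le 1 F).trans (by lia)) hB
      (abs_coeff_pderiv_le hF hH 1) hP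
    have h0 : 0 < |((eval P (pderiv 1 F) : ℤ) : ℝ)| := abs_pos.mpr (by exact_mod_cast hne)
    have hch : ((d + 2).choose 2 : ℝ) ≤ 4 * d ^ 2 := by
      rw [Nat.cast_choose_two]
      push_cast; nlinarith
    have h2 : |((eval P (pderiv 1 F) : ℤ) : ℝ)| ≤ 4 * d ^ 3 *
        Real.exp (22 * (d ^ 2 + d * Real.log B) + d * Real.log B) := by
      refine h1.trans ?_
      rw [exp_mul_rpow_eq hB, Real.exp_add]
      calc _ ≤ 4 * (d : ℝ) ^ 2 * (d * Real.exp (22 * (d ^ 2 + d * Real.log B)) *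
            Real.exp (d * Real.log B)) := by gcongr
        _ = _ := by ring
    have h3 := Real.log_le_log h0 h2
    rw [Real.log_mul (by positivity) (Real.exp_ne_zero _), Real.log_exp] at h3
    rw [← hL'] at hL h3 ⊢
    have e1 : (d : ℝ) ^ 2 ≤ d ^ 4 := pow_le_pow_right₀ hd1 (by norm_num)
    have e2 : (d : ℝ) * L ≤ d ^ 3 * L :=
      mul_le_mul_of_nonneg_right (by simpa using pow_le_pow_right₀ hd1 (by norm_num : 1 ≤ 3)) hL
    have e3 : 0 ≤ (d : ℝ) ^ 3 * L := by positivity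
    have e4 : 0 ≤ (d : ℝ) ^ 4 := by positivity
    linarith

theorem determinant_parameters {d D Q s : ℕ} (hd : 1 ≤ d) (hD : D = Q / d + d)
    (hs : (2 * s : ℤ) = d * (2 * D - d + 3)) :
    d * D ≤ Q + d ^ 2 ∧ Q ≤ d * D ∧ Q ≤ s ∧ 1 ≤ s := by
  have h1 := Nat.div_add_mod Q d
  have h2 := Nat.mod_lt Q (by lia : 0 < d)
  have h3 : d * D = d * (Q / d) + d ^ 2 := by rw [hD]; ring
  have h4 : d ≤ d ^ 2 := by nlinarith
  have h5 : (2 * s : ℤ) = 2 * (d * D : ℕ) - (d ^ 2 : ℕ) + 3 * d := by rw [hs]; push_cast; ring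
  lia

theorem card_sdiff_filter_pderiv_le {F : MvPolynomial (Fin 2) ℤ} {d : ℕ}
    (hF : Irreducible (map (Int.castRingHom ℚ) F)) (hFd : F.totalDegree ≤ d)
    (hfd : (map (Int.castRingHom ℚ) F).totalDegree = d) (hd : 1 ≤ d) (hFy : pderiv 1 F ≠ 0)
    (S : Finset (Fin 2 → ℤ)) (hSF : ∀ P ∈ S, eval P F = 0) :
    S.card ≤ (S.filter fun P => eval P (pderiv 1 F) ≠ 0).card + d * d := by
  have h2 : (map (Int.castRingHom ℚ) (pderiv 1 F)).totalDegree ≤ d - 1 :=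
    (Finset.sup_mono (support_map_subset _ _)).trans
      ((totalDegree_pderiv_le 1 F).trans (Nat.sub_le_sub_right hFd 1))
  rw [← Finset.card_filter_add_card_filter_not (s := S) (fun P => eval P (pderiv 1 F) ≠ 0)]
  refine Nat.add_le_add_left ?_ _
  refine card_common_int_zeros_le (g := map (Int.castRingHom ℚ) (pderiv 1 F)) hF hFd
    (h2.trans (by lia)) (fun h => hFy ?_) _
    (fun P hP => hSF P (Finset.mem_filter.mp hP).1) fun P hP => ?_
  · exact map_injective (σ := Fin 2) (Int.castRingHom ℚ) (RingHom.injective_int _)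
      ((eq_zero_of_dvd_of_totalDegree_lt h (by lia)).trans (map_zero _).symm)
  · rw [eval_map_intCast, not_not.mp (Finset.mem_filter.mp hP).2, Int.cast_zero]

theorem exists_card_le_of_primitive : ∃ C : ℝ, 0 ≤ C ∧ ∀ {F : MvPolynomial (Fin 2) ℤ} {d : ℕ},
    F.totalDegree = d → 2 ≤ d → (∀ r : ℤ, (∀ m, r ∣ coeff m F) → IsUnit r) →
    ∀ {j₀ : Bool × expLE 2 (d - 1)} {e : {j // j ≠ j₀} → expLE 2 (2 * d)},
    ruppertMinor F d j₀ e ≠ 0 → ∀ {B : ℝ}, 1 ≤ B → ∀ S : Finset (Fin 2 → ℤ),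
    (∀ P ∈ S, ∀ i, (|P i| : ℝ) ≤ B) → (∀ P ∈ S, eval P F = 0) →
    (S.card : ℝ) ≤ C * d ^ 3 * B ^ (1 / (d : ℝ)) * (Real.log B + d) := by
  classical
  obtain ⟨K, hK0, hK⟩ := exists_determinant_lower_bound
  obtain ⟨C₁, hC₁⟩ : ∃ C₁, C₁ = Real.exp (K + 16) := ⟨_, rfl⟩
  have hC₁1 : 1 ≤ C₁ := hC₁ ▸ Real.one_le_exp (by linarith)
  refine ⟨10001 * C₁ + 3, by linarith, ?_⟩
  intro F d hFd hd hprim j₀ e hΔ B hB S hSB hSF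
  obtain ⟨L, hL'⟩ : ∃ L, L = Real.log B := ⟨_, rfl⟩
  obtain ⟨b, hb⟩ : ∃ b, b = B ^ (1 / (d : ℝ)) := ⟨_, rfl⟩
  have hd2 : (2 : ℝ) ≤ d := by exact_mod_cast hd
  have hd1 : (1 : ℝ) ≤ d := by linarith
  have hL : 0 ≤ L := hL' ▸ Real.log_nonneg hB
  have hb1 : 1 ≤ b := hb ▸ Real.one_le_rpow hB (by positivity)
  have hlb : Real.log b = L / d := by
    rw [hb, Real.log_rpow (by linarith), hL']; ring
  rw [← hb, ← hL']
  obtain ⟨W, hW⟩ : ∃ W, W = d ^ 3 * b * (L + d) := ⟨_, rfl⟩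
  have hW2 : (d : ℝ) ^ 2 ≤ W := by
    rw [hW]
    calc (d : ℝ) ^ 2 = d ^ 2 * 1 * 1 := by ring
      _ ≤ d ^ 3 * b * (L + d) := by
        have : (d : ℝ) ^ 2 ≤ d ^ 3 := pow_le_pow_right₀ hd1 (by norm_num)
        gcongr
        linarith
  have hW1 : 1 ≤ W := le_trans (by nlinarith) hW2
  have hgoal : (10001 * C₁ + 3) * d ^ 3 * b * (L + d) = (10001 * C₁ + 3) * W := by rw [hW]; ring
  rw [hgoal]
  by_cases hcard : S.card ≤ 3 * d ^ 2
  · have : (S.card : ℝ) ≤ 3 * d ^ 2 := by exact_mod_cast hcard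
    nlinarith
  obtain ⟨hF, hfd⟩ := irreducible_map_of_ruppertMinor_ne_zero (K := ℚ) (by lia) hFd.le
    (fun n hn _ => by exact_mod_cast (by lia : n ≠ 0)) (Int.cast_ne_zero.mpr hΔ)
  have hH := abs_coeff_le_of_card_le (by lia) hFd hF hprim hB hSB hSF (by lia)
  obtain ⟨hΔX, hPX⟩ := log_height_bounds (by lia) hFd.le hB hH
  rw [← hL'] at hΔX hPX
  obtain ⟨X, hX⟩ : ∃ X : ℕ, X = ⌈10000 * (d ^ 4 + d ^ 3 * L)⌉₊ := ⟨_, rfl⟩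
  have hXle : 10000 * (d ^ 4 + d ^ 3 * L) ≤ X := hX ▸ Nat.le_ceil _
  have hX4 : 10000 * d ^ 4 ≤ X := by
    have : (0 : ℝ) ≤ d ^ 3 * L := by positivity
    exact_mod_cast (by linarith : 10000 * (d : ℝ) ^ 4 ≤ X)
  have hX1 : (1 : ℝ) ≤ X := by
    have : 1 ≤ d ^ 4 := Nat.one_le_pow _ _ (by lia)
    exact_mod_cast (by lia : 1 ≤ X)
  have hdLX : d * L ≤ X := by
    have e1 : (d : ℝ) * L ≤ d ^ 3 * L :=
      mul_le_mul_of_nonneg_right (by simpa using pow_le_pow_right₀ hd1 (by norm_num : 1 ≤ 3)) hL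
    have e2 : (0 : ℝ) ≤ d ^ 4 := by positivity
    have e3 : (0 : ℝ) ≤ d ^ 3 * L := by positivity
    linarith
  obtain ⟨Q, hQ⟩ : ∃ Q : ℕ, Q = ⌈C₁ * X * b⌉₊ := ⟨_, rfl⟩
  have hQle : C₁ * X * b ≤ Q := hQ ▸ Nat.le_ceil _
  have hXQ : X ≤ Q := by
    have : (X : ℝ) ≤ C₁ * X * b := by
      calc (X : ℝ) = 1 * X * 1 := by ring
        _ ≤ C₁ * X * b := by gcongr
    exact_mod_cast this.trans hQle
  obtain ⟨D, hD⟩ : ∃ D, D = Q / d + d := ⟨_, rfl⟩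
  have hdD : d ≤ D := by lia
  obtain ⟨s, hs⟩ : ∃ s, s = (stdExp (map (Int.castRingHom ℚ) F) D).card := ⟨_, rfl⟩
  have hsD := two_mul_card_stdExp hfd hdD
  rw [← hs] at hsD
  obtain ⟨hdDQ, hQdD, hQs, hs1⟩ := determinant_parameters (by lia) hD hsD
  have hSS' := card_sdiff_filter_pderiv_le hF hFd.le hfd (by lia)
    (pderiv_ne_zero_of_ruppertMinor_ne_zero hd hΔ) S hSF
  obtain ⟨S', hS'⟩ : ∃ S', S' = S.filter fun P => eval P (pderiv 1 F) ≠ 0 := ⟨_, rfl⟩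
  have hS'S : S' ⊆ S := hS' ▸ Finset.filter_subset _ _
  rw [← hS'] at hSS'
  suffices hmain : S'.card ≤ d * D by
    have h1 : S.card ≤ Q + 2 * d ^ 2 := by rw [sq] at hdDQ ⊢; lia
    have h2 : (S.card : ℝ) ≤ Q + 2 * d ^ 2 := by exact_mod_cast h1
    have h3 : (Q : ℝ) ≤ C₁ * X * b + 1 := hQ ▸ (Nat.ceil_lt_add_one (by positivity)).le
    have h4 : (X : ℝ) ≤ 10000 * (d ^ 4 + d ^ 3 * L) + 1 :=
      hX ▸ (Nat.ceil_lt_add_one (by positivity)).le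
    have h5 : (X : ℝ) ≤ 10001 * (d ^ 3 * (L + d)) := by
      have e1 : (1 : ℝ) ≤ d ^ 4 := one_le_pow₀ hd1
      have e3 : (0 : ℝ) ≤ d ^ 3 * L := by positivity
      linarith
    have h6 : C₁ * X * b ≤ 10001 * C₁ * W := by
      calc C₁ * X * b ≤ C₁ * (10001 * (d ^ 3 * (L + d))) * b := by gcongr
        _ = _ := by rw [hW]; ring
    linarith
  rcases card_le_or_exists_det_ne_zero hF hFd.le D S' fun P hP => hSF P (hS'S hP) with h | h
  · exact h
  exfalso
  obtain ⟨P, hPS, hdet⟩ := h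
  have hP2 : ∀ i, eval (P i) (pderiv 1 F) ≠ 0 := fun i => by
    have := hPS i
    rw [hS'] at this
    exact (Finset.mem_filter.mp this).2
  have hPB : ∀ i j, (|P i j| : ℝ) ≤ B := fun i => hSB _ (hS'S (hPS i))
  have hlow := hK (by lia : 1 ≤ d) hX4 hXQ hFd.le hΔ ((hΔX _ _ hΔ).trans hXle)
    (fun j : stdExp (map (Int.castRingHom ℚ) F) D => monomial j.1 (1 : ℤ)) P
    (fun i => hSF _ (hS'S (hPS i))) hP2 (fun i => (hPX _ (hPB i) (hP2 i)).trans hXle) hdet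
  rw [Fintype.card_coe, ← hs] at hlow
  have hup := abs_det_le_of_columns (B := B) (w := fun j => j.1.degree)
    (Matrix.of fun i j : stdExp (map (Int.castRingHom ℚ) F) D =>
      eval (P i) (monomial j.1 (1 : ℤ))) fun i j => abs_eval_monomial_le hB (hPB i) le_rfl
  have hup2 := Real.log_le_log (abs_pos.mpr (Int.cast_ne_zero.mpr hdet)) hup
  rw [Fintype.card_coe, ← hs, Real.log_mul (by positivity) (by positivity), Real.log_pow,
    Finset.sum_coe_sort _ (fun m : Fin 2 →₀ ℕ => m.degree), ← hL'] at hup2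
  have hsum := sum_degree_stdExp_le (map (Int.castRingHom ℚ) F) D
  rw [hfd] at hsum
  have hsum' : 2 * ((∑ m ∈ stdExp (map (Int.castRingHom ℚ) F) D, m.degree : ℕ) : ℝ) ≤
      d * (D * (D + 1)) := by exact_mod_cast hsum
  have hfact : Real.log s.factorial ≤ s * Real.log s := by
    rw [← Real.log_pow]
    exact Real.log_le_log (by positivity) (by exact_mod_cast Nat.factorial_le_pow s)
  have hsR : 2 * (s : ℝ) = d * (2 * D - d + 3) := by exact_mod_cast hsD
  refine determinant_numeric (L := L) (lX := Real.log X) (lQ := Real.log Q) hd1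
    (by exact_mod_cast hdD : (d : ℝ) ≤ D) hsR (by exact_mod_cast hQs) hL ?_ ?_ ?_ hlow
  · have h1 : (Q : ℝ) ≤ d * D := by exact_mod_cast hQdD
    have h2 : (X : ℝ) ≤ Q := by exact_mod_cast hXQ
    exact le_of_mul_le_mul_left (hdLX.trans (h2.trans h1)) (by linarith)
  · have h1 := Real.log_le_log (by positivity) hQle
    rw [Real.log_mul (by positivity) (by positivity), Real.log_mul (by positivity) (by positivity),
      hlb, hC₁, Real.log_exp] at h1
    linarith
  · have h1 := mul_le_mul_of_nonneg_right hsum' hL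
    linarith

/-- Integral points on a plane curve whose geometric irreducibility is certified by a minor. -/
theorem exists_card_le_of_ruppertMinor : ∃ C : ℝ, 0 ≤ C ∧ ∀ {F : MvPolynomial (Fin 2) ℤ} {d : ℕ},
    F.totalDegree = d → 2 ≤ d →
    ∀ {j₀ : Bool × expLE 2 (d - 1)} {e : {j // j ≠ j₀} → expLE 2 (2 * d)},
    ruppertMinor F d j₀ e ≠ 0 → ∀ {B : ℝ}, 1 ≤ B → ∀ S : Finset (Fin 2 → ℤ),
    (∀ P ∈ S, ∀ i, (|P i| : ℝ) ≤ B) → (∀ P ∈ S, eval P F = 0) →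
    (S.card : ℝ) ≤ C * d ^ 3 * B ^ (1 / (d : ℝ)) * (Real.log B + d) := by
  obtain ⟨C, hC0, hC⟩ := exists_card_le_of_primitive
  refine ⟨C, hC0, ?_⟩
  intro F d hFd hd j₀ e hΔ B hB S hSB hSF
  obtain ⟨c, G, hc, rfl, hG⟩ := exists_primitive (F := F) (by rintro rfl; simp at hFd; lia)
  rw [ruppertMinor_C_mul] at hΔ
  refine hC ?_ hd hG (right_ne_zero_of_mul hΔ) hB S hSB fun P hP => ?_
  · rw [← hFd, totalDegree_mul_of_isDomain (by simpa using hc) (by rintro rfl; simp at hFd; lia),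
      totalDegree_C, zero_add]
  · have := hSF P hP
    rw [map_mul, eval_C] at this
    exact (mul_eq_zero.mp this).resolve_left hc

end PlaneCurves

theorem not_dvd_of_notMem_vars {σ K : Type*} [CommRing K] [IsDomain K] {f g : MvPolynomial σ K}
    {i : σ} (hf : pderiv i f ≠ 0) (hg : g ≠ 0) (hi : i ∉ g.vars) : ¬ f ∣ g := by
  rintro ⟨q, rfl⟩
  have h0 : degreeOf i (f * q) = 0 := by
    by_contra h
    exact hi (mem_vars_iff_degreeOf_ne_zero.2 h)
  rw [degreeOf_mul_eq (left_ne_zero_of_mul hg) (right_ne_zero_of_mul hg)] at h0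
  refine hf (pderiv_eq_zero_of_notMem_vars fun h => ?_)
  exact mem_vars_iff_degreeOf_ne_zero.1 h (by lia)

theorem totalDegree_map_intCast_le {σ : Type*} (q : MvPolynomial σ ℤ) :
    (map (Int.castRingHom ℚ) q).totalDegree ≤ q.totalDegree :=
  Finset.sup_mono (support_map_subset _ _)

theorem card_common_zeros_box_le {m d b : ℕ} {f g : MvPolynomial (Fin (m + 2)) ℤ}
    (hf : Irreducible (map (Int.castRingHom ℚ) f))
    (hfg : ¬ map (Int.castRingHom ℚ) f ∣ map (Int.castRingHom ℚ) g)
    (hfd : f.totalDegree ≤ d) (hgd : g.totalDegree ≤ 2 * d ^ 3) (hd : 1 ≤ d) (hb : 1 ≤ b)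
    (S : Finset (Fin (m + 2) → ℤ)) (hSb : ∀ P ∈ S, ∀ i, |P i| ≤ b)
    (hSf : ∀ P ∈ S, eval P f = 0) (hSg : ∀ P ∈ S, eval P g = 0) :
    S.card ≤ 2 * d ^ 4 * ((4 * m + 9) * d ^ 3 * b) ^ m := by
  have h := card_common_zeros_grid_le hf hfg b S hSb
    (fun P hP => by rw [eval_map_intCast, hSf P hP, Int.cast_zero])
    (fun P hP => by rw [eval_map_intCast, hSg P hP, Int.cast_zero])
  have h1 := (totalDegree_map_intCast_le f).trans hfd
  have h2 := (totalDegree_map_intCast_le g).trans hgd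
  have hd3 : d ≤ d ^ 3 := Nat.le_self_pow (by norm_num) d
  have h3 : d ^ 3 ≤ d ^ 3 * b := Nat.le_mul_of_pos_right _ hb
  have h4 : b ≤ d ^ 3 * b := Nat.le_mul_of_pos_left _ (by positivity)
  calc S.card ≤ _ := h
    _ ≤ d * (2 * d ^ 3) * (d + 2 * d ^ 3 + (m + 2) * (2 * b + 1) + m) ^ m := by
        refine Nat.mul_le_mul (by gcongr) ((Nat.choose_le_pow _ _).trans ?_)
        gcongr
    _ ≤ d * (2 * d ^ 3) * ((4 * m + 9) * d ^ 3 * b) ^ m := by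
        gcongr
        have h5 : (m + 2) * (2 * b + 1) ≤ (m + 2) * (3 * (d ^ 3 * b)) := by gcongr; lia
        have h6 : m ≤ m * (d ^ 3 * b) := Nat.le_mul_of_pos_right _ (by positivity)
        linarith
    _ = _ := by ring

theorem eval_aeval_sliceParam {m : ℕ} (Φ : MvPolynomial (Fin m ⊕ Fin m) ℤ) (a : Fin m → ℤ)
    (P : Fin (m + 2) → ℤ) :
    eval P (aeval (Sum.elim (fun j => C (a j)) fun j => X j.succ.succ - C (a j) * X 0) Φ) =
      eval (Sum.elim a fun j => P j.succ.succ - a j * P 0) Φ := by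
  rw [← coe_aeval_eq_eval, RingHom.coe_coe, ← AlgHom.comp_apply, comp_aeval]
  have : (fun i => (aeval P) (Sum.elim (fun j => (C (a j) : MvPolynomial (Fin (m + 2)) ℤ))
      (fun j => X j.succ.succ - C (a j) * X 0) i)) =
      Sum.elim a fun j => P j.succ.succ - a j * P 0 := by
    funext i
    rcases i with i | i <;> simp
  rw [this]
  rfl

theorem card_degenerate_slices_le {m d b : ℕ} {f : MvPolynomial (Fin (m + 2)) ℤ}
    {Φ : MvPolynomial (Fin m ⊕ Fin m) ℤ} {a k₀ : Fin m → ℤ}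
    (hf : Irreducible (map (Int.castRingHom ℚ) f)) (hf1 : pderiv 1 f ≠ 0)
    (hfd : f.totalDegree ≤ d) (hΦd : Φ.totalDegree ≤ 2 * d ^ 3)
    (hΦ : eval (Sum.elim a k₀) Φ ≠ 0) (hd : 1 ≤ d) (hb : 1 ≤ b)
    (S : Finset (Fin (m + 2) → ℤ)) (hSb : ∀ P ∈ S, ∀ i, |P i| ≤ b)
    (hSf : ∀ P ∈ S, eval P f = 0)
    (hSΦ : ∀ P ∈ S, eval (Sum.elim a fun j => P j.succ.succ - a j * P 0) Φ = 0) :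
    S.card ≤ 2 * d ^ 4 * ((4 * m + 9) * d ^ 3 * b) ^ m := by
  have hinj : Function.Injective (map (Int.castRingHom ℚ) :
      MvPolynomial (Fin (m + 2)) ℤ → MvPolynomial (Fin (m + 2)) ℚ) :=
    map_injective _ Int.cast_injective
  obtain ⟨w, hw⟩ : ∃ w : Fin m ⊕ Fin m → MvPolynomial (Fin (m + 2)) ℤ, w =
    Sum.elim (fun j => C (a j)) fun j => X j.succ.succ - C (a j) * X 0 := ⟨_, rfl⟩
  have hev (P) : eval P (aeval w Φ) = eval (Sum.elim a fun j => P j.succ.succ - a j * P 0) Φ := by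
    rw [hw, eval_aeval_sliceParam]
  have hdeg (i) : (w i).totalDegree ≤ 1 := by
    rw [hw]
    rcases i with i | i
    · simp only [Sum.elim_inl, totalDegree_C, zero_le]
    · simp only [Sum.elim_inr]
      refine (totalDegree_sub _ _).trans (max_le (by simp) ?_)
      exact (totalDegree_mul _ _).trans (by rw [totalDegree_C, totalDegree_X])
  have hne : aeval w Φ ≠ 0 := by
    intro h
    have := hev (Fin.cons 0 (Fin.cons 0 k₀))
    rw [h, map_zero] at this
    refine hΦ (Eq.trans ?_ this.symm)
    congr 3
    funext j
    simp
  have hvars : (1 : Fin (m + 2)) ∉ (aeval w Φ).vars := by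
    intro h
    obtain ⟨i, -, hi⟩ := mem_vars_bind₁ w Φ h
    rw [hw] at hi
    rcases i with i | i
    · simp only [Sum.elim_inl, vars_C, Finset.notMem_empty] at hi
    · rw [Sum.elim_inr] at hi
      have h1 := vars_sub_subset _ hi
      simp only [vars_X, Finset.mem_union, Finset.mem_singleton] at h1
      rcases h1 with h1 | h1
      · have := congrArg Fin.val h1
        simp at this
      · have := vars_mul _ _ h1
        rw [vars_C, vars_X, Finset.empty_union, Finset.mem_singleton] at this
        exact absurd (congrArg Fin.val this) (by simp)
  refine card_common_zeros_box_le hf (g := aeval w Φ) ?_ hfd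
    ((totalDegree_aeval_le hdeg Φ).trans hΦd) hd hb S hSb hSf
    (fun P hP => (hev P).trans (hSΦ P hP))
  refine not_dvd_of_notMem_vars (i := 1) ?_ ?_ ?_
  · rw [pderiv_map]
    exact fun h => hf1 (hinj (h.trans (map_zero _).symm))
  · exact fun h => hne (hinj (h.trans (map_zero _).symm))
  · exact fun h => hvars (vars_map _ _ h)

theorem exists_small_eval_ne_zero {σ : Type*} [Finite σ] {Φ : MvPolynomial σ ℤ} {D : ℕ}
    (hΦ : Φ ≠ 0) (hD : Φ.totalDegree ≤ D) :
    ∃ x : σ → ℤ, (∀ i, |x i| ≤ D) ∧ eval x Φ ≠ 0 := by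
  by_contra! h
  refine hΦ (eq_zero_of_eval_zero_at_prod_finset Φ (fun _ => Finset.Icc 0 (D : ℤ))
    (fun i => ?_) fun x hx => h x fun i => ?_)
  · have := (degreeOf_le_totalDegree Φ i).trans hD
    rw [Int.card_Icc]
    lia
  · have := Finset.mem_Icc.1 (hx i)
    rw [abs_of_nonneg this.1]
    exact this.2

theorem exists_card_slice_zeros_le : ∃ C : ℝ, 0 ≤ C ∧
    ∀ {m d : ℕ} {f : MvPolynomial (Fin (m + 2)) ℤ}, f.totalDegree = d → 2 ≤ d →
    ∀ {j₀ : Bool × expLE 2 (d - 1)} {e : {j // j ≠ j₀} → expLE 2 (2 * d)} {a k : Fin m → ℤ},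
    eval (Sum.elim a k) (ruppertMinor (genericSlice ℤ f) d j₀ e) ≠ 0 →
    ∀ {B : ℝ}, 1 ≤ B → ∀ S : Finset (Fin (m + 2) → ℤ), (∀ P ∈ S, ∀ i, (|P i| : ℝ) ≤ B) →
    (∀ P ∈ S, eval P f = 0) → (∀ P ∈ S, (fun j => P j.succ.succ - a j * P 0) = k) →
    (S.card : ℝ) ≤ C * d ^ 3 * B ^ (1 / (d : ℝ)) * (Real.log B + d) := by
  obtain ⟨C, hC, hcore⟩ := exists_card_le_of_ruppertMinor
  refine ⟨C, hC, fun {m d f} hfd hd {j₀ e a k} hne {B} hB S hSb hSf hSk => ?_⟩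
  rw [← ruppertMinor_map, genericSlice_specialize] at hne
  have hdeg : (slice a k f).totalDegree = d := by
    have h1 : (slice a k f).totalDegree ≤ d := (totalDegree_slice_le a k f).trans hfd.le
    have h2 := (irreducible_map_of_ruppertMinor_ne_zero (K := ℚ) (by lia) h1
      (fun n hn _ => by positivity) (Int.cast_ne_zero.2 hne)).2
    exact le_antisymm h1 (h2.symm.trans_le (totalDegree_map_intCast_le _))
  have hcoord (P) (hP : P ∈ S) :
      (Fin.cons (P 0) (Fin.cons (P 1) fun j => k j + a j * P 0) : Fin (m + 2) → ℤ) = P := by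
    funext i
    refine Fin.cases rfl (fun i => Fin.cases rfl (fun j => ?_) i) i
    have := congrFun (hSk P hP) j
    simp only [Fin.cons_succ]
    lia
  have hinj : Set.InjOn (fun P : Fin (m + 2) → ℤ => (![P 0, P 1] : Fin 2 → ℤ)) S := by
    intro P hP Q hQ h
    have h0 := congrFun h 0
    have h1 := congrFun h 1
    simp only [Matrix.cons_val_zero, Matrix.cons_val_one] at h0 h1
    rw [← hcoord P hP, ← hcoord Q hQ, h0, h1]
  rw [← Finset.card_image_of_injOn hinj]
  refine hcore hdeg hd hne hB _ ?_ ?_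
  · simp only [Finset.mem_image]
    rintro _ ⟨P, hP, rfl⟩ i
    fin_cases i
    · exact hSb P hP 0
    · exact hSb P hP 1
  · simp only [Finset.mem_image]
    rintro _ ⟨P, hP, rfl⟩
    rw [eval_slice]
    simp only [Matrix.cons_val_zero, Matrix.cons_val_one]
    rw [hcoord P hP]
    exact hSf P hP

theorem card_le_of_slices {m d b : ℕ} {M : ℝ} (hM : 0 ≤ M) (hd : 1 ≤ d) (hb : 1 ≤ b)
    {a : Fin m → ℤ} (ha : ∀ j, |a j| ≤ 2 * (d : ℤ) ^ 3) (S : Finset (Fin (m + 2) → ℤ))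
    (hSb : ∀ P ∈ S, ∀ i, |P i| ≤ b)
    (h : ∀ P ∈ S, (({Q ∈ S | (fun j => Q j.succ.succ - a j * Q 0) =
      fun j => P j.succ.succ - a j * P 0} : Finset _).card : ℝ) ≤ M) :
    (S.card : ℝ) ≤ (7 * d ^ 3 * b : ℝ) ^ m * M := by
  obtain ⟨φ, hφ⟩ : ∃ φ : (Fin (m + 2) → ℤ) → Fin m → ℤ,
    φ = fun P j => P j.succ.succ - a j * P 0 := ⟨_, rfl⟩
  have hd1 : (1 : ℤ) ≤ (d : ℤ) ^ 3 := one_le_pow₀ (by exact_mod_cast hd)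
  have hb1 : (1 : ℤ) ≤ b := by exact_mod_cast hb
  have hbd : (b : ℤ) ≤ d ^ 3 * b := by nlinarith
  obtain ⟨T, hT⟩ : ∃ T : Finset (Fin m → ℤ), T = Fintype.piFinset fun _ =>
    Finset.Icc (-(3 * (d : ℤ) ^ 3 * b)) (3 * (d : ℤ) ^ 3 * b) := ⟨_, rfl⟩
  have hmaps : ∀ P ∈ S, φ P ∈ T := by
    intro P hP
    rw [hT, hφ, Fintype.mem_piFinset]
    intro j
    rw [Finset.mem_Icc, ← abs_le]
    calc |P j.succ.succ - a j * P 0| ≤ |P j.succ.succ| + |a j * P 0| := abs_sub _ _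
      _ = |P j.succ.succ| + |a j| * |P 0| := by rw [abs_mul]
      _ ≤ b + 2 * (d : ℤ) ^ 3 * b := by
          gcongr
          · exact hSb P hP _
          · exact ha j
          · exact hSb P hP _
      _ ≤ 3 * (d : ℤ) ^ 3 * b := by linarith
  have hTc : (T.card : ℝ) ≤ (7 * d ^ 3 * b : ℝ) ^ m := by
    rw [hT, Fintype.card_piFinset, Finset.prod_const, Finset.card_univ, Fintype.card_fin,
      Int.card_Icc]
    push_cast
    gcongr
    have : ((3 * (d : ℤ) ^ 3 * b + 1 - -(3 * (d : ℤ) ^ 3 * b)).toNat : ℤ) ≤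
        7 * (d : ℤ) ^ 3 * b := by
      rw [sub_neg_eq_add, Int.toNat_of_nonneg (by positivity)]
      linarith
    exact_mod_cast this
  rw [Finset.card_eq_sum_card_fiberwise hmaps]
  push_cast
  calc ∑ k ∈ T, (({P ∈ S | φ P = k} : Finset _).card : ℝ) ≤ ∑ _k ∈ T, M := by
        refine Finset.sum_le_sum fun k _ => ?_
        rcases Finset.eq_empty_or_nonempty {P ∈ S | φ P = k} with h0 | ⟨P, hP⟩
        · rw [h0]
          simpa using hM
        · obtain ⟨hPS, rfl⟩ := Finset.mem_filter.1 hP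
          rw [hφ]
          exact h P hPS
    _ = T.card * M := by rw [Finset.sum_const, nsmul_eq_mul]
    _ ≤ _ := by gcongr

theorem abs_le_floor_of_abs_le {x : ℤ} {B : ℝ} (h : (|x| : ℝ) ≤ B) : |x| ≤ (⌊B⌋₊ : ℤ) := by
  rw [← Int.cast_abs, ← Nat.cast_natAbs] at h
  rw [Int.abs_eq_natAbs]
  exact_mod_cast Nat.le_floor (by exact_mod_cast h)

theorem card_zeros_box_le {n b : ℕ} {f : MvPolynomial (Fin (n + 1)) ℤ} (hf : f ≠ 0)
    (S : Finset (Fin (n + 1) → ℤ)) (hSb : ∀ P ∈ S, ∀ i, |P i| ≤ b)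
    (hSf : ∀ P ∈ S, eval P f = 0) : S.card ≤ f.totalDegree * (2 * b + 1) ^ n := by
  have h := schwartz_zippel_totalDegree hf (Finset.Icc (-(b : ℤ)) b)
  have hc : (Finset.Icc (-(b : ℤ)) b).card = 2 * b + 1 := by
    rw [Int.card_Icc]
    lia
  rw [hc, div_le_div_iff₀ (by positivity) (by positivity)] at h
  have hsub : S ⊆ {P ∈ Fintype.piFinset fun _ : Fin (n + 1) => Finset.Icc (-(b : ℤ)) b |
      eval P f = 0} := by
    intro P hP
    rw [Finset.mem_filter, Fintype.mem_piFinset]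
    exact ⟨fun i => Finset.mem_Icc.2 (abs_le.1 (hSb P hP i)), hSf P hP⟩
  refine (Finset.card_le_card hsub).trans (Nat.le_of_mul_le_mul_right ?_ (Nat.succ_pos (2 * b)))
  rw [mul_assoc, ← pow_succ]
  exact_mod_cast h

theorem exists_card_zeros_le_of_pderiv_ne_zero (m : ℕ) : ∃ c : ℝ, 0 ≤ c ∧
    ∀ {f : MvPolynomial (Fin (m + 2)) ℤ} {d : ℕ}, f.totalDegree = d → 2 ≤ d →
    Irreducible (map (Int.castRingHom ℚ) f) → pderiv 1 f ≠ 0 →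
    ∀ {B : ℝ}, 1 ≤ B → ∀ S : Finset (Fin (m + 2) → ℤ), (∀ P ∈ S, ∀ i, (|P i| : ℝ) ≤ B) →
    (∀ P ∈ S, eval P f = 0) →
    (S.card : ℝ) ≤ c * d ^ (3 * (m + 1)) * (B ^ m * B ^ (1 / (d : ℝ))) * (Real.log B + d) := by
  obtain ⟨C, hC, hcore⟩ := exists_card_slice_zeros_le
  refine ⟨2 * (4 * m + 9) ^ m + 7 ^ m * C, by positivity,
    fun {f d} hfd hd hf hf1 {B} hB S hSB hSf => ?_⟩
  classical
  obtain ⟨b, hb⟩ : ∃ b : ℕ, b = ⌊B⌋₊ := ⟨_, rfl⟩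
  have hb1 : 1 ≤ b := by rw [hb]; exact Nat.le_floor (by exact_mod_cast hB)
  have hbB : (b : ℝ) ≤ B := by rw [hb]; exact Nat.floor_le (by linarith)
  have hSb : ∀ P ∈ S, ∀ i, |P i| ≤ (b : ℤ) := fun P hP i => by
    rw [hb]
    exact abs_le_floor_of_abs_le (hSB P hP i)
  have hL : 0 ≤ Real.log B := Real.log_nonneg hB
  have hB0 : 0 ≤ B := by linarith
  have hBd : 1 ≤ B ^ (1 / (d : ℝ)) := Real.one_le_rpow hB (by positivity)
  have hsmall (n : ℕ) (h : n ≤ 2 * d ^ 4 * ((4 * m + 9) * d ^ 3 * b) ^ m) : (n : ℝ) ≤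
      2 * (4 * m + 9) ^ m * d ^ (3 * (m + 1)) * (B ^ m * B ^ (1 / (d : ℝ))) * (Real.log B + d) := by
    calc (n : ℝ) ≤ 2 * d ^ 4 * ((4 * m + 9) * d ^ 3 * b) ^ m := by exact_mod_cast h
      _ ≤ 2 * d ^ 4 * ((4 * m + 9) * d ^ 3 * B) ^ m := by gcongr
      _ = 2 * (4 * m + 9) ^ m * d ^ (3 * (m + 1)) * (B ^ m * 1) * (0 + d) := by
          rw [mul_pow, mul_pow]
          generalize (4 * (m : ℝ) + 9) ^ m = A
          ring
      _ ≤ _ := by gcongr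
  have hpos : 0 ≤ 7 ^ m * C * d ^ (3 * (m + 1)) * (B ^ m * B ^ (1 / (d : ℝ))) *
      (Real.log B + d) := by positivity
  refine le_trans ?_ (le_of_eq (show 2 * (4 * m + 9) ^ m * d ^ (3 * (m + 1)) *
      (B ^ m * B ^ (1 / (d : ℝ))) * (Real.log B + d) +
      7 ^ m * C * d ^ (3 * (m + 1)) * (B ^ m * B ^ (1 / (d : ℝ))) * (Real.log B + d) = _ by ring))
  by_cases hreg : ∃ P ∈ S, eval P (pderiv 1 f) ≠ 0
  · obtain ⟨P, hP, hP1⟩ := hreg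
    obtain ⟨j₀, e, hΦ, hΦd⟩ := exists_certificate hfd (by lia) hf (hSf P hP) hP1
    obtain ⟨x, hx, hxΦ⟩ := exists_small_eval_ne_zero hΦ hΦd
    rw [← Sum.elim_comp_inl_inr x] at hxΦ
    obtain ⟨a, ha⟩ : ∃ a, a = x ∘ Sum.inl := ⟨_, rfl⟩
    rw [← ha] at hxΦ
    rw [← Finset.card_filter_add_card_filter_not (s := S) (fun P =>
      eval (Sum.elim a fun j => P j.succ.succ - a j * P 0)
        (ruppertMinor (genericSlice ℤ f) d j₀ e) = 0), Nat.cast_add]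
    refine add_le_add (hsmall _ ?_) ?_
    · exact card_degenerate_slices_le hf hf1 hfd.le hΦd hxΦ (by lia) hb1 _
        (fun P hP => hSb P (Finset.mem_filter.1 hP).1)
        (fun P hP => hSf P (Finset.mem_filter.1 hP).1) fun P hP => (Finset.mem_filter.1 hP).2
    · have h := card_le_of_slices (M := C * d ^ 3 * B ^ (1 / (d : ℝ)) * (Real.log B + d))
        (d := d) (b := b) (a := a) (by positivity) (by lia) hb1
        (fun j => by rw [ha]; exact_mod_cast hx (Sum.inl j)) _
        (fun P hP => hSb P (Finset.mem_filter.1 hP).1) (fun P hP =>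
          hcore hfd hd (j₀ := j₀) (e := e) (Finset.mem_filter.1 hP).2 hB _
            (fun Q hQ => hSB Q (Finset.mem_filter.1 (Finset.mem_filter.1 hQ).1).1)
            (fun Q hQ => hSf Q (Finset.mem_filter.1 (Finset.mem_filter.1 hQ).1).1)
            fun Q hQ => (Finset.mem_filter.1 hQ).2)
      refine h.trans ?_
      calc _ ≤ (7 * d ^ 3 * B : ℝ) ^ m * (C * d ^ 3 * B ^ (1 / (d : ℝ)) * (Real.log B + d)) := by
            gcongr
        _ = _ := by ring
  · push Not at hreg
    refine (hsmall _ ?_).trans (le_add_of_nonneg_right hpos)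
    have hdeg : (pderiv 1 f).totalDegree ≤ d - 1 := hfd ▸ totalDegree_pderiv_le 1 f
    refine card_common_zeros_box_le hf (g := pderiv 1 f) (fun h => ?_) hfd.le ?_ (by lia) hb1 S
      hSb hSf hreg
    · rw [← pderiv_map] at h
      have hne : pderiv 1 (map (Int.castRingHom ℚ) f) ≠ 0 := by
        rw [pderiv_map]
        exact fun h => hf1 (map_injective _ Int.cast_injective (h.trans (map_zero _).symm))
      refine hne (eq_zero_of_dvd_of_totalDegree_lt h ?_)
      refine (totalDegree_pderiv_le _ _).trans_lt (Nat.sub_lt (Nat.pos_of_ne_zero fun h0 => ?_)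
        one_pos)
      exact hne (by rw [totalDegree_eq_zero_iff_eq_C.1 h0, pderiv_C])
    · have : d ≤ d ^ 3 := Nat.le_self_pow (by norm_num) d
      lia

theorem Irreducible.rename_equiv {σ K : Type*} [Field K] {p : MvPolynomial σ K}
    (hp : Irreducible p) (e : σ ≃ σ) : Irreducible (rename e p) :=
  (prime_rename_of_injective e.injective hp.prime).irreducible

theorem exists_card_zeros_le (m : ℕ) : ∃ c : ℝ, 0 ≤ c ∧
    ∀ {f : MvPolynomial (Fin (m + 2)) ℤ} {d : ℕ}, f.totalDegree = d → 2 ≤ d →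
    Irreducible (map (Int.castRingHom ℚ) f) →
    ∀ {B : ℝ}, 1 ≤ B → ∀ S : Finset (Fin (m + 2) → ℤ), (∀ P ∈ S, ∀ i, (|P i| : ℝ) ≤ B) →
    (∀ P ∈ S, eval P f = 0) →
    (S.card : ℝ) ≤ c * d ^ (3 * (m + 1)) * (B ^ m * B ^ (1 / (d : ℝ))) * (Real.log B + d) := by
  obtain ⟨c, hc, h⟩ := exists_card_zeros_le_of_pderiv_ne_zero m
  refine ⟨c, hc, fun {f d} hfd hd hf {B} hB S hSB hSf => ?_⟩
  classical
  obtain ⟨i, hi⟩ : ∃ i, pderiv i f ≠ 0 := by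
    by_contra! h0
    have := totalDegree_eq_zero_of_pderiv (fun n hn _ => by positivity) h0
    lia
  obtain ⟨e, he⟩ : ∃ e, e = Equiv.swap i 1 := ⟨_, rfl⟩
  have hinj : Function.Injective fun P : Fin (m + 2) → ℤ => P ∘ e :=
    e.surjective.injective_comp_right
  rw [← Finset.card_image_of_injective S hinj]
  refine h (f := rename e f) ((totalDegree_renameEquiv e f).trans hfd) hd ?_ ?_ hB _ ?_ ?_
  · rw [map_rename]
    exact hf.rename_equiv e
  · have h1 : e i = 1 := by rw [he, Equiv.swap_apply_left]
    rw [← h1, pderiv_rename e.injective]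
    exact fun h0 => hi (rename_injective e e.injective (h0.trans (map_zero _).symm))
  · simp only [Finset.mem_image]
    rintro _ ⟨P, hP, rfl⟩ j
    exact hSB P hP _
  · simp only [Finset.mem_image]
    rintro _ ⟨P, hP, rfl⟩
    rw [eval_rename, Function.comp_assoc]
    have : e ∘ e = id := by
      funext j
      rw [he]
      simp
    rw [this]
    exact hSf P hP

theorem card_zeros_le_of_totalDegree_eq_one {m : ℕ} {f : MvPolynomial (Fin (m + 2)) ℤ}
    (hf : f.totalDegree = 1) {B : ℝ} (hB : 1 ≤ B) (S : Finset (Fin (m + 2) → ℤ))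
    (hSB : ∀ P ∈ S, ∀ i, (|P i| : ℝ) ≤ B) (hSf : ∀ P ∈ S, eval P f = 0) :
    (S.card : ℝ) ≤ (3 * B) ^ (m + 1) := by
  have hf0 : f ≠ 0 := by
    rintro rfl
    simp at hf
  have h := card_zeros_box_le hf0 S (fun P hP i => abs_le_floor_of_abs_le (hSB P hP i)) hSf
  rw [hf, one_mul] at h
  have hbB : (⌊B⌋₊ : ℝ) ≤ B := Nat.floor_le (by linarith)
  calc (S.card : ℝ) ≤ (2 * ⌊B⌋₊ + 1) ^ (m + 1) := by exact_mod_cast h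
    _ ≤ _ := by
        gcongr
        linarith

/-- Effective Pila-type bound for irreducible affine hypersurfaces: for `n ≥ 2` there is
`c = c(n)` such that every irreducible (over ℚ) `f ∈ ℤ[x₁,…,xₙ]` of degree `d ≥ 1` satisfies
`N_aff(f,B) ≤ c·d^{3(n-1)}·B^{n-2+1/d}·(log B + d)` for all `B ≥ 1`. -/
theorem effective_pila_hypersurface (n : ℕ) (hn : 2 ≤ n) :
    ∃ c : ℝ, ∀ (f : MvPolynomial (Fin n) ℤ) (d : ℕ), f.totalDegree = d → 1 ≤ d →
      Irreducible (MvPolynomial.map (Int.castRingHom ℚ) f) →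
      ∀ B : ℝ, 1 ≤ B →
        (Naff f B : ℝ) ≤ c * (d : ℝ) ^ (3 * (n - 1))
          * B ^ ((n : ℝ) - 2 + 1 / (d : ℝ)) * (Real.log B + d) := by
  obtain ⟨m, rfl⟩ : ∃ m, n = m + 2 := ⟨n - 2, by lia⟩
  obtain ⟨c, hc, h⟩ := exists_card_zeros_le m
  refine ⟨3 ^ (m + 1) + c, fun f d hfd hd hf B hB => ?_⟩
  have hB0 : 0 < B := by linarith
  have hL : 0 ≤ Real.log B := Real.log_nonneg hB
  have hfin : {x : Fin (m + 2) → ℤ | eval x f = 0 ∧ ∀ i, (|x i| : ℝ) ≤ B}.Finite := by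
    refine (Set.Finite.pi' fun _ : Fin (m + 2) =>
      Set.finite_Icc (-(⌊B⌋₊ : ℤ)) ⌊B⌋₊).subset fun x hx i => ?_
    exact abs_le.1 (abs_le_floor_of_abs_le (hx.2 i))
  have hSB : ∀ P ∈ hfin.toFinset, ∀ i, (|P i| : ℝ) ≤ B := fun P hP =>
    (hfin.mem_toFinset.1 hP).2
  have hSf : ∀ P ∈ hfin.toFinset, eval P f = 0 := fun P hP => (hfin.mem_toFinset.1 hP).1
  rw [Naff, Set.ncard_eq_toFinset_card _ hfin]
  have hexp : B ^ (((m + 2 : ℕ) : ℝ) - 2 + 1 / (d : ℝ)) = B ^ m * B ^ (1 / (d : ℝ)) := by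
    rw [← Real.rpow_natCast, ← Real.rpow_add hB0]
    push_cast
    ring_nf
  rw [hexp, show m + 2 - 1 = m + 1 by lia]
  rcases hd.eq_or_lt with rfl | hd
  · refine (card_zeros_le_of_totalDegree_eq_one hfd hB _ hSB hSf).trans ?_
    calc (3 * B) ^ (m + 1) = 3 ^ (m + 1) * (B ^ m * B) * 1 := by ring
      _ ≤ (3 ^ (m + 1) + c) * (B ^ m * B) * (Real.log B + 1) := by
          gcongr <;> linarith
      _ = _ := by simp
  · refine (h hfd hd hf hB _ hSB hSf).trans ?_
    gcongr
    have : (0 : ℝ) ≤ 3 ^ (m + 1) := by positivity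
    linarith
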